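/- (Theorem 2.3, part (1), Lᵖ case) Let m > 2 be an integer and ν = η = ε = 1. Let (u, b, π) be a smooth solution of the 2½-dimensional Hall-MHD system on [0,T) × ℝ², Schwartz-class in the space variable for each t, with sup_{0≤t≤T'} (‖u(t)‖_{Hᵐ} + ‖b(t)‖_{Hᵐ}) < ∞ for every T' < T. Suppose there exist p ∈ (2,∞) and r ∈ [2,∞) with 2/p + 2/r ≤ 1 such that ∫₀ᵀ ‖Δ(Δu₃)(t,·)‖_{Lᵖ(ℝ²)}^{r} dt < ∞, where u₃ is the third component of the velocity and Δ = ∂₁² + ∂₂². Then sup_{0≤t<T} (‖u(t)‖_{Hᵐ} + ‖b(t)‖_{Hᵐ}) < ∞. -/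

import Mathlib

open MeasureTheory
open scoped ENNReal

noncomputable section

/-- Partial derivative in the `i`-th coordinate direction of `ℝ²`. -/
def pd (i : Fin 2) (f : (Fin 2 → ℝ) → ℝ) (x : Fin 2 → ℝ) : ℝ :=
  fderiv ℝ f x (Pi.single i 1)

/-- The Laplacian `Δ = ∂₁² + ∂₂²` of a scalar function on `ℝ²`. -/
def lap (f : (Fin 2 → ℝ) → ℝ) (x : Fin 2 → ℝ) : ℝ :=
  pd 0 (pd 0 f) x + pd 1 (pd 1 f) x

/-- The 2½-dimensional curl `∇×F = (∂₂F₃, −∂₁F₃, ∂₁F₂ − ∂₂F₁)` of `F : ℝ² → ℝ³`. -/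
def curl (F : (Fin 2 → ℝ) → (Fin 3 → ℝ)) (x : Fin 2 → ℝ) : Fin 3 → ℝ :=
  ![pd 1 (fun y => F y 2) x, -(pd 0 (fun y => F y 2) x),
    pd 0 (fun y => F y 1) x - pd 1 (fun y => F y 0) x]

/-- The advection term `(f·∇)g = f₁∂₁g + f₂∂₂g` for `f, g : ℝ² → ℝ³`. -/
def advect (f g : (Fin 2 → ℝ) → (Fin 3 → ℝ)) (x : Fin 2 → ℝ) (i : Fin 3) : ℝ :=
  f x 0 * pd 0 (fun y => g y i) x + f x 1 * pd 1 (fun y => g y i) x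

/-- A function is Schwartz-class: it is smooth and all its iterated derivatives decay
faster than any polynomial. -/
def IsSchwartz {F : Type*} [NormedAddCommGroup F] [NormedSpace ℝ F]
    (f : (Fin 2 → ℝ) → F) : Prop :=
  ContDiff ℝ (⊤ : ℕ∞) f ∧
    ∀ k n : ℕ, ∃ C : ℝ, ∀ x, ‖x‖ ^ k * ‖iteratedFDeriv ℝ n f x‖ ≤ C

/-- A smooth solution of the 2½-dimensional Hall-MHD system on `S × ℝ²`, Schwartz-class in
the space variable for each time `t ∈ S`:
`∂ₜu + (u·∇)u + ∇π = νΔu + (b·∇)b`, `∂ₜb + (u·∇)b = ηΔb + (b·∇)u − ε∇×(j×b)`,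
`∂₁u₁ + ∂₂u₂ = 0`, `∂₁b₁ + ∂₂b₂ = 0`, where `j = ∇×b`. -/
structure IsHallMHDSolution (ν η ε : ℝ) (S : Set ℝ)
    (u b : ℝ → (Fin 2 → ℝ) → (Fin 3 → ℝ)) (π : ℝ → (Fin 2 → ℝ) → ℝ) : Prop where
  smooth_u : ContDiffOn ℝ (⊤ : ℕ∞) (fun p : ℝ × (Fin 2 → ℝ) => u p.1 p.2) (S ×ˢ Set.univ)
  smooth_b : ContDiffOn ℝ (⊤ : ℕ∞) (fun p : ℝ × (Fin 2 → ℝ) => b p.1 p.2) (S ×ˢ Set.univ)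
  smooth_pi : ContDiffOn ℝ (⊤ : ℕ∞) (fun p : ℝ × (Fin 2 → ℝ) => π p.1 p.2) (S ×ˢ Set.univ)
  schwartz_u : ∀ t ∈ S, IsSchwartz (u t)
  schwartz_b : ∀ t ∈ S, IsSchwartz (b t)
  schwartz_pi : ∀ t ∈ S, IsSchwartz (π t)
  div_u : ∀ t ∈ S, ∀ x, pd 0 (fun y => u t y 0) x + pd 1 (fun y => u t y 1) x = 0
  div_b : ∀ t ∈ S, ∀ x, pd 0 (fun y => b t y 0) x + pd 1 (fun y => b t y 1) x = 0
  momentum : ∀ t ∈ S, ∀ x, ∀ i : Fin 3,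
    deriv (fun s => u s x i) t + advect (u t) (u t) x i
        + ![pd 0 (π t) x, pd 1 (π t) x, 0] i
      = ν * lap (fun y => u t y i) x + advect (b t) (b t) x i
  induction : ∀ t ∈ S, ∀ x, ∀ i : Fin 3,
    deriv (fun s => b s x i) t + advect (u t) (b t) x i
      = η * lap (fun y => b t y i) x + advect (b t) (u t) x i
        - ε * curl (fun y => crossProduct (curl (b t) y) (b t y)) x i

/-- The `Hᵐ(ℝ²)` norm: `‖f‖_{Hᵐ} = (∑_{k=0}^{m} ∫ ‖Dᵏf(x)‖² dx)^{1/2}`. -/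
def hSobNorm (m : ℕ) (f : (Fin 2 → ℝ) → (Fin 3 → ℝ)) : ℝ :=
  Real.sqrt (∑ k ∈ Finset.range (m + 1), ∫ x, ‖iteratedFDeriv ℝ k f x‖ ^ 2)

end

section
open MeasureTheory Set Filter Topology
open scoped ENNReal ContDiff

noncomputable section
namespace HM

abbrev E2 := Fin 2 → ℝ

lemma contDiff_pd {f : E2 → ℝ} (hf : ContDiff ℝ ∞ f) (i : Fin 2) : ContDiff ℝ ∞ (pd i f) := by
  have h : ContDiff ℝ ∞ (fderiv ℝ f) := hf.fderiv_right (by simp)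
  exact h.clm_apply contDiff_const

lemma sdiff {f : E2 → ℝ} (hf : ContDiff ℝ ∞ f) : Differentiable ℝ f :=
  hf.differentiable (by simp)

lemma pd_add {f g : E2 → ℝ} (hf : ContDiff ℝ ∞ f) (hg : ContDiff ℝ ∞ g) (i : Fin 2) :
    pd i (f + g) = pd i f + pd i g := by
  funext x
  simp only [pd, Pi.add_apply]
  rw [fderiv_add (sdiff hf x) (sdiff hg x)]; rfl

lemma pd_mul {f g : E2 → ℝ} (hf : ContDiff ℝ ∞ f) (hg : ContDiff ℝ ∞ g) (i : Fin 2) :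
    pd i (f * g) = f * pd i g + g * pd i f := by
  funext x
  simp only [pd, Pi.add_apply, Pi.mul_apply]
  rw [fderiv_mul (sdiff hf x) (sdiff hg x)]; rfl

lemma pd_const (c : ℝ) (i : Fin 2) : pd i (fun _ => c) = 0 := by
  funext x; simp [pd]

lemma pd_comm {f : E2 → ℝ} (hf : ContDiff ℝ ∞ f) (i j : Fin 2) :
    pd i (pd j f) = pd j (pd i f) := by
  have h : ContDiff ℝ ∞ (fderiv ℝ f) := hf.fderiv_right (by simp)
  have key : ∀ i j x, pd i (pd j f) x
      = fderiv ℝ (fderiv ℝ f) x (Pi.single i 1) (Pi.single j 1) := by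
    intro i j x
    have h1 : HasFDerivAt (fderiv ℝ f) (fderiv ℝ (fderiv ℝ f) x) x :=
      (h.differentiable (by simp) x).hasFDerivAt
    have h2 := h1.clm_apply (hasFDerivAt_const (Pi.single j (1:ℝ) : E2) x)
    unfold pd
    rw [h2.fderiv]; simp
  funext x
  rw [key, key]
  exact (hf.contDiffAt.isSymmSndFDerivAt (by simp; exact WithTop.coe_le_coe.2 le_top)) _ _

/-- decay with weight `k` of all partial derivatives up to order `n` -/
def Wt (k : ℕ) : ℕ → (E2 → ℝ) → Prop
  | 0, f => ∃ C : ℝ, ∀ x, |f x| * (1 + ‖x‖) ^ k ≤ C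
  | n + 1, f => (∃ C : ℝ, ∀ x, |f x| * (1 + ‖x‖) ^ k ≤ C) ∧ ∀ i, Wt k n (pd i f)

lemma Wt.zero {k n : ℕ} {f : E2 → ℝ} (h : Wt k n f) : Wt k 0 f := by
  cases n with
  | zero => exact h
  | succ n => exact h.1

lemma Wt.pred {k n : ℕ} : ∀ {f : E2 → ℝ}, Wt k (n+1) f → Wt k n f := by
  induction n with
  | zero => intro f h; exact h.1
  | succ n ih => intro f h; exact ⟨h.1, fun i => ih (h.2 i)⟩

lemma Wt.add {k n : ℕ} : ∀ {f g : E2 → ℝ}, ContDiff ℝ ∞ f → ContDiff ℝ ∞ g →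
    Wt k n f → Wt k n g → Wt k n (f + g) := by
  have base : ∀ {f g : E2 → ℝ}, Wt k 0 f → Wt k 0 g → Wt k 0 (f + g) := by
    rintro f g ⟨C, hC⟩ ⟨D, hD⟩
    refine ⟨C + D, fun x => ?_⟩
    have := abs_add_le (f x) (g x)
    have h0 : 0 ≤ (1 + ‖x‖) ^ k := by positivity
    calc |(f + g) x| * (1 + ‖x‖) ^ k ≤ (|f x| + |g x|) * (1 + ‖x‖) ^ k := by
          gcongr; exact this
      _ ≤ _ := by rw [add_mul]; exact add_le_add (hC x) (hD x)
  induction n with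
  | zero => intro f g _ _ h1 h2; exact base h1 h2
  | succ n ih =>
    intro f g hf hg h1 h2
    refine ⟨base h1.zero h2.zero, fun i => ?_⟩
    rw [pd_add hf hg]
    exact ih (contDiff_pd hf i) (contDiff_pd hg i) (h1.2 i) (h2.2 i)

lemma Wt.mul {k l n : ℕ} : ∀ {f g : E2 → ℝ}, ContDiff ℝ ∞ f → ContDiff ℝ ∞ g →
    Wt k n f → Wt l n g → Wt (k + l) n (f * g) := by
  have base : ∀ {f g : E2 → ℝ}, Wt k 0 f → Wt l 0 g → Wt (k + l) 0 (f * g) := by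
    rintro f g ⟨C, hC⟩ ⟨D, hD⟩
    refine ⟨C * D, fun x => ?_⟩
    calc |(f * g) x| * (1 + ‖x‖) ^ (k + l)
        = (|f x| * (1 + ‖x‖) ^ k) * (|g x| * (1 + ‖x‖) ^ l) := by
          simp only [Pi.mul_apply, abs_mul, pow_add]; ring
      _ ≤ C * D := mul_le_mul (hC x) (hD x) (by positivity)
          (le_trans (by positivity) (hC x))
  induction n with
  | zero => intro f g _ _ h1 h2; exact base h1 h2
  | succ n ih =>
    intro f g hf hg h1 h2
    refine ⟨base h1.zero h2.zero, fun i => ?_⟩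
    rw [pd_mul hf hg]
    refine Wt.add (hf.mul (contDiff_pd hg i)) (hg.mul (contDiff_pd hf i))
      (ih hf (contDiff_pd hg i) h1.pred (h2.2 i)) ?_
    rw [mul_comm]
    exact ih (contDiff_pd hf i) hg (h1.2 i) h2.pred

lemma Wt.const0 (n : ℕ) : ∀ c : ℝ, Wt 0 n (fun _ => c) := by
  induction n with
  | zero => intro c; exact ⟨|c|, fun x => by simp⟩
  | succ n ih =>
    intro c
    refine ⟨⟨|c|, fun x => by simp⟩, fun i => ?_⟩
    rw [pd_const]; exact ih 0

lemma Wt.zero_fun (k n : ℕ) : Wt k n (0 : E2 → ℝ) := by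
  induction n with
  | zero => exact ⟨0, fun x => by simp⟩
  | succ n ih =>
    refine ⟨⟨0, fun x => by simp⟩, fun i => ?_⟩
    have : pd i (0 : E2 → ℝ) = 0 := pd_const 0 i
    rw [this]; exact ih

/-- The algebra of smooth functions with all derivatives bounded. -/
def Aalg : Subalgebra ℝ (E2 → ℝ) where
  carrier := {f | ContDiff ℝ ∞ f ∧ ∀ n, Wt 0 n f}
  mul_mem' := fun ha hb => ⟨ha.1.mul hb.1, fun n => (ha.2 n).mul ha.1 hb.1 (hb.2 n)⟩
  add_mem' := fun ha hb => ⟨ha.1.add hb.1, fun n => (ha.2 n).add ha.1 hb.1 (hb.2 n)⟩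
  algebraMap_mem' := fun c => ⟨contDiff_const, fun n => Wt.const0 n c⟩

/-- The type of smooth functions with all derivatives bounded. -/
def A : Type := ↥Aalg

instance : CommRing A := inferInstanceAs (CommRing ↥Aalg)
instance : Algebra ℝ A := inferInstanceAs (Algebra ℝ ↥Aalg)
instance : CoeFun A (fun _ => E2 → ℝ) := ⟨fun f => Subtype.val (p := (· ∈ Aalg)) f⟩

def A.mk (f : E2 → ℝ) (h : ContDiff ℝ ∞ f) (h' : ∀ n, Wt 0 n f) : A :=
  (⟨f, h, h'⟩ : ↥Aalg)

lemma A.ext {f g : A} (h : ∀ x, f x = g x) : f = g :=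
  Subtype.ext (p := (· ∈ Aalg)) (funext h)

lemma A.smooth (f : A) : ContDiff ℝ ∞ f := (Subtype.property (p := (· ∈ Aalg)) f).1
lemma A.wt (f : A) : ∀ n, Wt 0 n f := (Subtype.property (p := (· ∈ Aalg)) f).2
lemma A.cont (f : A) : Continuous f := f.smooth.continuous
lemma A.diff (f : A) : Differentiable ℝ f := sdiff f.smooth

@[simp] lemma A.mk_apply (f : E2 → ℝ) (h h') (x : E2) : (A.mk f h h') x = f x := rfl
@[simp] lemma A.add_apply (f g : A) (x : E2) : (f + g) x = f x + g x := rfl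
@[simp] lemma A.sub_apply (f g : A) (x : E2) : (f - g) x = f x - g x := rfl
@[simp] lemma A.neg_apply (f : A) (x : E2) : (-f) x = - f x := rfl
@[simp] lemma A.mul_apply (f g : A) (x : E2) : (f * g) x = f x * g x := rfl
@[simp] lemma A.smul_apply (c : ℝ) (f : A) (x : E2) : (c • f) x = c * f x := rfl
@[simp] lemma A.zero_apply (x : E2) : (0 : A) x = 0 := rfl
@[simp] lemma A.one_apply (x : E2) : (1 : A) x = 1 := rfl
@[simp] lemma A.pow_apply (f : A) (n : ℕ) (x : E2) : (f ^ n) x = f x ^ n := rfl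

/-- partial derivatives as derivations -/
def P (i : Fin 2) : Derivation ℝ A A :=
  Derivation.mk'
    { toFun := fun f => A.mk (pd i f) (contDiff_pd f.smooth i) (fun n => (f.wt (n+1)).2 i)
      map_add' := fun f g => A.ext fun x => congrFun (pd_add f.smooth g.smooth i) x
      map_smul' := fun c f => A.ext fun x => by
        have h := pd_mul (f := fun _ => c) contDiff_const f.smooth i
        rw [pd_const] at h
        simp only [mul_zero, add_zero] at h
        exact congrFun h x }
    (fun f g => A.ext fun x => congrFun (pd_mul f.smooth g.smooth i) x)

lemma P_val (i : Fin 2) (f : A) : (⇑(P i f) : E2 → ℝ) = pd i f := rfl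
lemma P_apply (i : Fin 2) (f : A) (x : E2) : (P i f) x = pd i f x := rfl

lemma P_comm (i j : Fin 2) (f : A) : P i (P j f) = P j (P i f) :=
  A.ext fun x => congrFun (pd_comm f.smooth i j) x

@[simp] lemma P10 (f : A) : P 1 (P 0 f) = P 0 (P 1 f) := P_comm 1 0 f

lemma P_mul (i : Fin 2) (f g : A) : P i (f * g) = f * P i g + g * P i f := by
  rw [Derivation.leibniz]; rfl

/-- Decaying functions (weight 3, all derivatives). -/
def Sch (f : A) : Prop := ∀ n, Wt 3 n f

lemma Sch.add {f g : A} (hf : Sch f) (hg : Sch g) : Sch (f + g) :=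
  fun n => (hf n).add f.smooth g.smooth (hg n)
lemma Sch.zero : Sch 0 := fun n => Wt.zero_fun 3 n
lemma Sch.mul' {f : A} (hf : Sch f) (c : A) : Sch (c * f) := fun n => by
  have := (c.wt n).mul c.smooth f.smooth (hf n)
  rwa [zero_add] at this
lemma Sch.mul {f : A} (hf : Sch f) (c : A) : Sch (f * c) := by
  rw [mul_comm]; exact hf.mul' c
lemma Sch.neg {f : A} (hf : Sch f) : Sch (-f) := by
  have := hf.mul' (-1); rwa [neg_one_mul] at this
lemma Sch.sub {f g : A} (hf : Sch f) (hg : Sch g) : Sch (f - g) := by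
  rw [sub_eq_add_neg]; exact hf.add hg.neg
lemma Sch.smul {f : A} (hf : Sch f) (c : ℝ) : Sch (c • f) := by
  have := hf.mul' (algebraMap ℝ A c); rwa [← Algebra.smul_def] at this
lemma Sch.P {f : A} (hf : Sch f) (i : Fin 2) : Sch (P i f) := fun n => (hf (n+1)).2 i

lemma Sch.integrable {f : A} (hf : Sch f) : Integrable f := by
  obtain ⟨C, hC⟩ := hf 0
  have h : Integrable (fun x : E2 => C * (1 + ‖x‖) ^ (-(3:ℝ))) :=
    (integrable_one_add_norm (by simp; norm_num)).const_mul C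
  refine h.mono' f.cont.aestronglyMeasurable (Eventually.of_forall fun x => ?_)
  have h1 : (1 + ‖x‖) ^ (-(3:ℝ)) = ((1 + ‖x‖) ^ 3)⁻¹ := by
    rw [Real.rpow_neg (by positivity)]; norm_cast
  rw [h1, ← div_eq_mul_inv, le_div_iff₀ (by positivity)]
  exact hC x

/-- integral functional -/
def I (f : A) : ℝ := ∫ x, f x

lemma I_add {f g : A} (hf : Sch f) (hg : Sch g) : I (f + g) = I f + I g :=
  integral_add hf.integrable hg.integrable
lemma I_sub {f g : A} (hf : Sch f) (hg : Sch g) : I (f - g) = I f - I g :=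
  integral_sub hf.integrable hg.integrable
lemma I_neg (f : A) : I (-f) = - I f := integral_neg _
lemma I_smul (c : ℝ) (f : A) : I (c • f) = c * I f := integral_const_mul c _

lemma I_P {f : A} (hf : Sch f) (i : Fin 2) : I (P i f) = 0 := by
  have := integral_mul_fderiv_eq_neg_fderiv_mul_of_integrable (μ := (volume : Measure E2))
    (f := fun _ : E2 => (1:ℝ)) (g := f) (v := Pi.single i 1)
    (by simp) (by simpa using! (hf.P i).integrable) (by simpa using! hf.integrable)
    (fun x _ => by fun_prop) (fun x _ => f.diff x)
  simpa using! this

/-- integration by parts in divergence form -/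
lemma ibp {e₁ e₂ f g : A} (hf : Sch f) (hg : Sch g) (h : e₁ = e₂ + P 0 f + P 1 g) :
    I e₁ = I e₂ := by
  have h1 : Sch (P 0 f + P 1 g) := (hf.P 0).add (hg.P 1)
  have h0 : I (P 0 f + P 1 g) = 0 := by rw [I_add (hf.P 0) (hg.P 1), I_P hf, I_P hg, add_zero]
  by_cases h2 : Integrable e₂
  · have : I (e₂ + (P 0 f + P 1 g)) = I e₂ + I (P 0 f + P 1 g) :=
      integral_add h2 h1.integrable
    rw [h, add_assoc, this, h0, add_zero]
  · have h3 : ¬ Integrable e₁ := by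
      intro h3; apply h2
      have : e₂ = e₁ - (P 0 f + P 1 g) := by rw [h]; ring
      rw [this]
      exact h3.sub h1.integrable
    rw [I, I, integral_undef h2, integral_undef h3]

lemma I_mono {f g : A} (hf : Sch f) (hg : Sch g) (h : ∀ x, f x ≤ g x) : I f ≤ I g :=
  integral_mono hf.integrable hg.integrable h

lemma I_nonneg {f : A} (h : ∀ x, 0 ≤ f x) : 0 ≤ I f := integral_nonneg h

/-- square of the L2 norm -/
def sq (f : A) : ℝ := I (f * f)

lemma sq_nn (f : A) : 0 ≤ sq f := I_nonneg fun x => mul_self_nonneg (f x)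

lemma sq_neg' (f : A) : sq (-f) = sq f := by unfold sq; congr 1; ring

lemma sq_add_le {f g : A} (hf : Sch f) (hg : Sch g) : sq (f + g) ≤ 2 * sq f + 2 * sq g := by
  unfold sq
  rw [← I_smul, ← I_smul, ← I_add ((hf.mul _).smul _) ((hg.mul _).smul _)]
  refine I_mono ((hf.add hg).mul _) (((hf.mul _).smul _).add ((hg.mul _).smul _)) fun x => ?_
  simp only [A.add_apply, A.mul_apply, A.smul_apply]
  nlinarith [sq_nonneg (f x - g x)]

lemma sq_sub_le {f g : A} (hf : Sch f) (hg : Sch g) : sq (f - g) ≤ 2 * sq f + 2 * sq g := by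
  rw [sub_eq_add_neg]; have := sq_add_le hf hg.neg; rwa [sq_neg'] at this

lemma sq_smul (c : ℝ) (f : A) : sq (c • f) = c ^ 2 * sq f := by
  unfold sq; rw [smul_mul_smul_comm, I_smul]; ring

/-- Cauchy-Schwarz -/
lemma cs {f g : A} (hf : Sch f) (hg : Sch g) : (I (f * g)) ^ 2 ≤ sq f * sq g := by
  have key : ∀ t : ℝ, 0 ≤ sq g * (t * t) + (2 * I (f * g)) * t + sq f := by
    intro t
    have h : sq (f + t • g) = sq g * (t * t) + (2 * I (f * g)) * t + sq f := by
      have e : (f + t • g) * (f + t • g) = f * f + (((2 * t) • (f * g)) + ((t * t) • (g * g))) := by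
        apply A.ext; intro x
        simp only [A.add_apply, A.mul_apply, A.smul_apply]
        ring
      unfold sq
      rw [e, I_add (hf.mul _) (((hf.mul _).smul _).add ((hg.mul _).smul _)),
        I_add ((hf.mul _).smul _) ((hg.mul _).smul _), I_smul, I_smul]
      ring
    rw [← h]; exact sq_nn _
  have := discrim_le_zero key
  unfold discrim at this
  nlinarith

lemma young {f g : A} (hf : Sch f) (hg : Sch g) {δ : ℝ} (hδ : 0 < δ) :
    |I (f * g)| ≤ δ * sq f + (4 * δ)⁻¹ * sq g := by
  apply abs_le_of_sq_le_sq
  · have h1 := cs hf hg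
    have : sq f * sq g ≤ (δ * sq f + (4 * δ)⁻¹ * sq g) ^ 2 := by
      have e : (δ * sq f + (4 * δ)⁻¹ * sq g) ^ 2 - sq f * sq g = (δ * sq f - (4 * δ)⁻¹ * sq g) ^ 2 := by
        field_simp; ring
      nlinarith [sq_nonneg (δ * sq f - (4 * δ)⁻¹ * sq g)]
    linarith
  · have := sq_nn f; have := sq_nn g; positivity

end HM
end
end

section
open MeasureTheory Set Filter Topology
open scoped ENNReal ContDiff

noncomputable section
namespace HM

lemma Sch.bound {f : A} (hf : Sch f) : ∃ C : ℝ, 0 ≤ C ∧ ∀ x, |f x| ≤ C * (1 + ‖x‖) ^ (-(3:ℝ)) := by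
  obtain ⟨C, hC⟩ := hf 0
  refine ⟨C, le_trans (by positivity) (hC 0), fun x => ?_⟩
  have h1 : (1 + ‖x‖) ^ (-(3:ℝ)) = ((1 + ‖x‖) ^ 3)⁻¹ := by
    rw [Real.rpow_neg (by positivity)]; norm_cast
  rw [h1, ← div_eq_mul_inv, le_div_iff₀ (by positivity)]
  exact hC x

lemma norm_le_vec (a b : ℝ) : ‖a‖ ≤ ‖(![a, b] : E2)‖ ∧ ‖b‖ ≤ ‖(![a, b] : E2)‖ :=
  ⟨norm_le_pi_norm (![a, b] : E2) 0, norm_le_pi_norm (![a, b] : E2) 1⟩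

lemma cont_vec : Continuous (fun p : ℝ × ℝ => (![p.1, p.2] : E2)) := by
  refine continuous_pi fun i => ?_
  fin_cases i
  · exact continuous_fst
  · exact continuous_snd

lemma rpow_anti {a b : ℝ} (ha : 0 ≤ a) (h : a ≤ b) : (1 + b) ^ (-(3:ℝ)) ≤ (1 + a) ^ (-(3:ℝ)) :=
  Real.rpow_le_rpow_of_nonpos (by linarith) (by linarith) (by norm_num)

lemma bound_slice {f : A} (hf : Sch f) : ∃ C : ℝ, 0 ≤ C ∧ ∀ a b : ℝ,
    |f ![a, b]| ≤ C * (1 + ‖a‖) ^ (-(3:ℝ)) ∧ |f ![a, b]| ≤ C * (1 + ‖b‖) ^ (-(3:ℝ)) := by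
  obtain ⟨C, hC0, hC⟩ := hf.bound
  refine ⟨C, hC0, fun a b => ⟨(hC _).trans ?_, (hC _).trans ?_⟩⟩
  · exact mul_le_mul_of_nonneg_left (rpow_anti (norm_nonneg _) (norm_le_vec a b).1) hC0
  · exact mul_le_mul_of_nonneg_left (rpow_anti (norm_nonneg _) (norm_le_vec a b).2) hC0

lemma int_jb (C : ℝ) : Integrable (fun a : ℝ => C * (1 + ‖a‖) ^ (-(3:ℝ))) :=
  (integrable_one_add_norm (by simp)).const_mul C

lemma slice0 {f : A} (hf : Sch f) (b : ℝ) : Integrable (fun a : ℝ => f ![a, b]) := by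
  obtain ⟨C, -, hC⟩ := bound_slice hf
  refine (int_jb C).mono' ?_ (Eventually.of_forall fun a => (hC a b).1)
  exact (f.cont.comp (cont_vec.comp (by fun_prop : Continuous fun a : ℝ => (a, b)))).aestronglyMeasurable

lemma slice1 {f : A} (hf : Sch f) (a : ℝ) : Integrable (fun b : ℝ => f ![a, b]) := by
  obtain ⟨C, -, hC⟩ := bound_slice hf
  refine (int_jb C).mono' ?_ (Eventually.of_forall fun b => (hC a b).2)
  exact (f.cont.comp (cont_vec.comp (by fun_prop : Continuous fun b : ℝ => (a, b)))).aestronglyMeasurable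

lemma jb_tendsto (C : ℝ) : Tendsto (fun a : ℝ => C * (1 + ‖a‖) ^ (-(3:ℝ))) atBot (𝓝 0) := by
  have h1 : Tendsto (fun a : ℝ => 1 + ‖a‖) atBot atTop :=
    tendsto_atTop_add_const_left _ _ tendsto_abs_atBot_atTop
  have := ((tendsto_rpow_neg_atTop (by norm_num : (0:ℝ) < 3)).comp h1).const_mul C
  simpa using this

lemma hasDeriv0 (f : A) (a b : ℝ) : HasDerivAt (fun s : ℝ => f ![s, b]) ((P 0 f) ![a, b]) a := by
  have h1 : HasFDerivAt f (fderiv ℝ f ![a, b]) ![a, b] := (f.diff _).hasFDerivAt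
  have h2 : HasDerivAt (fun s : ℝ => (![s, b] : E2)) (Pi.single 0 1) a := by
    rw [hasDerivAt_pi]
    intro i; fin_cases i
    · exact hasDerivAt_id a
    · simpa using hasDerivAt_const a b
  exact h1.comp_hasDerivAt a h2

lemma hasDeriv1 (f : A) (a b : ℝ) : HasDerivAt (fun s : ℝ => f ![a, s]) ((P 1 f) ![a, b]) b := by
  have h1 : HasFDerivAt f (fderiv ℝ f ![a, b]) ![a, b] := (f.diff _).hasFDerivAt
  have h2 : HasDerivAt (fun s : ℝ => (![a, s] : E2)) (Pi.single 1 1) b := by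
    rw [hasDerivAt_pi]
    intro i; fin_cases i
    · simpa using hasDerivAt_const b a
    · exact hasDerivAt_id b
  exact h1.comp_hasDerivAt b h2

lemma sup_1d {φ φ' : ℝ → ℝ} (h : ∀ s, HasDerivAt φ (φ' s) s) (hi : Integrable φ')
    (h0 : Tendsto φ atBot (𝓝 0)) (a : ℝ) : |φ a| ≤ ∫ s, |φ' s| := by
  have := integral_Iic_of_hasDerivAt_of_tendsto' (a := a) (fun x _ => h x) hi.integrableOn h0
  rw [sub_zero] at this
  rw [← this]
  calc |∫ x in Iic a, φ' x| ≤ ∫ x in Iic a, |φ' x| := abs_integral_le_integral_abs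
    _ ≤ _ := setIntegral_le_integral hi.abs (Eventually.of_forall fun x => abs_nonneg _)

lemma le_slice0 {f : A} (hf : Sch f) (a b : ℝ) : |f ![a, b]| ≤ ∫ s, |(P 0 f) ![s, b]| := by
  refine sup_1d (φ := fun s => f ![s, b]) (fun s => hasDeriv0 f s b) (slice0 (hf.P 0) b) ?_ a
  obtain ⟨C, -, hC⟩ := bound_slice hf
  exact squeeze_zero_norm (fun s => (hC s b).1) (jb_tendsto C)

lemma le_slice1 {f : A} (hf : Sch f) (a b : ℝ) : |f ![a, b]| ≤ ∫ s, |(P 1 f) ![a, s]| := by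
  refine sup_1d (φ := fun s => f ![a, s]) (fun s => hasDeriv1 f a s) (slice1 (hf.P 1) a) ?_ b
  obtain ⟨C, -, hC⟩ := bound_slice hf
  exact squeeze_zero_norm (fun s => (hC a s).2) (jb_tendsto C)

lemma mp_vec : MeasurePreserving (fun p : ℝ × ℝ => (![p.1, p.2] : E2)) volume volume :=
  (volume_preserving_finTwoArrow ℝ).symm _

lemma emb_vec : MeasurableEmbedding (fun p : ℝ × ℝ => (![p.1, p.2] : E2)) :=
  (MeasurableEquiv.finTwoArrow (α := ℝ)).symm.measurableEmbedding

lemma int_vec (h : E2 → ℝ) : ∫ x, h x = ∫ p : ℝ × ℝ, h ![p.1, p.2] :=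
  (mp_vec.integral_comp emb_vec h).symm

lemma integrable_vec {h : E2 → ℝ} (hh : Integrable h) :
    Integrable (fun p : ℝ × ℝ => h ![p.1, p.2]) (volume.prod volume) :=
  (mp_vec.integrable_comp_emb emb_vec).2 hh

lemma l1_sobolev {f : A} (hf : Sch f) :
    ∫ x, f x ^ 2 ≤ (∫ x, |(P 0 f) x|) * (∫ x, |(P 1 f) x|) := by
  have i0 := integrable_vec (hf.P 0).integrable.abs
  have i1 := integrable_vec (hf.P 1).integrable.abs
  have e0 : ∫ x, |(P 0 f) x| = ∫ b, ∫ s, |(P 0 f) ![s, b]| := by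
    rw [int_vec]; exact integral_prod_symm _ i0
  have e1 : ∫ x, |(P 1 f) x| = ∫ a, ∫ s, |(P 1 f) ![a, s]| := by
    rw [int_vec]; exact integral_prod _ i1
  rw [e0, e1, int_vec, mul_comm, ← integral_prod_mul]
  refine integral_mono_of_nonneg (Eventually.of_forall fun p => sq_nonneg _) ?_
    (Eventually.of_forall fun p => ?_)
  · exact i1.integral_prod_left.mul_prod i0.integral_prod_right
  · have h0 := le_slice0 hf p.1 p.2
    have h1 := le_slice1 hf p.1 p.2
    show f ![p.1, p.2] ^ 2 ≤ _
    rw [← sq_abs, pow_two]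
    exact mul_le_mul h1 h0 (abs_nonneg _) ((abs_nonneg _).trans h1)

lemma sup_l1 {f : A} (hf : Sch f) (x : E2) : |f x| ≤ ∫ y, |(P 0 (P 1 f)) y| := by
  have i0 := integrable_vec ((hf.P 0).P 1).integrable.abs
  have hx : x = ![x 0, x 1] := by
    funext i; fin_cases i <;> rfl
  rw [← P10, int_vec, hx]
  have e : ∫ p : ℝ × ℝ, |(P 1 (P 0 f)) ![p.1, p.2]| = ∫ s, ∫ r, |(P 1 (P 0 f)) ![s, r]| :=
    integral_prod _ i0
  rw [e]
  refine (le_slice0 hf _ _).trans ?_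
  refine integral_mono (slice0 (hf.P 0) _).abs i0.integral_prod_left fun s => ?_
  exact le_slice1 (hf.P 0) s _

lemma l1_prod {f g : A} (hf : Sch f) (hg : Sch g) :
    (∫ x, |f x * g x|) ^ 2 ≤ sq f * sq g := by
  have h := integral_mul_le_Lp_mul_Lq_of_nonneg (μ := (volume : Measure E2)) (p := 2) (q := 2)
    Real.HolderConjugate.two_two
    (f := fun x => |f x|) (g := fun x => |g x|)
    (Eventually.of_forall fun x => abs_nonneg _) (Eventually.of_forall fun x => abs_nonneg _)
    ?_ ?_
  · have e : ∀ h : A, ∫ x, |h x| ^ (2:ℝ) = sq h := by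
      intro h; unfold sq I; congr 1; funext x
      rw [A.mul_apply, ← abs_mul_abs_self]
      norm_cast; ring
    rw [e, e] at h
    simp only [← abs_mul] at h
    rw [← Real.sqrt_eq_rpow, ← Real.sqrt_eq_rpow, ← Real.sqrt_mul (sq_nn f)] at h
    calc _ ≤ (√(sq f * sq g)) ^ 2 := by
          gcongr
      _ = _ := Real.sq_sqrt (mul_nonneg (sq_nn f) (sq_nn g))
  all_goals
    rw [show ENNReal.ofReal 2 = 2 by simp]
  · refine (memLp_two_iff_integrable_sq (f.cont.abs.aestronglyMeasurable)).2 ?_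
    refine (hf.mul f).integrable.congr (Eventually.of_forall fun x => ?_)
    simp [pow_two]
  · refine (memLp_two_iff_integrable_sq (g.cont.abs.aestronglyMeasurable)).2 ?_
    refine (hg.mul g).integrable.congr (Eventually.of_forall fun x => ?_)
    simp [pow_two]

/-- gradient energy -/
def gr (f : A) : ℝ := sq (P 0 f) + sq (P 1 f)
lemma gr_nn (f : A) : 0 ≤ gr f := add_nonneg (sq_nn _) (sq_nn _)

/-- Ladyzhenskaya -/
lemma lady {f : A} (hf : Sch f) : sq (f * f) ≤ 4 * (sq f * gr f) := by
  have h := l1_sobolev (hf.mul f)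
  have e : ∀ i, ∫ x, |(P i (f * f)) x| = 2 * ∫ x, |f x * (P i f) x| := by
    intro i
    rw [← integral_const_mul]; congr 1; funext x
    rw [P_mul]; simp only [A.add_apply, A.mul_apply]
    rw [← two_mul, abs_mul]; simp
  rw [e, e] at h
  have e2 : ∫ x, (f * f) x ^ 2 = sq (f * f) := by
    unfold sq I; congr 1; funext x; simp [pow_two]
  rw [e2] at h
  have h0 := l1_prod hf (hf.P 0)
  have h1 := l1_prod hf (hf.P 1)
  have n0 : 0 ≤ ∫ x, |f x * (P 0 f) x| := integral_nonneg fun x => abs_nonneg _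
  have n1 : 0 ≤ ∫ x, |f x * (P 1 f) x| := integral_nonneg fun x => abs_nonneg _
  have := mul_nonneg (sq_nn f) (gr_nn f)
  unfold gr at *
  nlinarith [sq_nonneg ((∫ x, |f x * (P 0 f) x|) - ∫ x, |f x * (P 1 f) x|)]

/-- product estimate from Ladyzhenskaya -/
lemma lady2 {f g : A} (hf : Sch f) (hg : Sch g) :
    sq (f * g) ^ 2 ≤ 16 * ((sq f * gr f) * (sq g * gr g)) := by
  have h : sq (f * g) = I ((f * f) * (g * g)) := by unfold sq; congr 1; ring
  have h1 := cs (hf.mul f) (hg.mul g)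
  rw [← h] at h1
  have a := lady hf
  have b := lady hg
  have c := mul_le_mul a b (sq_nn _) (by have := mul_nonneg (sq_nn f) (gr_nn f); positivity)
  nlinarith

/-- H2 norm dominating the sup norm -/
lemma agmon {f : A} (hf : Sch f) (x : E2) : f x ^ 2 ≤ sq f + gr f + sq (P 0 (P 1 f)) := by
  have h := sup_l1 (hf.mul f) x
  have e : P 0 (P 1 (f * f)) = (2:ℝ) • (f * P 0 (P 1 f) + P 0 f * P 1 f) := by
    rw [two_smul, P_mul]; simp only [map_add, P_mul]; ring
  rw [e] at h
  have h1 : f x ^ 2 ≤ |(f * f) x| := by rw [A.mul_apply, ← pow_two, abs_of_nonneg (sq_nonneg _)]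
  refine h1.trans (h.trans ?_)
  have h2 : sq f + gr f + sq (P 0 (P 1 f)) =
      I (f * f + (P 0 f * P 0 f + (P 1 f * P 1 f + P 0 (P 1 f) * P 0 (P 1 f)))) := by
    rw [I_add, I_add, I_add]
    · unfold gr sq; ring
    all_goals
      simp (maxDischargeDepth := 30) only [Sch.add, Sch.mul, Sch.P, hf]
  rw [h2]
  refine integral_mono ?_ ?_ fun y => ?_
  · exact (Sch.smul ((hf.mul _).add ((hf.P 0).mul _)) _).integrable.abs
  · exact (Sch.add (hf.mul _) (Sch.add ((hf.P 0).mul _) (Sch.add ((hf.P 1).mul _) (((hf.P 1).P 0).mul _)))).integrable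
  · simp only [A.add_apply, A.mul_apply, A.smul_apply]
    rw [abs_le]
    constructor <;> nlinarith [sq_nonneg (f y + (P 0 (P 1 f)) y), sq_nonneg (f y - (P 0 (P 1 f)) y),
      sq_nonneg ((P 0 f) y + (P 1 f) y), sq_nonneg ((P 0 f) y - (P 1 f) y)]

end HM
end
end

section
open MeasureTheory Set Filter Topology
open scoped ENNReal ContDiff

noncomputable section
namespace HM

lemma Wt.compact (k n : ℕ) : ∀ {f : E2 → ℝ}, ContDiff ℝ ∞ f → HasCompactSupport f → Wt k n f := by
  have base : ∀ {f : E2 → ℝ}, ContDiff ℝ ∞ f → HasCompactSupport f → Wt k 0 f := by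
    intro f hf hc
    have h1 : Continuous (fun x => f x * (1 + ‖x‖) ^ k) := by
      have := hf.continuous; fun_prop
    have h2 : HasCompactSupport (fun x => f x * (1 + ‖x‖) ^ k) := hc.mul_right
    obtain ⟨C, hC⟩ := h1.bounded_above_of_compact_support h2
    refine ⟨C, fun x => ?_⟩
    have := hC x
    rw [norm_mul, Real.norm_eq_abs, Real.norm_of_nonneg (by positivity)] at this
    exact this
  induction n with
  | zero => intro f hf hc; exact base hf hc
  | succ n ih =>
    intro f hf hc
    exact ⟨base hf hc, fun i => ih (contDiff_pd hf i) (hc.fderiv_apply ℝ _)⟩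

def A.ofC (f : E2 → ℝ) (hf : ContDiff ℝ ∞ f) (hc : HasCompactSupport f) : A :=
  A.mk f hf (fun n => Wt.compact 0 n hf hc)

lemma A.ofC_sch (f : E2 → ℝ) (hf : ContDiff ℝ ∞ f) (hc : HasCompactSupport f) :
    Sch (A.ofC f hf hc) := fun n => Wt.compact 3 n hf hc

lemma A.bdd (f : A) : ∃ C : ℝ, 0 ≤ C ∧ ∀ x, |f x| ≤ C := by
  obtain ⟨C, hC⟩ := f.wt 0
  simp only [pow_zero, mul_one] at hC
  exact ⟨C, (abs_nonneg _).trans (hC 0), hC⟩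

lemma pd_aff {f : E2 → ℝ} (hf : ContDiff ℝ ∞ f) (x : E2) (s c : ℝ) (i : Fin 2) :
    pd i (fun y => c * f (x + s • y)) = fun y => (c * s) * (pd i f) (x + s • y) := by
  funext y
  have h1 : HasFDerivAt f (fderiv ℝ f (x + s • y)) (x + s • y) := (sdiff hf _).hasFDerivAt
  have h2 : HasFDerivAt (fun y : E2 => x + s • y) (s • ContinuousLinearMap.id ℝ E2) y :=
    ((hasFDerivAt_id y).const_smul s).const_add x
  have h3 := (h1.comp y h2).const_mul c
  unfold pd
  rw [HasFDerivAt.fderiv (f := fun y => c * f (x + s • y)) h3]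
  simp; ring

lemma Wt.aff (x : E2) (s : ℝ) (n : ℕ) : ∀ {f : E2 → ℝ} (c : ℝ), ContDiff ℝ ∞ f → Wt 0 n f →
    Wt 0 n (fun y => c * f (x + s • y)) := by
  have base : ∀ {f : E2 → ℝ} (c : ℝ), Wt 0 0 f → Wt 0 0 (fun y => c * f (x + s • y)) := by
    rintro f c ⟨C, hC⟩
    refine ⟨|c| * C, fun y => ?_⟩
    have := hC (x + s • y)
    simp only [pow_zero, mul_one, abs_mul] at this ⊢
    gcongr
  induction n with
  | zero => intro f c _ h; exact base c h
  | succ n ih =>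
    intro f c hf h
    refine ⟨base c h.zero, fun i => ?_⟩
    rw [pd_aff hf]
    exact ih _ (contDiff_pd hf i) (h.2 i)

/-- affine pullback -/
def tau (x : E2) (s : ℝ) (v : A) : A :=
  A.mk (fun y => v (x + s • y)) (v.smooth.comp (by fun_prop)) (fun n => by
    simpa using Wt.aff x s n 1 v.smooth (v.wt n))

@[simp] lemma tau_apply (x : E2) (s : ℝ) (v : A) (y : E2) : (tau x s v) y = v (x + s • y) := rfl

lemma P_tau (x : E2) (s : ℝ) (v : A) (i : Fin 2) : P i (tau x s v) = s • tau x s (P i v) := by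
  apply A.ext; intro y
  have := congrFun (pd_aff v.smooth x s 1 i) y
  simpa using! this

/-- kernel theta -/
lemma theta_aux : ∀ y : E2, y ∉ Metric.closedBall (0:E2) 1 → 1 - (y 0 ^ 2 + y 1 ^ 2) < 0 := by
  intro y hy
  rw [mem_closedBall_zero_iff, pi_norm_le_iff_of_nonneg zero_le_one] at hy
  push Not at hy
  obtain ⟨i, hi⟩ := hy
  have h1 : 1 < y i ^ 2 := by
    rw [Real.norm_eq_abs] at hi
    rw [← sq_abs]; nlinarith
  have h2 := sq_nonneg (y 0)
  have h3 := sq_nonneg (y 1)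
  fin_cases i <;> simp only [Fin.zero_eta, Fin.mk_one] at h1 <;> linarith

lemma st_smooth : ContDiff ℝ ∞ Real.smoothTransition := Real.smoothTransition.contDiff

lemma dst_smooth : ContDiff ℝ ∞ (deriv Real.smoothTransition) :=
  ((contDiff_infty_iff_deriv).1 st_smooth).2

lemma dst_neg {s : ℝ} (hs : s < 0) : deriv Real.smoothTransition s = 0 := by
  have : Real.smoothTransition =ᶠ[𝓝 s] fun _ => 0 := by
    filter_upwards [Iio_mem_nhds hs] with a ha
    exact Real.smoothTransition.zero_of_nonpos (le_of_lt ha)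
  rw [this.deriv_eq]; simp

lemma dst_nonneg (s : ℝ) : 0 ≤ deriv Real.smoothTransition s :=
  Real.smoothTransition.monotone.deriv_nonneg

def theta : A := A.ofC (fun y => Real.smoothTransition (1 - (y 0 ^ 2 + y 1 ^ 2)))
  (st_smooth.comp (by fun_prop))
  (HasCompactSupport.intro (isCompact_closedBall 0 1) fun y hy =>
    Real.smoothTransition.zero_of_nonpos (theta_aux y hy).le)

def rho : A := A.ofC (fun y => 2 * deriv Real.smoothTransition (1 - (y 0 ^ 2 + y 1 ^ 2)))
  (contDiff_const.mul (dst_smooth.comp (by fun_prop)))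
  (HasCompactSupport.intro (isCompact_closedBall 0 1) fun y hy => by
    rw [dst_neg (theta_aux y hy), mul_zero])

lemma theta_sch : Sch theta := A.ofC_sch _ _ _
lemma rho_sch : Sch rho := A.ofC_sch _ _ _

lemma P_theta (i : Fin 2) (y : E2) : (P i theta) y = - (y i * rho y) := by
  have h1 : HasFDerivAt (fun y : E2 => 1 - (y 0 ^ 2 + y 1 ^ 2))
      (-((2 * y 0) • ContinuousLinearMap.proj (R := ℝ) (φ := fun _ : Fin 2 => ℝ) 0
        + (2 * y 1) • ContinuousLinearMap.proj (R := ℝ) (φ := fun _ : Fin 2 => ℝ) 1)) y := by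
    have p : ∀ i : Fin 2, HasFDerivAt (fun y : E2 => y i)
      (ContinuousLinearMap.proj (R := ℝ) (φ := fun _ : Fin 2 => ℝ) i) y := fun i =>
        (ContinuousLinearMap.proj (R := ℝ) (φ := fun _ : Fin 2 => ℝ) i).hasFDerivAt
    have := (((p 0).pow 2).add ((p 1).pow 2)).const_sub 1
    refine this.congr_fderiv ?_
    ext z
    simp
  have h2 : HasDerivAt Real.smoothTransition (deriv Real.smoothTransition (1 - (y 0 ^ 2 + y 1 ^ 2)))
    (1 - (y 0 ^ 2 + y 1 ^ 2)) := (st_smooth.differentiable (by simp) _).hasDerivAt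
  have h3 := h2.comp_hasFDerivAt y h1
  rw [P_apply]
  unfold pd
  rw [HasFDerivAt.fderiv (f := theta) h3]
  have e : rho y = 2 * deriv Real.smoothTransition (1 - (y 0 ^ 2 + y 1 ^ 2)) := rfl
  rw [e]
  fin_cases i <;> simp <;> ring

lemma rho_pos : 0 < I rho := by
  have hc : HasCompactSupport rho := (HasCompactSupport.intro (isCompact_closedBall 0 1) fun y hy => by
    change 2 * deriv Real.smoothTransition (1 - (y 0 ^ 2 + y 1 ^ 2)) = 0
    rw [dst_neg (theta_aux y hy), mul_zero])
  obtain ⟨c, hc1, hc2⟩ := exists_deriv_eq_slope Real.smoothTransition zero_lt_one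
    (st_smooth.continuous.continuousOn) (st_smooth.differentiable (by simp)).differentiableOn
  rw [Real.smoothTransition.zero, Real.smoothTransition.one] at hc2
  norm_num at hc2
  refine rho.cont.integral_pos_of_hasCompactSupport_nonneg_nonzero hc
    (fun y => mul_nonneg zero_le_two (dst_nonneg _)) (x := ![√(1 - c), 0]) ?_
  change 2 * deriv Real.smoothTransition (1 - (√(1-c) ^ 2 + 0 ^ 2)) ≠ 0
  rw [Real.sq_sqrt (by linarith [hc1.2])]
  rw [show 1 - (1 - c + 0 ^ 2) = c by ring, hc2]; norm_num

lemma tau_hasDeriv (x y : E2) (v : A) (s : ℝ) :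
    HasDerivAt (fun s => v (x + s • y)) (y 0 * (P 0 v) (x + s • y) + y 1 * (P 1 v) (x + s • y)) s := by
  have h1 : HasFDerivAt v (fderiv ℝ v (x + s • y)) (x + s • y) := (v.diff _).hasFDerivAt
  have h2 : HasDerivAt (fun s : ℝ => x + s • y) y s := by
    simpa using ((hasDerivAt_id s).smul_const y).const_add x
  have h3 := h1.comp_hasDerivAt s h2
  refine h3.congr_deriv ?_
  have : y = y 0 • (Pi.single 0 1 : E2) + y 1 • (Pi.single 1 1 : E2) := by
    funext i; fin_cases i <;> simp
  conv_lhs => rw [show (fderiv ℝ v (x + s • y)) y = (fderiv ℝ v (x + s • y)) (y 0 • (Pi.single 0 1 : E2) + y 1 • (Pi.single 1 1 : E2)) from congrArg _ this]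
  rw [map_add, map_smul, map_smul]; rfl

lemma phi_deriv (x : E2) (v : A) (s : ℝ) :
    HasDerivAt (fun s => I (rho * tau x s v))
      (s * I (theta * tau x s (P 0 (P 0 v) + P 1 (P 1 v)))) s := by
  obtain ⟨C0, hC0, h0⟩ := (P 0 v).bdd
  obtain ⟨C1, hC1, h1⟩ := (P 1 v).bdd
  have key := hasDerivAt_integral_of_dominated_loc_of_deriv_le (μ := (volume : Measure E2))
    (F := fun s y => rho y * v (x + s • y)) (x₀ := s) (s := univ)
    (F' := fun s y => -((P 0 theta) y * (P 0 v) (x + s • y) + (P 1 theta) y * (P 1 v) (x + s • y)))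
    (bound := fun y => |(P 0 theta) y| * C0 + |(P 1 theta) y| * C1) univ_mem
    (Eventually.of_forall fun t => ((rho_sch.mul (tau x t v)).integrable).aestronglyMeasurable)
    ((rho_sch.mul (tau x s v)).integrable)
    (((((theta_sch.P 0).mul (tau x s (P 0 v))).add ((theta_sch.P 1).mul (tau x s (P 1 v)))).neg).integrable.aestronglyMeasurable)
    (Eventually.of_forall fun y t _ => ?_)
    (((theta_sch.P 0).integrable.abs.mul_const _).add ((theta_sch.P 1).integrable.abs.mul_const _))
    (Eventually.of_forall fun y t _ => ?_)
  · have e : I (-(P 0 theta * tau x s (P 0 v) + P 1 theta * tau x s (P 1 v)))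
        = I (s • (theta * tau x s (P 0 (P 0 v) + P 1 (P 1 v)))) := by
      refine ibp (f := -(theta * tau x s (P 0 v))) (g := -(theta * tau x s (P 1 v)))
        (theta_sch.mul _).neg (theta_sch.mul _).neg ?_
      simp only [map_neg, P_mul, P_tau]
      apply A.ext; intro y
      simp; ring
    rw [I_smul] at e
    rw [← e]
    exact key.2
  · rw [norm_neg]
    refine (norm_add_le _ _).trans ?_
    rw [norm_mul, norm_mul]
    exact add_le_add (mul_le_mul_of_nonneg_left (h0 _) (norm_nonneg _))
      (mul_le_mul_of_nonneg_left (h1 _) (norm_nonneg _))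
  · have := (tau_hasDeriv x y v t).const_mul (rho y)
    refine this.congr_deriv ?_
    rw [P_theta, P_theta]; ring

lemma tau_zero (x : E2) (v : A) : I (rho * tau x 0 v) = I rho * v x := by
  unfold I
  rw [← integral_mul_const]
  congr 1; funext y; simp

/-- Hölder with dilation -/
lemma holder_tau {k : A} (hk : Sch k) {p : ℝ} (hp : 1 < p) : ∃ K : ℝ, 0 ≤ K ∧ ∀ (g : A), Sch g →
    ∀ (x : E2) (s : ℝ), 0 < s →
    |I (k * tau x s g)| ≤ K * (s ^ (-(2 / p)) * (∫ y, |g y| ^ p) ^ (1 / p)) := by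
  have hp0 : 0 < p := by linarith
  have hpq := Real.HolderConjugate.conjExponent hp
  set q := Real.conjExponent p
  have memk : ∀ {g : A} (hg : Sch g) {q : ℝ} (hq : 1 < q),
      MemLp (fun x => |g x|) (ENNReal.ofReal q) := by
    intro g hg q hq
    obtain ⟨C, hC0, hC⟩ := g.bdd
    have hq0 : 0 < q := by linarith
    refine (integrable_norm_rpow_iff g.cont.abs.aestronglyMeasurable (by simpa using hq0)
      (by simp)).1 ?_
    rw [ENNReal.toReal_ofReal hq0.le]
    refine (hg.integrable.abs.const_mul (C ^ (q - 1))).mono' ?_ (Eventually.of_forall fun x => ?_)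
    · exact ((g.cont.abs.norm).rpow_const fun x => Or.inr hq0.le).aestronglyMeasurable
    · simp only [Real.norm_eq_abs, abs_abs]
      rw [abs_of_nonneg (by positivity)]
      calc |g x| ^ q = |g x| ^ ((q - 1) + 1) := by ring_nf
        _ = |g x| ^ (q - 1) * |g x| := by
          rw [Real.rpow_add_one' (abs_nonneg _) (by linarith)]
        _ ≤ _ := by
          gcongr
          exact hC x
  refine ⟨(∫ y, |k y| ^ q) ^ (1 / q), by positivity, fun g hg x s hs => ?_⟩
  have hg' : ∀ h : E2 → ℝ, ∫ y, h (x + s • y) = s⁻¹ ^ 2 * ∫ y, h y := by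
    intro h
    rw [Measure.integral_comp_smul volume (fun y => h (x + y)) s, integral_add_left_eq_self]
    simp [abs_of_pos hs]
  have mt : MemLp (fun y => |g (x + s • y)|) (ENNReal.ofReal p) := by
    refine (integrable_norm_rpow_iff ?_ (by simpa using hp0) (by simp)).1 ?_
    · exact (tau x s g).cont.abs.aestronglyMeasurable
    have h1 := (integrable_norm_rpow_iff (memk hg hp).1 (by simpa using hp0) (by simp)).2 (memk hg hp)
    have h2 := h1.comp_add_left x
    exact h2.comp_smul hs.ne'
  have H := integral_mul_le_Lp_mul_Lq_of_nonneg (μ := (volume : Measure E2)) hpq.symm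
    (f := fun y => |k y|) (g := fun y => |g (x + s • y)|)
    (Eventually.of_forall fun x => abs_nonneg _) (Eventually.of_forall fun x => abs_nonneg _)
    (memk hk hpq.symm.lt) mt
  have e1 : |I (k * tau x s g)| ≤ ∫ y, |k y| * |g (x + s • y)| := by
    unfold I
    refine (abs_integral_le_integral_abs).trans (le_of_eq ?_)
    congr 1; funext y; simp [abs_mul]
  refine e1.trans (H.trans (le_of_eq ?_))
  rw [hg' (fun y => |g y| ^ p), Real.mul_rpow (by positivity)
    (integral_nonneg fun y => by positivity)]
  congr 2
  rw [← Real.rpow_natCast, ← Real.rpow_mul (by positivity), Real.inv_rpow hs.le,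
    ← Real.rpow_neg hs.le]
  congr 1; push_cast; ring

def L (f : A) : A := P 0 (P 0 f) + P 1 (P 1 f)

lemma Sch.L {f : A} (hf : Sch f) : Sch (L f) := ((hf.P 0).P 0).add ((hf.P 1).P 1)

lemma P_L (i : Fin 2) (f : A) : P i (L f) = L (P i f) := by
  unfold L; rw [map_add, P_comm i 0, P_comm i 0, P_comm i 1, P_comm i 1]

lemma ibp_tau {k : A} (hk : Sch k) (x : E2) (s : ℝ) (g : A) (i : Fin 2) :
    s * I (k * tau x s (P i g)) = - I (P i k * tau x s g) := by
  have h := I_P (hk.mul (tau x s g)) i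
  rw [P_mul, P_tau, I_add (hk.mul _) (by rw [mul_comm]; exact (hk.P i).mul _)] at h
  rw [mul_smul_comm, I_smul, mul_comm (tau x s g)] at h
  linarith

lemma sup_step {φ φ' : ℝ → ℝ} (h : ∀ s, HasDerivAt φ (φ' s) s) {K a : ℝ} (_ha : 0 ≤ a) (ha1 : a < 1)
    (hb : ∀ s, 0 < s → s < 1 → |φ' s| ≤ K * s ^ (-a)) : |φ 0| ≤ |φ 1| + K / (1 - a) := by
  have h1a : 0 < 1 - a := by linarith
  have key : ∀ ε : ℝ, |ε| = 1 → MonotoneOn (fun s => K / (1 - a) * s ^ (1 - a) + ε * φ s) (Icc 0 1) := by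
    intro ε hε
    have hd : ∀ s ∈ Ioo (0:ℝ) 1, HasDerivAt (fun s => K / (1 - a) * s ^ (1 - a) + ε * φ s)
        (K * s ^ (-a) + ε * φ' s) s := by
      intro s hs
      have h1 := (Real.hasDerivAt_rpow_const (x := s) (p := 1 - a) (Or.inl hs.1.ne')).const_mul (K / (1 - a))
      refine (h1.add ((h s).const_mul ε)).congr_deriv ?_
      rw [show 1 - a - 1 = -a by ring]
      field_simp
    refine monotoneOn_of_deriv_nonneg (convex_Icc 0 1) ?_ ?_ ?_
    · refine ContinuousOn.add ?_ ?_
      · exact continuousOn_const.mul (continuousOn_id.rpow_const fun x _ => Or.inr h1a.le)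
      · exact continuousOn_const.mul (fun s _ => (h s).continuousAt.continuousWithinAt)
    · intro s hs
      rw [interior_Icc] at hs
      exact (hd s hs).differentiableAt.differentiableWithinAt
    · intro s hs
      rw [interior_Icc] at hs
      rw [(hd s hs).deriv]
      have h2 := hb s hs.1 hs.2
      have h3 : |ε * φ' s| = |φ' s| := by rw [abs_mul, hε, one_mul]
      have := neg_abs_le (ε * φ' s)
      linarith
  have k1 := key 1 (by simp) (left_mem_Icc.2 zero_le_one) (right_mem_Icc.2 zero_le_one) zero_le_one
  have k2 := key (-1) (by simp) (left_mem_Icc.2 zero_le_one) (right_mem_Icc.2 zero_le_one) zero_le_one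
  simp only [Real.zero_rpow h1a.ne', Real.one_rpow] at k1 k2
  rw [abs_le]
  constructor
  · have := neg_abs_le (φ 1); linarith
  · have := le_abs_self (φ 1); linarith

lemma tau_l2 {k : A} (hk : Sch k) : ∃ K : ℝ, 0 ≤ K ∧ ∀ f : A, Sch f → ∀ x,
    |I (k * tau x 1 f)| ≤ K * √(sq f) := by
  obtain ⟨K, hK, h⟩ := holder_tau hk (p := 2) (by norm_num)
  refine ⟨K, hK, fun f hf x => (h f hf x 1 zero_lt_one).trans (le_of_eq ?_)⟩
  rw [Real.one_rpow, one_mul, Real.sqrt_eq_rpow]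
  congr 3; funext y
  rw [A.mul_apply, ← abs_mul_abs_self]
  norm_cast; ring

lemma tau_l2_1 {k : A} (hk : Sch k) (i : Fin 2) : ∃ K : ℝ, 0 ≤ K ∧ ∀ f : A, Sch f → ∀ x,
    |I (k * tau x 1 (P i f))| ≤ K * √(sq f) := by
  obtain ⟨K, hK, h⟩ := tau_l2 (hk.P i)
  refine ⟨K, hK, fun f hf x => ?_⟩
  have := ibp_tau hk x 1 f i
  rw [one_mul] at this
  rw [this, abs_neg]; exact h f hf x

lemma tau_l2_2 {k : A} (hk : Sch k) : ∃ K : ℝ, 0 ≤ K ∧ ∀ f : A, Sch f → ∀ x,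
    |I (k * tau x 1 (L f))| ≤ K * √(sq f) := by
  obtain ⟨K0, hK0, h0⟩ := tau_l2_1 (hk.P 0) 0
  obtain ⟨K1, hK1, h1⟩ := tau_l2_1 (hk.P 1) 1
  refine ⟨K0 + K1, by positivity, fun f hf x => ?_⟩
  have e : I (k * tau x 1 (L f)) = I (k * tau x 1 (P 0 (P 0 f))) + I (k * tau x 1 (P 1 (P 1 f))) := by
    rw [← I_add (hk.mul _) (hk.mul _)]; congr 1
    apply A.ext; intro y; simp [L]; ring
  have e0 := ibp_tau hk x 1 (P 0 f) 0
  have e1 := ibp_tau hk x 1 (P 1 f) 1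
  rw [one_mul] at e0 e1
  rw [e, e0, e1]
  refine (abs_add_le _ _).trans ?_
  rw [abs_neg, abs_neg, add_mul]
  exact add_le_add (h0 f hf x) (h1 f hf x)

lemma tau_l2_3 {k : A} (hk : Sch k) (i : Fin 2) : ∃ K : ℝ, 0 ≤ K ∧ ∀ f : A, Sch f → ∀ x,
    |I (k * tau x 1 (P i (L f)))| ≤ K * √(sq f) := by
  obtain ⟨K, hK, h⟩ := tau_l2_2 (hk.P i)
  refine ⟨K, hK, fun f hf x => ?_⟩
  have := ibp_tau hk x 1 (L f) i
  rw [one_mul] at this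
  rw [this, abs_neg]; exact h f hf x

lemma tau_inf {k : A} (hk : Sch k) (g : A) {B : ℝ} (hg : ∀ x, |g x| ≤ B) (x : E2) (s : ℝ) :
    |I (k * tau x s g)| ≤ (∫ y, |k y|) * B := by
  unfold I
  refine (abs_integral_le_integral_abs).trans ?_
  rw [← integral_mul_const]
  refine integral_mono (hk.mul _).integrable.abs (hk.integrable.abs.mul_const _) fun y => ?_
  simp only [A.mul_apply, abs_mul, tau_apply]
  exact mul_le_mul_of_nonneg_left (hg _) (abs_nonneg _)

def Np (p : ℝ) (f : A) : ℝ := (∫ y, |(L (L f)) y| ^ p) ^ (1 / p)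

lemma Np_nn (p : ℝ) (f : A) : 0 ≤ Np p f := by
  unfold Np; exact Real.rpow_nonneg (integral_nonneg fun y => by positivity) _

lemma bilap3 {p : ℝ} (hp : 2 < p) (i : Fin 2) : ∃ C : ℝ, 0 ≤ C ∧ ∀ f : A, Sch f → ∀ x,
    |(P i (L f)) x| ≤ C * (√(sq f) + Np p f) := by
  obtain ⟨K0, hK0, h0⟩ := tau_l2_3 rho_sch i
  obtain ⟨K1, hK1, h1⟩ := holder_tau (theta_sch.P i) (p := p) (by linarith)
  have hM := rho_pos
  have ha1 : 2 / p < 1 := by rw [div_lt_one (by linarith)]; exact hp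
  have ha0 : 0 ≤ 2 / p := by positivity
  have ha2 : 0 < 1 - 2 / p := by linarith
  refine ⟨(K0 + K1 / (1 - 2 / p)) / I rho, by positivity, fun f hf x => ?_⟩
  have hN := Np_nn p f
  have hs := Real.sqrt_nonneg (sq f)
  have := sup_step (fun s => phi_deriv x (P i (L f)) s) (K := K1 * Np p f) ha0 ha1 ?_
  · rw [tau_zero, abs_mul, abs_of_pos hM] at this
    rw [div_mul_eq_mul_div, le_div_iff₀ hM, mul_comm]
    refine this.trans ?_
    have h2 := h0 f hf x
    have h3 : 0 ≤ K1 / (1 - 2 / p) * √(sq f) := by positivity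
    have h4 : 0 ≤ K0 * Np p f := by positivity
    have h5 : K1 * Np p f / (1 - 2 / p) = K1 / (1 - 2 / p) * Np p f := by ring
    rw [h5]
    nlinarith
  · intro s hs0 hs1
    have e : P 0 (P 0 (P i (L f))) + P 1 (P 1 (P i (L f))) = P i (L (L f)) := (P_L i (L f)).symm
    rw [e, ibp_tau theta_sch, abs_neg]
    refine (h1 _ hf.L.L x s hs0).trans (le_of_eq ?_)
    unfold Np; ring

lemma bilap1 {p : ℝ} (hp : 2 < p) (i : Fin 2) : ∃ C : ℝ, 0 ≤ C ∧ ∀ f : A, Sch f → ∀ x,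
    |(P i f) x| ≤ C * (√(sq f) + Np p f) := by
  obtain ⟨K0, hK0, h0⟩ := tau_l2_1 rho_sch i
  obtain ⟨C, hC, h1⟩ := bilap3 hp i
  have hM := rho_pos
  have hth : 0 ≤ ∫ y, |theta y| := integral_nonneg fun y => abs_nonneg _
  refine ⟨(K0 + (∫ y, |theta y|) * C) / I rho, by positivity, fun f hf x => ?_⟩
  have hN := Np_nn p f
  have hs := Real.sqrt_nonneg (sq f)
  have := sup_step (fun s => phi_deriv x (P i f) s) (K := (∫ y, |theta y|) * (C * (√(sq f) + Np p f)))
    le_rfl zero_lt_one ?_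
  · rw [tau_zero, abs_mul, abs_of_pos hM] at this
    rw [div_mul_eq_mul_div, le_div_iff₀ hM, mul_comm]
    refine this.trans ?_
    have h2 := h0 f hf x
    have h4 : 0 ≤ K0 * Np p f := by positivity
    rw [sub_zero, div_one]
    nlinarith
  · intro s hs0 hs1
    have e : P 0 (P 0 (P i f)) + P 1 (P 1 (P i f)) = P i (L f) := (P_L i f).symm
    rw [e, neg_zero, Real.rpow_zero, mul_one, abs_mul, abs_of_pos hs0]
    have h2 := tau_inf theta_sch (P i (L f)) (h1 f hf) x s
    have := abs_nonneg (I (theta * tau x s (P i (L f))))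
    nlinarith

lemma bilap2 {p : ℝ} (hp : 2 < p) : ∃ C : ℝ, 0 ≤ C ∧ ∀ f : A, Sch f → ∀ x,
    |(L f) x| ≤ C * (√(sq f) + Np p f) := by
  obtain ⟨K0, hK0, h0⟩ := tau_l2_2 rho_sch
  obtain ⟨C0, hC0, h1⟩ := bilap3 hp 0
  obtain ⟨C1, hC1, h2⟩ := bilap3 hp 1
  have hM := rho_pos
  have hth : ∀ i, 0 ≤ ∫ y, |(P i theta) y| := fun i => integral_nonneg fun y => abs_nonneg _
  have := hth 0
  have := hth 1
  refine ⟨(K0 + ((∫ y, |(P 0 theta) y|) * C0 + (∫ y, |(P 1 theta) y|) * C1)) / I rho, by positivity, fun f hf x => ?_⟩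
  have hN := Np_nn p f
  have hs := Real.sqrt_nonneg (sq f)
  have := sup_step (fun s => phi_deriv x (L f) s)
    (K := ((∫ y, |(P 0 theta) y|) * C0 + (∫ y, |(P 1 theta) y|) * C1) * (√(sq f) + Np p f))
    le_rfl zero_lt_one ?_
  · rw [tau_zero, abs_mul, abs_of_pos hM] at this
    rw [div_mul_eq_mul_div, le_div_iff₀ hM, mul_comm]
    refine this.trans ?_
    have h2 := h0 f hf x
    have h4 : 0 ≤ K0 * Np p f := by positivity
    rw [sub_zero, div_one]
    nlinarith
  · intro s hs0 hs1
    have e : I (theta * tau x s (P 0 (P 0 (L f)) + P 1 (P 1 (L f))))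
        = I (theta * tau x s (P 0 (P 0 (L f)))) + I (theta * tau x s (P 1 (P 1 (L f)))) := by
      rw [← I_add (theta_sch.mul _) (theta_sch.mul _)]; congr 1
      apply A.ext; intro y; simp; ring
    rw [e, mul_add, ibp_tau theta_sch, ibp_tau theta_sch, neg_zero, Real.rpow_zero, mul_one]
    refine (abs_add_le _ _).trans ?_
    rw [abs_neg, abs_neg]
    have a1 := tau_inf (theta_sch.P 0) (P 0 (L f)) (h1 f hf) x s
    have a2 := tau_inf (theta_sch.P 1) (P 1 (L f)) (h2 f hf) x s
    linarith

/-- All sup bounds needed for the third velocity component. -/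
lemma bilap {p : ℝ} (hp : 2 < p) : ∃ C : ℝ, 0 ≤ C ∧ ∀ f : A, Sch f → ∀ x,
    |(L f) x| ≤ C * (√(sq f) + Np p f) ∧ ∀ i, |(P i f) x| ≤ C * (√(sq f) + Np p f) ∧
      |(P i (L f)) x| ≤ C * (√(sq f) + Np p f) := by
  obtain ⟨C2, h2, H2⟩ := bilap2 hp
  choose C1 h1 H1 using bilap1 hp
  choose C3 h3 H3 using bilap3 hp
  have a0 := h1 0; have a1 := h1 1; have b0 := h3 0; have b1 := h3 1
  refine ⟨C2 + C1 0 + C1 1 + C3 0 + C3 1, by positivity, fun f hf x => ?_⟩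
  have hN : 0 ≤ √(sq f) + Np p f := add_nonneg (Real.sqrt_nonneg _) (Np_nn p f)
  refine ⟨(H2 f hf x).trans ?_, fun i => ⟨(H1 i f hf x).trans ?_, (H3 i f hf x).trans ?_⟩⟩
  · gcongr; linarith
  · gcongr; fin_cases i <;> simp only [Fin.zero_eta, Fin.mk_one] <;> linarith
  · gcongr; fin_cases i <;> simp only [Fin.zero_eta, Fin.mk_one] <;> linarith

end HM
end
end

section
open MeasureTheory Set Filter Topology
open scoped ENNReal ContDiff

noncomputable section
namespace HM

def D : List (Fin 2) → A → A
  | [], f => f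
  | i :: δ, f => D δ (P i f)

@[simp] lemma D_nil (f : A) : D [] f = f := rfl
lemma D_cons (i : Fin 2) (δ : List (Fin 2)) (f : A) : D (i :: δ) f = D δ (P i f) := rfl

lemma D_add (δ : List (Fin 2)) : ∀ f g : A, D δ (f + g) = D δ f + D δ g := by
  induction δ with
  | nil => intro f g; rfl
  | cons i δ ih => intro f g; rw [D_cons, map_add, ih]; rfl

lemma D_smul (δ : List (Fin 2)) : ∀ (c : ℝ) (f : A), D δ (c • f) = c • D δ f := by
  induction δ with
  | nil => intro c f; rfl
  | cons i δ ih => intro c f; rw [D_cons, Derivation.map_smul, ih]; rfl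

lemma D_neg (δ : List (Fin 2)) (f : A) : D δ (-f) = - D δ f := by
  rw [← neg_one_smul ℝ f, D_smul, neg_one_smul]

lemma D_sub (δ : List (Fin 2)) (f g : A) : D δ (f - g) = D δ f - D δ g := by
  rw [sub_eq_add_neg, D_add, D_neg, sub_eq_add_neg]

lemma D_P (δ : List (Fin 2)) : ∀ (i : Fin 2) (f : A), D δ (P i f) = P i (D δ f) := by
  induction δ with
  | nil => intro i f; rfl
  | cons j δ ih => intro i f; rw [D_cons, P_comm, ih]; rfl

lemma D_L (δ : List (Fin 2)) (f : A) : D δ (L f) = L (D δ f) := by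
  unfold L; simp only [D_add, D_P]

lemma Sch.D {f : A} (hf : Sch f) (δ : List (Fin 2)) : Sch (D δ f) := by
  induction δ generalizing f with
  | nil => exact hf
  | cons i δ ih => exact ih (hf.P i)

/-- words of length `k` -/
def W (k : ℕ) : Finset (List (Fin 2)) :=
  (Finset.univ : Finset (Fin k → Fin 2)).image List.ofFn

lemma mem_W {k : ℕ} {δ : List (Fin 2)} : δ ∈ W k ↔ δ.length = k := by
  unfold W
  simp only [Finset.mem_image, Finset.mem_univ, true_and]
  constructor
  · rintro ⟨f, rfl⟩; simp
  · rintro rfl; exact ⟨δ.get, List.ofFn_get δ⟩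

def N (k : ℕ) (f : A) : ℝ := ∑ δ ∈ W k, sq (D δ f)
def S (j : ℕ) (f : A) : ℝ := ∑ l ∈ Finset.range (j + 1), N l f

lemma N_nn (k : ℕ) (f : A) : 0 ≤ N k f := Finset.sum_nonneg fun _ _ => sq_nn _
lemma S_nn (k : ℕ) (f : A) : 0 ≤ S k f := Finset.sum_nonneg fun _ _ => N_nn _ _

lemma sq_le_N (δ : List (Fin 2)) (f : A) : sq (D δ f) ≤ N δ.length f :=
  Finset.single_le_sum (f := fun δ => sq (D δ f)) (fun _ _ => sq_nn _) (mem_W.2 rfl)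

lemma N_le_S {k j : ℕ} (h : k ≤ j) (f : A) : N k f ≤ S j f :=
  Finset.single_le_sum (f := fun k => N k f) (fun _ _ => N_nn _ _)
    (Finset.mem_range.2 (by omega))

lemma S_mono {k j : ℕ} (h : k ≤ j) (f : A) : S k f ≤ S j f :=
  Finset.sum_le_sum_of_subset_of_nonneg (Finset.range_mono (by omega)) fun _ _ _ => N_nn _ _

lemma sq_le_S {δ : List (Fin 2)} {j : ℕ} (h : δ.length ≤ j) (f : A) : sq (D δ f) ≤ S j f :=
  (sq_le_N δ f).trans (N_le_S h f)

lemma gr_le_S {δ : List (Fin 2)} {j : ℕ} (h : δ.length + 1 ≤ j) (f : A) :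
    gr (D δ f) ≤ 2 * S j f := by
  have h0 := sq_le_S (δ := 0 :: δ) (j := j) (by simpa using h) f
  have h1 := sq_le_S (δ := 1 :: δ) (j := j) (by simpa using h) f
  rw [D_cons, D_P] at h0 h1
  unfold gr; linarith

lemma sup_le_S {f : A} (hf : Sch f) (x : E2) : f x ^ 2 ≤ 4 * S 2 f := by
  have h := agmon hf x
  have h0 := sq_le_S (δ := []) (j := 2) (by simp) f
  have h1 := gr_le_S (δ := []) (j := 2) (by simp) f
  have h2 := sq_le_S (δ := [1, 0]) (j := 2) (by simp) f
  simp only [D_nil, D_cons] at h0 h1 h2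
  linarith

lemma sq_mul_sup {f g : A} (hg : Sch g) {B : ℝ} (hB : ∀ x, f x ^ 2 ≤ B) : sq (f * g) ≤ B * sq g := by
  unfold sq
  rw [← I_smul]
  refine I_mono (((hg.mul' f).mul _)) ((hg.mul _).smul _) fun x => ?_
  simp only [A.mul_apply, A.smul_apply]
  have := hB x
  have := mul_self_nonneg (g x)
  nlinarith

lemma lady3 {f g : A} (hf : Sch f) (hg : Sch g) {a b : ℝ} (h1 : sq f ≤ a) (h2 : gr f ≤ b)
    (h3 : sq g ≤ a) (h4 : gr g ≤ b) : sq (f * g) ≤ 4 * (a * b) := by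
  have n1 := sq_nn f; have n2 := sq_nn g; have n3 := gr_nn f; have n4 := gr_nn g
  have a0 : 0 ≤ a := n1.trans h1
  have b0 : 0 ≤ b := n3.trans h2
  refine abs_le_of_sq_le_sq' (a := sq (f * g)) ?_ (by positivity) |>.2
  refine (lady2 hf hg).trans ?_
  have e1 : sq f * gr f ≤ a * b := by gcongr
  have e2 : sq g * gr g ≤ a * b := by gcongr
  have : (sq f * gr f) * (sq g * gr g) ≤ (a * b) * (a * b) := by gcongr
  nlinarith

lemma lady4 {f g : A} (hf : Sch f) (hg : Sch g) {a b c d ε : ℝ} (hε : 0 < ε) (h1 : sq f ≤ a)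
    (h2 : gr f ≤ b) (h3 : sq g ≤ c) (h4 : gr g ≤ d) : sq (f * g) ≤ ε * b + 4 * ε⁻¹ * (a * (c * d)) := by
  have n1 := sq_nn f; have n2 := sq_nn g; have n3 := gr_nn f; have n4 := gr_nn g
  have a0 : 0 ≤ a := n1.trans h1
  have b0 : 0 ≤ b := n3.trans h2
  have c0 : 0 ≤ c := n2.trans h3
  have d0 : 0 ≤ d := n4.trans h4
  refine abs_le_of_sq_le_sq' (a := sq (f * g)) ?_ (by positivity) |>.2
  refine (lady2 hf hg).trans ?_
  have e1 : sq f * gr f ≤ a * b := by gcongr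
  have e2 : sq g * gr g ≤ c * d := by gcongr
  have e3 : (sq f * gr f) * (sq g * gr g) ≤ (a * b) * (c * d) := by gcongr
  have e4 : (ε * b) * (4 * ε⁻¹ * (a * (c * d))) = 4 * ((a * b) * (c * d)) := by
    field_simp
  nlinarith [sq_nonneg (ε * b - 4 * ε⁻¹ * (a * (c * d)))]

lemma prod_bound {f g : A} (hf : Sch f) (hg : Sch g) {Q : ℕ → ℝ} (hQf : ∀ j, S j f ≤ Q j)
    (hQg : ∀ j, S j g ≤ Q j) {k : ℕ} {β γ : List (Fin 2)} (h : β.length + γ.length = k) :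
    sq (D β f * D γ g) ≤ 8 * ((Q 2 + Q (k - 1)) * Q k) := by
  have hQ : ∀ j, 0 ≤ Q j := fun j => (S_nn j f).trans (hQf j)
  have q1 := hQ 2; have q2 := hQ (k - 1); have q3 := hQ k
  rcases Nat.eq_zero_or_pos β.length with h0 | h0
  · have hβ : β = [] := List.length_eq_zero_iff.1 h0
    subst hβ
    have := sq_mul_sup (f := f) (hg.D γ) (sup_le_S hf)
    have h2 := (sq_le_S (δ := γ) (j := k) (by omega) g).trans (hQg k)
    have h3 := hQf 2
    rw [D_nil]
    have h4 : 4 * S 2 f * sq (D γ g) ≤ 4 * Q 2 * Q k := by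
      have := sq_nn (D γ g); have := S_nn 2 f; gcongr
    nlinarith [mul_nonneg q2 q3, mul_nonneg q1 q3]
  rcases Nat.eq_zero_or_pos γ.length with h1 | h1
  · have hγ : γ = [] := List.length_eq_zero_iff.1 h1
    subst hγ
    have := sq_mul_sup (f := g) (hf.D β) (sup_le_S hg)
    have h2 := (sq_le_S (δ := β) (j := k) (by omega) f).trans (hQf k)
    have h3 := hQg 2
    rw [D_nil, mul_comm]
    have h4 : 4 * S 2 g * sq (D β f) ≤ 4 * Q 2 * Q k := by
      have := sq_nn (D β f); have := S_nn 2 g; gcongr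
    nlinarith [mul_nonneg q2 q3, mul_nonneg q1 q3]
  · have := lady3 (hf.D β) (hg.D γ) (a := Q (k - 1)) (b := 2 * Q k)
      ((sq_le_S (by omega) f).trans (hQf _))
      ((gr_le_S (j := k) (by omega) f).trans (by linarith [hQf k]))
      ((sq_le_S (by omega) g).trans (hQg _))
      ((gr_le_S (j := k) (by omega) g).trans (by linarith [hQg k]))
    nlinarith [mul_nonneg q1 q3]

/-- weight conditions -/
structure Wgt (χ : A) : Prop where
  le : ∀ x, χ x ^ 2 ≤ 1
  dle : ∀ i x, (P i χ) x ^ 2 ≤ 1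

lemma Wgt.one : Wgt 1 where
  le := fun x => by simp
  dle := fun i x => by
    have : P i (1 : A) = 0 := Derivation.map_one_eq_zero _
    rw [this]; simp

lemma Wgt.sq_le {χ : A} (hχ : Wgt χ) {h : A} (hh : Sch h) : sq (χ * h) ≤ sq h := by
  have := sq_mul_sup hh hχ.le; linarith

/-- weighted gradient -/
def grw (χ f : A) : ℝ := sq (χ * P 0 f) + sq (χ * P 1 f)
lemma grw_nn (χ f : A) : 0 ≤ grw χ f := add_nonneg (sq_nn _) (sq_nn _)

lemma Wgt.gr_mul {χ : A} (hχ : Wgt χ) {h : A} (hh : Sch h) : gr (χ * h) ≤ 2 * grw χ h + 4 * sq h := by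
  have : ∀ i, sq (P i (χ * h)) ≤ 2 * sq (χ * P i h) + 2 * sq h := by
    intro i
    rw [P_mul]
    refine (sq_add_le ((hh.P i).mul' _) (hh.mul _)).trans ?_
    have := sq_mul_sup hh (hχ.dle i)
    rw [mul_comm h]; linarith
  have h0 := this 0; have h1 := this 1
  unfold gr grw; linarith

lemma hall_bound {χ : A} (hχ : Wgt χ) {f g : A} (hf : Sch f) (hg : Sch g) {Q : ℕ → ℝ}
    (hQf : ∀ j, S j f ≤ Q j) (hQg : ∀ j, S j g ≤ Q j) {k : ℕ} {β γ : List (Fin 2)}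
    (h : β.length + γ.length = k + 1) (hβ : 1 ≤ β.length) (hγ : 1 ≤ γ.length)
    {X ε : ℝ} (hε : 0 < ε) (hε1 : ε ≤ 1) (hXf : ∀ δ : List (Fin 2), δ.length = k → grw χ (D δ f) ≤ X)
    (hXg : ∀ δ : List (Fin 2), δ.length = k → grw χ (D δ g) ≤ X) :
    sq (χ * (D β f * D γ g)) ≤ ε * X + 16 * ε⁻¹ * ((1 + Q 1 * Q 2 + Q (k - 1)) * Q k) := by
  have hQ : ∀ j, 0 ≤ Q j := fun j => (S_nn j f).trans (hQf j)
  have q1 := hQ 1; have q2 := hQ 2; have q3 := hQ (k - 1); have q4 := hQ k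
  have he : 1 ≤ ε⁻¹ := (one_le_inv₀ hε).2 hε1
  have hX : 0 ≤ X := (grw_nn χ _).trans (hXf (List.replicate k 0) (by simp))
  have aux : ∀ {f g : A} (hf : Sch f) (hg : Sch g) (hQf : ∀ j, S j f ≤ Q j) (hQg : ∀ j, S j g ≤ Q j)
      {β γ : List (Fin 2)} (hβ : β.length = k) (hγ : γ.length = 1)
      (hXf : ∀ δ : List (Fin 2), δ.length = k → grw χ (D δ f) ≤ X),
      sq (χ * (D β f * D γ g)) ≤ ε * X + 16 * ε⁻¹ * ((1 + Q 1 * Q 2 + Q (k - 1)) * Q k) := by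
    intro f g hf hg hQf hQg β γ hβ hγ hXf
    have h0 := (sq_le_S (δ := β) (j := k) hβ.le f).trans (hQf k)
    have := lady4 ((hf.D β).mul' χ) (hg.D γ) (half_pos hε) (a := Q k) (b := 2 * X + 4 * Q k)
      (c := Q 1) (d := 2 * Q 2) ((hχ.sq_le (hf.D β)).trans h0)
      ((hχ.gr_mul (hf.D β)).trans (by linarith [hXf β hβ]))
      ((sq_le_S hγ.le g).trans (hQg _))
      ((gr_le_S (j := 2) (by omega) g).trans (by linarith [hQg 2]))
    rw [mul_assoc] at this
    refine this.trans ?_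
    have e : (ε / 2)⁻¹ = 2 * ε⁻¹ := by rw [inv_div, div_eq_mul_inv]
    rw [e]
    have e1 : ε * Q k ≤ 1 * Q k := by gcongr
    have e2 : 1 * Q k ≤ ε⁻¹ * Q k := by gcongr
    have e3 : 0 ≤ ε⁻¹ * (Q (k-1) * Q k) := by positivity
    nlinarith
  by_cases c1 : β.length = k
  · exact aux hf hg hQf hQg c1 (by omega) hXf
  by_cases c2 : γ.length = k
  · rw [mul_comm (D β f)]
    exact aux hg hf hQg hQf c2 (by omega) hXg
  have h1 := lady3 (hf.D β) (hg.D γ) (a := Q (k - 1)) (b := 2 * Q k)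
      ((sq_le_S (by omega) f).trans (hQf _))
      ((gr_le_S (j := k) (by omega) f).trans (by linarith [hQf k]))
      ((sq_le_S (by omega) g).trans (hQg _))
      ((gr_le_S (j := k) (by omega) g).trans (by linarith [hQg k]))
  refine (hχ.sq_le ((hf.D β).mul _)).trans (h1.trans ?_)
  have e1 : 1 * (Q (k-1) * Q k) ≤ ε⁻¹ * (Q (k - 1) * Q k) := by gcongr
  have e2 : 0 ≤ ε * X := by positivity
  have e3 : 0 ≤ ε⁻¹ * (Q 1 * Q 2 * Q k) := by positivity
  have e4 : 0 ≤ ε⁻¹ * Q k := by positivity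
  nlinarith

/-- Leibniz -/
lemma leib (χ : A) {B : ℝ} (δ : List (Fin 2)) : ∀ {f g : A}, Sch f → Sch g →
    (∀ β γ : List (Fin 2), β.length + γ.length = δ.length → sq (χ * (D β f * D γ g)) ≤ B) →
    sq (χ * D δ (f * g)) ≤ 4 ^ δ.length * B := by
  induction δ with
  | nil => intro f g _ _ h; simpa using h [] [] rfl
  | cons i δ ih =>
    intro f g hf hg h
    rw [D_cons, P_mul, D_add, mul_add]
    refine (sq_add_le (((hf.mul _).D δ).mul' _) (((hg.mul _).D δ).mul' _)).trans ?_
    have h1 := ih hf (hg.P i) (fun β γ hl => h β (i :: γ) (by simp; omega))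
    have h2 := ih (hf.P i) hg (fun β γ hl => h (i :: β) γ (by simp; omega))
    rw [mul_comm g]
    rw [List.length_cons, pow_succ]; linarith

/-- commutator -/
lemma comm (χ : A) {B : ℝ} (hB : 0 ≤ B) (δ : List (Fin 2)) : ∀ {f g : A}, Sch f → Sch g →
    (∀ β γ : List (Fin 2), 1 ≤ β.length → β.length + γ.length = δ.length →
      sq (χ * (D β f * D γ g)) ≤ B) →
    sq (χ * (D δ (f * g) - f * D δ g)) ≤ 4 ^ δ.length * B := by
  induction δ with
  | nil =>
    intro f g _ _ _
    have : χ * (D [] (f * g) - f * D [] g) = 0 := by simp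
    rw [this]; simpa [sq, I] using hB
  | cons i δ ih =>
    intro f g hf hg h
    have e : χ * (D (i :: δ) (f * g) - f * D (i :: δ) g)
        = χ * D δ (P i f * g) + χ * (D δ (f * P i g) - f * D δ (P i g)) := by
      rw [D_cons, D_cons, P_mul, D_add, mul_comm g]; ring
    rw [e]
    refine (sq_add_le ((((hf.P i).mul _).D δ).mul' _)
      ((((hf.mul _).D δ).sub (hf.mul _)).mul' _)).trans ?_
    have h1 := leib χ δ (hf.P i) hg (fun β γ hl => h (i :: β) γ (by simp) (by simp; omega))
    have h2 := ih hf (hg.P i) (fun β γ hb hl => h β (i :: γ) hb (by simp; omega))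
    rw [List.length_cons, pow_succ]; linarith

end HM
end
end

section
open MeasureTheory Set Filter Topology
open scoped ENNReal ContDiff

noncomputable section
namespace HM

lemma quad1 {p a g : ℝ} (hp : p ^ 2 ≤ 1) : -(2 * (a * (p * g))) ≤ a ^ 2 / 8 + 8 * g ^ 2 := by
  have : p ^ 2 * g ^ 2 ≤ 1 * g ^ 2 := by gcongr
  nlinarith [sq_nonneg (a + 8 * (p * g))]

lemma quad2 (a F : ℝ) : -(F * a) ≤ a ^ 2 / 8 + 2 * F ^ 2 := by
  nlinarith [sq_nonneg (a + 4 * F)]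

lemma quad2' (a F : ℝ) : (F * a) ≤ a ^ 2 / 8 + 2 * F ^ 2 := by
  nlinarith [sq_nonneg (a - 4 * F)]

lemma quad3 {p g : ℝ} (F : ℝ) (hp : p ^ 2 ≤ 1) : -(2 * (p * g * F)) ≤ g ^ 2 + F ^ 2 := by
  have : p ^ 2 * g ^ 2 ≤ 1 * g ^ 2 := by gcongr
  nlinarith [sq_nonneg (p * g + F)]

lemma quad3' {p g : ℝ} (F : ℝ) (hp : p ^ 2 ≤ 1) : (2 * (p * g * F)) ≤ g ^ 2 + F ^ 2 := by
  have : p ^ 2 * g ^ 2 ≤ 1 * g ^ 2 := by gcongr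
  nlinarith [sq_nonneg (p * g - F)]

lemma quad4 {p c a b B : ℝ} (hp : p ^ 2 ≤ 1) (hb : b ^ 2 ≤ B) :
    -(2 * (p * c * (a * b))) ≤ a ^ 2 / 32 + 32 * (B * c ^ 2) ∧
    (2 * (p * c * (a * b))) ≤ a ^ 2 / 32 + 32 * (B * c ^ 2) := by
  have h1 : (p ^ 2 * b ^ 2) * c ^ 2 ≤ (1 * B) * c ^ 2 := by gcongr
  constructor
  · nlinarith [sq_nonneg (a + 32 * (p * c * b))]
  · nlinarith [sq_nonneg (a - 32 * (p * c * b))]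

lemma sq_eq (f : A) : sq f = ∫ x, f x ^ 2 := by
  unfold sq I; congr 1; funext x; rw [A.mul_apply]; ring

/-- parabolic energy estimate with weight -/
lemma par {χ : A} (hχ : Wgt χ) {g F0 F1 : A} (hg : Sch g) (h0 : Sch F0) (h1 : Sch F1) :
    I (χ * χ * (g * (L g + P 0 F0 + P 1 F1))) ≤
      -(1/2) * grw χ g + 20 * (sq g + sq (χ * F0) + sq (χ * F1)) := by
  have e : I (χ * χ * (g * (L g + P 0 F0 + P 1 F1))) =
      I (-(χ * P 0 g * (χ * P 0 g)) - (χ * P 1 g * (χ * P 1 g))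
        - (2:ℝ) • (χ * P 0 g * (P 0 χ * g)) - (2:ℝ) • (χ * P 1 g * (P 1 χ * g))
        - χ * F0 * (χ * P 0 g) - χ * F1 * (χ * P 1 g)
        - (2:ℝ) • (P 0 χ * g * (χ * F0)) - (2:ℝ) • (P 1 χ * g * (χ * F1))) := by
    refine ibp (f := χ * χ * g * (P 0 g + F0)) (g := χ * χ * g * (P 1 g + F1)) ?_ ?_ ?_
    · exact ((hg.P 0).add h0).mul' _
    · exact ((hg.P 1).add h1).mul' _
    · simp only [P_mul, map_add, L, two_smul]; ring
  rw [e]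
  have e2 : -(1/2) * grw χ g + 20 * (sq g + sq (χ * F0) + sq (χ * F1))
      = I ((-(1/2) : ℝ) • (χ * P 0 g * (χ * P 0 g) + χ * P 1 g * (χ * P 1 g))
        + (20:ℝ) • (g * g + χ * F0 * (χ * F0) + χ * F1 * (χ * F1))) := by
    have s1 := ((hg.P 0).mul' χ).mul (χ * P 0 g)
    have s2 := ((hg.P 1).mul' χ).mul (χ * P 1 g)
    have s3 := hg.mul g
    have s4 := (h0.mul' χ).mul (χ * F0)
    have s5 := (h1.mul' χ).mul (χ * F1)
    rw [I_add ((s1.add s2).smul _) (((s3.add s4).add s5).smul _), I_smul, I_smul, I_add s1 s2,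
      I_add (s3.add s4) s5, I_add s3 s4]; rfl
  rw [e2]
  refine I_mono ?_ ?_ fun x => ?_
  · simp (maxDischargeDepth := 30) only [Sch.add, Sch.mul, Sch.mul', Sch.sub, Sch.smul, Sch.P, Sch.neg, hg, h0, h1]
  · simp (maxDischargeDepth := 30) only [Sch.add, Sch.mul, Sch.mul', Sch.sub, Sch.smul, Sch.P, Sch.neg, hg, h0, h1]
  · have p0 := hχ.dle 0 x
    have p1 := hχ.dle 1 x
    simp only [A.add_apply, A.sub_apply, A.mul_apply, A.smul_apply, A.neg_apply]
    generalize (P 0 χ) x = p at *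
    generalize (P 1 χ) x = q at *
    generalize g x = g at *
    generalize χ x * (P 0 _) x = a at *
    generalize χ x * (P 1 _) x = b at *
    generalize χ x * F0 x = F at *
    generalize χ x * F1 x = G at *
    have q1 := quad1 (a := a) (g := g) p0
    have q2 := quad1 (a := b) (g := g) p1
    have q3 := quad2 a F
    have q4 := quad2 b G
    have q5 := quad3 (g := g) F p0
    have q6 := quad3 (g := g) G p1
    nlinarith [sq_nonneg a, sq_nonneg b, sq_nonneg F, sq_nonneg G, sq_nonneg g]

/-- magnetic energy estimate with weight, Hall term included -/
lemma hall {χ : A} (hχ : Wgt χ) {c1 c2 c3 F1 F2 F3 b1 b2 b3 : A} (h1 : Sch c1) (h2 : Sch c2)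
    (h3 : Sch c3) (k1 : Sch F1) (k2 : Sch F2) (k3 : Sch F3) {B : ℝ} (hb1 : ∀ x, b1 x ^ 2 ≤ B)
    (hb2 : ∀ x, b2 x ^ 2 ≤ B) (hb3 : ∀ x, b3 x ^ 2 ≤ B) {J1 J2 J3 G1 G2 G3 : A}
    (eJ1 : J1 = P 1 c3) (eJ2 : J2 = -P 0 c3) (eJ3 : J3 = P 0 c2 - P 1 c1)
    (e1 : G1 = F1 - (J2 * b3 - J3 * b2)) (e2 : G2 = F2 - (J3 * b1 - J1 * b3))
    (e3 : G3 = F3 - (J1 * b2 - J2 * b1)) :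
    I (χ * χ * (c1 * (L c1 + P 1 G3) + c2 * (L c2 - P 0 G3) + c3 * (L c3 + P 0 G2 - P 1 G1)))
      ≤ -(1/4) * (grw χ c1 + grw χ c2 + grw χ c3)
        + 200 * ((1 + B) * (sq c1 + sq c2 + sq c3) + (sq (χ * F1) + sq (χ * F2) + sq (χ * F3))) := by
  have sG1 : Sch G1 := by
    rw [e1, eJ2, eJ3]
    simp (maxDischargeDepth := 30) only [Sch.add, Sch.mul, Sch.mul', Sch.sub, Sch.smul, Sch.P, Sch.neg, h1, h2, h3, k1]
  have sG2 : Sch G2 := by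
    rw [e2, eJ1, eJ3]
    simp (maxDischargeDepth := 30) only [Sch.add, Sch.mul, Sch.mul', Sch.sub, Sch.smul, Sch.P, Sch.neg, h1, h2, h3, k2]
  have sG3 : Sch G3 := by
    rw [e3, eJ1, eJ2]
    simp (maxDischargeDepth := 30) only [Sch.add, Sch.mul, Sch.mul', Sch.sub, Sch.smul, Sch.P, Sch.neg, h1, h2, h3, k3]
  have e : I (χ * χ * (c1 * (L c1 + P 1 G3) + c2 * (L c2 - P 0 G3) + c3 * (L c3 + P 0 G2 - P 1 G1)))
      = I (-(χ * P 0 c1 * (χ * P 0 c1)) - (χ * P 1 c1 * (χ * P 1 c1))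
          -(χ * P 0 c2 * (χ * P 0 c2)) - (χ * P 1 c2 * (χ * P 1 c2))
          -(χ * P 0 c3 * (χ * P 0 c3)) - (χ * P 1 c3 * (χ * P 1 c3))
          - (2:ℝ) • (χ * P 0 c1 * (P 0 χ * c1)) - (2:ℝ) • (χ * P 1 c1 * (P 1 χ * c1))
          - (2:ℝ) • (χ * P 0 c2 * (P 0 χ * c2)) - (2:ℝ) • (χ * P 1 c2 * (P 1 χ * c2))
          - (2:ℝ) • (χ * P 0 c3 * (P 0 χ * c3)) - (2:ℝ) • (χ * P 1 c3 * (P 1 χ * c3))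
          - (χ * P 1 c1 - χ * P 0 c2) * (χ * G3) - χ * P 0 c3 * (χ * G2) + χ * P 1 c3 * (χ * G1)
          - (2:ℝ) • ((P 1 χ * c1 - P 0 χ * c2) * (χ * G3)) - (2:ℝ) • (P 0 χ * c3 * (χ * G2))
          + (2:ℝ) • (P 1 χ * c3 * (χ * G1))) := by
    refine ibp (f := χ * χ * (c1 * P 0 c1 + c2 * P 0 c2 + c3 * P 0 c3 - c2 * G3 + c3 * G2))
      (g := χ * χ * (c1 * P 1 c1 + c2 * P 1 c2 + c3 * P 1 c3 + c1 * G3 - c3 * G1)) ?_ ?_ ?_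
    · simp (maxDischargeDepth := 30) only [Sch.add, Sch.mul, Sch.mul', Sch.sub, Sch.smul, Sch.P, Sch.neg, h1, h2, h3]
    · simp (maxDischargeDepth := 30) only [Sch.add, Sch.mul, Sch.mul', Sch.sub, Sch.smul, Sch.P, Sch.neg, h1, h2, h3]
    · simp only [P_mul, map_add, map_sub, L, two_smul]; ring
  rw [e]
  have er : -(1/4) * (grw χ c1 + grw χ c2 + grw χ c3)
        + 200 * ((1 + B) * (sq c1 + sq c2 + sq c3) + (sq (χ * F1) + sq (χ * F2) + sq (χ * F3)))
      = I ((-(1/4) : ℝ) • ((χ * P 0 c1 * (χ * P 0 c1) + χ * P 1 c1 * (χ * P 1 c1))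
          + (χ * P 0 c2 * (χ * P 0 c2) + χ * P 1 c2 * (χ * P 1 c2))
          + (χ * P 0 c3 * (χ * P 0 c3) + χ * P 1 c3 * (χ * P 1 c3)))
        + (200:ℝ) • ((1 + B) • (c1 * c1 + c2 * c2 + c3 * c3)
          + (χ * F1 * (χ * F1) + χ * F2 * (χ * F2) + χ * F3 * (χ * F3)))) := by
    rw [I_add, I_smul, I_smul, I_add, I_add, I_add, I_add, I_add, I_add, I_smul, I_add, I_add, I_add, I_add]
    · rfl
    all_goals
      simp (maxDischargeDepth := 30) only [Sch.add, Sch.mul, Sch.mul', Sch.sub, Sch.smul, Sch.P, Sch.neg, h1, h2, h3, k1, k2, k3]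
  rw [er]
  refine I_mono ?_ ?_ fun x => ?_
  · simp (maxDischargeDepth := 40) only [Sch.add, Sch.mul, Sch.mul', Sch.sub, Sch.smul, Sch.P, Sch.neg, h1, h2, h3]
  · simp (maxDischargeDepth := 40) only [Sch.add, Sch.mul, Sch.mul', Sch.sub, Sch.smul, Sch.P, Sch.neg, h1, h2, h3, k1, k2, k3]
  · have p0 := hχ.dle 0 x
    have p1 := hχ.dle 1 x
    have hb1 := hb1 x
    have hb2 := hb2 x
    have hb3 := hb3 x
    have hB : 0 ≤ B := (sq_nonneg _).trans hb1
    subst eJ1 eJ2 eJ3 e1 e2 e3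
    simp only [A.add_apply, A.sub_apply, A.mul_apply, A.smul_apply, A.neg_apply]
    have r : ∀ m n o : ℝ, χ x * (m - (n - o)) = χ x * m - (χ x * n - χ x * o) := by intros; ring
    have r2 : ∀ m n : ℝ, χ x * (m * n) = (χ x * m) * n := by intros; ring
    have r3 : ∀ m n : ℝ, χ x * (m - n) = (χ x * m) - χ x * n := by intros; ring
    have r4 : ∀ m : ℝ, χ x * (-m) = -(χ x * m) := by intros; ring
    simp only [r, r2, r3, r4]
    generalize (P 0 χ) x = p at *
    generalize (P 1 χ) x = q at *
    generalize χ x * (P 0 c1) x = a01 at *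
    generalize χ x * (P 1 c1) x = a11 at *
    generalize χ x * (P 0 c2) x = a02 at *
    generalize χ x * (P 1 c2) x = a12 at *
    generalize χ x * (P 0 c3) x = a03 at *
    generalize χ x * (P 1 c3) x = a13 at *
    generalize χ x * F1 x = f1 at *
    generalize χ x * F2 x = f2 at *
    generalize χ x * F3 x = f3 at *
    generalize c1 x = d1 at *
    generalize c2 x = d2 at *
    generalize c3 x = d3 at *
    generalize b1 x = m1 at *
    generalize b2 x = m2 at *
    generalize b3 x = m3 at *
    have t1 := quad1 (a := a01) (g := d1) p0
    have t2 := quad1 (a := a11) (g := d1) p1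
    have t3 := quad1 (a := a02) (g := d2) p0
    have t4 := quad1 (a := a12) (g := d2) p1
    have t5 := quad1 (a := a03) (g := d3) p0
    have t6 := quad1 (a := a13) (g := d3) p1
    have u1 := quad2 a11 f3
    have u2 := quad2' a02 f3
    have u3 := quad2 a03 f2
    have u4 := quad2' a13 f1
    have v1 := quad3 (g := d1) f3 p1
    have v2 := quad3' (g := d2) f3 p0
    have v3 := quad3 (g := d3) f2 p0
    have v4 := quad3' (g := d3) f1 p1
    have w1 := (quad4 (c := d1) (a := a13) p1 hb2).2
    have w2 := (quad4 (c := d1) (a := a03) p1 hb1).2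
    have w3 := (quad4 (c := d2) (a := a13) p0 hb2).1
    have w4 := (quad4 (c := d2) (a := a03) p0 hb1).1
    have w5 := (quad4 (c := d3) (a := a02) p0 hb1).2
    have w6 := (quad4 (c := d3) (a := a11) p0 hb1).1
    have w7 := (quad4 (c := d3) (a := a13) p0 hb3).1
    have w8 := (quad4 (c := d3) (a := a03) p1 hb3).2
    have w9 := (quad4 (c := d3) (a := a02) p1 hb2).2
    have w10 := (quad4 (c := d3) (a := a11) p1 hb2).1
    have z1 := mul_nonneg hB (sq_nonneg d1)
    have z2 := mul_nonneg hB (sq_nonneg d2)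
    have z3 := mul_nonneg hB (sq_nonneg d3)
    have y1 := sq_nonneg d1
    have y2 := sq_nonneg d2
    have y3 := sq_nonneg d3
    have x1 := sq_nonneg f1
    have x2 := sq_nonneg f2
    have x3 := sq_nonneg f3
    have g1 := sq_nonneg a01
    have g2 := sq_nonneg a02
    have g3 := sq_nonneg a03
    have g4 := sq_nonneg a11
    have g5 := sq_nonneg a12
    have g6 := sq_nonneg a13
    linarith

end HM
end
end

section
open MeasureTheory Set Filter Topology
open scoped ENNReal ContDiff
set_option linter.unusedSimpArgs false

noncomputable section
namespace HM

/-- A configuration at a fixed time. -/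
structure Cfg where
  u1 : A
  u2 : A
  u3 : A
  b1 : A
  b2 : A
  b3 : A
  su1 : Sch u1
  su2 : Sch u2
  su3 : Sch u3
  sb1 : Sch b1
  sb2 : Sch b2
  sb3 : Sch b3
  du : P 0 u1 + P 1 u2 = 0
  db : P 0 b1 + P 1 b2 = 0

namespace Cfg
variable (c : Cfg)

def om : A := P 0 c.u2 - P 1 c.u1
def j1 : A := P 1 c.b3
def j2 : A := -P 0 c.b3
def j3 : A := P 0 c.b2 - P 1 c.b1
def F1 : A := (c.b1 * P 0 c.b1 + c.b2 * P 1 c.b1) - (c.u1 * P 0 c.u1 + c.u2 * P 1 c.u1)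
def F2 : A := (c.b1 * P 0 c.b2 + c.b2 * P 1 c.b2) - (c.u1 * P 0 c.u2 + c.u2 * P 1 c.u2)
def omt : A := L c.om + P 0 c.F2 - P 1 c.F1
def u3t : A := L c.u3 + P 0 (c.b1 * c.b3 - c.u1 * c.u3) + P 1 (c.b2 * c.b3 - c.u2 * c.u3)
def G1 : A := (c.u2 * c.b3 - c.u3 * c.b2) - (c.j2 * c.b3 - c.j3 * c.b2)
def G2 : A := (c.u3 * c.b1 - c.u1 * c.b3) - (c.j3 * c.b1 - c.j1 * c.b3)
def G3 : A := (c.u1 * c.b2 - c.u2 * c.b1) - (c.j1 * c.b2 - c.j2 * c.b1)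
def b1t : A := L c.b1 + P 1 c.G3
def b2t : A := L c.b2 - P 0 c.G3
def b3t : A := L c.b3 + P 0 c.G2 - P 1 c.G1

def Q (j : ℕ) : ℝ := S j c.u1 + S j c.u2 + S j c.u3 + S j c.b1 + S j c.b2 + S j c.b3

lemma Q_nn (j : ℕ) : 0 ≤ c.Q j := by
  unfold Q
  have := S_nn j c.u1; have := S_nn j c.u2; have := S_nn j c.u3
  have := S_nn j c.b1; have := S_nn j c.b2; have := S_nn j c.b3
  positivity

lemma Q_mono {i j : ℕ} (h : i ≤ j) : c.Q i ≤ c.Q j := by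
  unfold Q; gcongr <;> exact S_mono h _

/-- being a component -/
def Is (f : A) : Prop := Sch f ∧ ∀ j, S j f ≤ c.Q j

lemma is_all : c.Is c.u1 ∧ c.Is c.u2 ∧ c.Is c.u3 ∧ c.Is c.b1 ∧ c.Is c.b2 ∧ c.Is c.b3 := by
  have h : ∀ j, S j c.u1 ≤ c.Q j ∧ S j c.u2 ≤ c.Q j ∧ S j c.u3 ≤ c.Q j ∧ S j c.b1 ≤ c.Q j
      ∧ S j c.b2 ≤ c.Q j ∧ S j c.b3 ≤ c.Q j := by
    intro j
    have := S_nn j c.u1; have := S_nn j c.u2; have := S_nn j c.u3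
    have := S_nn j c.b1; have := S_nn j c.b2; have := S_nn j c.b3
    unfold Q
    refine ⟨?_, ?_, ?_, ?_, ?_, ?_⟩ <;> linarith
  exact ⟨⟨c.su1, fun j => (h j).1⟩, ⟨c.su2, fun j => (h j).2.1⟩, ⟨c.su3, fun j => (h j).2.2.1⟩,
    ⟨c.sb1, fun j => (h j).2.2.2.1⟩, ⟨c.sb2, fun j => (h j).2.2.2.2.1⟩,
    ⟨c.sb3, fun j => (h j).2.2.2.2.2⟩⟩

/-- the bound at level `n+1` -/
def R (n : ℕ) : ℝ := (1 + c.Q 1 * c.Q 2 + c.Q 2 + c.Q n) * c.Q (n + 1)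

lemma R_nn (n : ℕ) : 0 ≤ c.R n := by
  unfold R
  have := c.Q_nn 1; have := c.Q_nn 2; have := c.Q_nn n; have := c.Q_nn (n+1); positivity

lemma R_ge1 (n : ℕ) : (c.Q 2 + c.Q n) * c.Q (n + 1) ≤ c.R n := by
  unfold R
  have h1 := c.Q_nn 1; have h2 := c.Q_nn 2; have := c.Q_nn n; have := c.Q_nn (n+1)
  exact mul_le_mul_of_nonneg_right (by nlinarith [mul_nonneg h1 h2]) (c.Q_nn _)

lemma R_ge2 (n : ℕ) : (1 + c.Q 1 * c.Q 2 + c.Q n) * c.Q (n + 1) ≤ c.R n := by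
  unfold R
  have h1 := c.Q_nn 1; have h2 := c.Q_nn 2; have := c.Q_nn n; have := c.Q_nn (n+1)
  exact mul_le_mul_of_nonneg_right (by linarith) (c.Q_nn _)

lemma R_ge3 (n : ℕ) : (1 + c.Q 2) * c.Q (n + 1) ≤ c.R n := by
  unfold R
  have h1 := c.Q_nn 1; have h2 := c.Q_nn 2; have := c.Q_nn n; have := c.Q_nn (n+1)
  exact mul_le_mul_of_nonneg_right (by nlinarith [mul_nonneg h1 h2]) (c.Q_nn _)

variable {c} {χ : A}

lemma w_prod (hχ : Wgt χ) {f g : A} (hf : c.Is f) (hg : c.Is g) {n : ℕ} {δ : List (Fin 2)}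
    (hδ : δ.length = n + 1) : sq (χ * D δ (f * g)) ≤ 4 ^ (n + 1) * (8 * c.R n) := by
  rw [← hδ]
  refine leib χ δ hf.1 hg.1 fun β γ h => ?_
  refine (hχ.sq_le ((hf.1.D β).mul _)).trans ?_
  have := prod_bound hf.1 hg.1 hf.2 hg.2 (k := n + 1) (β := β) (γ := γ) (by omega)
  refine this.trans ?_
  have := c.R_ge1 n
  simp only [Nat.add_sub_cancel]; linarith

lemma w_prod1 (hχ : Wgt χ) {f g : A} (hf : c.Is f) (hg : c.Is g) (i : Fin 2) {n : ℕ} {δ : List (Fin 2)}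
    (hδ : δ.length = n) : sq (χ * D δ (f * P i g)) ≤ 4 ^ (n + 1) * (8 * c.R n) := by
  have h1 : sq (χ * D δ (f * P i g)) ≤ 4 ^ n * (8 * c.R n) := by
    rw [← hδ]
    refine leib χ δ hf.1 (hg.1.P i) fun β γ h => ?_
    rw [hδ] at h
    rw [hδ]
    refine (hχ.sq_le ((hf.1.D β).mul _)).trans ?_
    have := prod_bound hf.1 hg.1 hf.2 hg.2 (k := n + 1) (β := β) (γ := i :: γ) (by simp; omega)
    refine this.trans ?_
    have := c.R_ge1 n
    simp only [Nat.add_sub_cancel]; linarith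
  have := c.R_nn n
  refine h1.trans ?_
  gcongr
  · norm_num
  · omega

lemma w_comm (hχ : Wgt χ) {f g : A} (hf : c.Is f) (hg : c.Is g) (i : Fin 2) {n : ℕ} {δ : List (Fin 2)}
    (hδ : δ.length = n + 1) {X ε : ℝ} (hε : 0 < ε) (hε1 : ε ≤ 1)
    (hXf : ∀ δ : List (Fin 2), δ.length = n + 1 → grw χ (D δ f) ≤ X)
    (hXg : ∀ δ : List (Fin 2), δ.length = n + 1 → grw χ (D δ g) ≤ X) :
    sq (χ * (D δ (f * P i g) - f * D δ (P i g))) ≤ 4 ^ (n + 1) * (ε * X + 16 * ε⁻¹ * c.R n) := by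
  have hX : 0 ≤ X := (grw_nn χ _).trans (hXf (List.replicate (n+1) 0) (by simp))
  have := c.R_nn n
  rw [← hδ]
  refine comm χ (by positivity) δ hf.1 (hg.1.P i) fun β γ hβ h => ?_
  have := hall_bound hχ hf.1 hg.1 hf.2 hg.2 (k := n + 1) (β := β) (γ := i :: γ) (by simp; omega) hβ
    (by simp) hε hε1 hXf hXg
  refine this.trans ?_
  have h2 := c.R_ge2 n
  simp only [Nat.add_sub_cancel]
  gcongr

lemma sq4 (χ : A) {a b p q : A} (ha : Sch a) (hb : Sch b) (hp : Sch p) (hq : Sch q) {B : ℝ}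
    (h1 : sq (χ * a) ≤ B) (h2 : sq (χ * b) ≤ B) (h3 : sq (χ * p) ≤ B) (h4 : sq (χ * q) ≤ B) :
    sq (χ * ((a + b) - (p + q))) ≤ 16 * B := by
  have e : χ * ((a + b) - (p + q)) = (χ * a + χ * b) - (χ * p + χ * q) := by ring
  rw [e]
  have sa := ha.mul' χ; have sb := hb.mul' χ; have sp := hp.mul' χ; have ss := hq.mul' χ
  have k1 := sq_sub_le (sa.add sb) (sp.add ss)
  have k2 := sq_add_le sa sb
  have k3 := sq_add_le sp ss
  linarith

lemma sq2 (χ : A) {a b : A} (ha : Sch a) (hb : Sch b) {B : ℝ}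
    (h1 : sq (χ * a) ≤ B) (h2 : sq (χ * b) ≤ B) :
    sq (χ * (a - b)) ≤ 4 * B := by
  rw [mul_sub]
  have sa := ha.mul' χ; have sb := hb.mul' χ
  have k1 := sq_sub_le sa sb
  linarith

lemma w_om (c : Cfg) (hχ : Wgt χ) {n : ℕ} {δ : List (Fin 2)} (hδ : δ.length = n) :
    I (χ * χ * (D δ c.om * D δ c.omt)) ≤ -(1/2) * grw χ (D δ c.om) + 10000 * 4 ^ (n+1) * c.R n := by
  obtain ⟨i1, i2, i3, i4, i5, i6⟩ := c.is_all
  have su1 := c.su1; have su2 := c.su2; have sb1 := c.sb1; have sb2 := c.sb2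
  have s1 : Sch c.F1 := by
    unfold F1
    simp (maxDischargeDepth := 30) only [Sch.add, Sch.mul, Sch.mul', Sch.sub, su1, su2, sb1, sb2]
  have s2 : Sch c.F2 := by
    unfold F2
    simp (maxDischargeDepth := 30) only [Sch.add, Sch.mul, Sch.mul', Sch.sub, su1, su2, sb1, sb2]
  have so : Sch c.om := (su2.P 0).sub (su1.P 1)
  have e : D δ c.omt = L (D δ c.om) + P 0 (D δ c.F2) + P 1 (-(D δ c.F1)) := by
    unfold omt
    rw [D_sub, D_add, D_L, D_P, D_P, map_neg, sub_eq_add_neg]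
  rw [e]
  refine (par hχ (so.D δ) (s2.D δ) (s1.D δ).neg).trans ?_
  have b2 : sq (χ * D δ c.F2) ≤ 16 * (4 ^ (n + 1) * (8 * c.R n)) := by
    unfold F2
    simp only [D_sub, D_add]
    exact sq4 χ ((sb1.mul _).D _) ((sb2.mul _).D _) ((su1.mul _).D _) ((su2.mul _).D _)
      (w_prod1 hχ i4 i5 0 hδ) (w_prod1 hχ i5 i5 1 hδ) (w_prod1 hχ i1 i2 0 hδ) (w_prod1 hχ i2 i2 1 hδ)
  have b1 : sq (χ * -D δ c.F1) ≤ 16 * (4 ^ (n + 1) * (8 * c.R n)) := by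
    rw [mul_neg, sq_neg']
    unfold F1
    simp only [D_sub, D_add]
    exact sq4 χ ((sb1.mul _).D _) ((sb2.mul _).D _) ((su1.mul _).D _) ((su2.mul _).D _)
      (w_prod1 hχ i4 i4 0 hδ) (w_prod1 hχ i5 i4 1 hδ) (w_prod1 hχ i1 i1 0 hδ) (w_prod1 hχ i2 i1 1 hδ)
  have b0 : sq (D δ c.om) ≤ 4 * c.R n := by
    unfold om
    rw [D_sub]
    refine (sq_sub_le ((su2.P 0).D δ) ((su1.P 1).D δ)).trans ?_
    have h1 := (sq_le_S (δ := 0 :: δ) (j := n + 1) (by simp; omega) c.u2).trans (i2.2 _)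
    have h2 := (sq_le_S (δ := 1 :: δ) (j := n + 1) (by simp; omega) c.u1).trans (i1.2 _)
    rw [D_cons] at h1 h2
    have := c.R_ge3 n
    nlinarith [c.Q_nn 2, c.Q_nn (n+1), mul_nonneg (c.Q_nn 2) (c.Q_nn (n+1))]
  have h4 : c.R n ≤ 4 ^ (n+1) * c.R n := le_mul_of_one_le_left (c.R_nn n) (one_le_pow₀ (by norm_num))
  have := c.R_nn n
  linarith

lemma w_u3 (c : Cfg) (hχ : Wgt χ) {n : ℕ} {δ : List (Fin 2)} (hδ : δ.length = n + 1) :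
    I (χ * χ * (D δ c.u3 * D δ c.u3t)) ≤ -(1/2) * grw χ (D δ c.u3) + 10000 * 4 ^ (n+1) * c.R n := by
  obtain ⟨i1, i2, i3, i4, i5, i6⟩ := c.is_all
  have su1 := c.su1; have su2 := c.su2; have sb1 := c.sb1; have sb2 := c.sb2
  have e : D δ c.u3t = L (D δ c.u3) + P 0 (D δ (c.b1 * c.b3 - c.u1 * c.u3))
      + P 1 (D δ (c.b2 * c.b3 - c.u2 * c.u3)) := by
    unfold u3t
    rw [D_add, D_add, D_L, D_P, D_P]
  rw [e]
  refine (par hχ (c.su3.D δ) (((sb1.mul _).sub (su1.mul _)).D δ) (((sb2.mul _).sub (su2.mul _)).D δ)).trans ?_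
  have b1 : sq (χ * D δ (c.b1 * c.b3 - c.u1 * c.u3)) ≤ 4 * (4 ^ (n + 1) * (8 * c.R n)) := by
    simp only [D_sub]
    exact sq2 χ ((sb1.mul _).D _) ((su1.mul _).D _) (w_prod hχ i4 i6 hδ) (w_prod hχ i1 i3 hδ)
  have b2 : sq (χ * D δ (c.b2 * c.b3 - c.u2 * c.u3)) ≤ 4 * (4 ^ (n + 1) * (8 * c.R n)) := by
    simp only [D_sub]
    exact sq2 χ ((sb2.mul _).D _) ((su2.mul _).D _) (w_prod hχ i5 i6 hδ) (w_prod hχ i2 i3 hδ)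
  have b0 : sq (D δ c.u3) ≤ c.R n := by
    have h1 := (sq_le_S (δ := δ) (j := n + 1) (by omega) c.u3).trans (i3.2 _)
    have := c.R_ge3 n
    nlinarith [c.Q_nn 2, c.Q_nn (n+1), mul_nonneg (c.Q_nn 2) (c.Q_nn (n+1))]
  have h4 : c.R n ≤ 4 ^ (n+1) * c.R n := le_mul_of_one_le_left (c.R_nn n) (one_le_pow₀ (by norm_num))
  have := c.R_nn n
  linarith

lemma w_b (c : Cfg) (hχ : Wgt χ) {n : ℕ} {δ : List (Fin 2)} (hδ : δ.length = n + 1)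
    {X ε : ℝ} (hε : 0 < ε) (hε1 : ε ≤ 1)
    (hX1 : ∀ δ : List (Fin 2), δ.length = n + 1 → grw χ (D δ c.b1) ≤ X)
    (hX2 : ∀ δ : List (Fin 2), δ.length = n + 1 → grw χ (D δ c.b2) ≤ X)
    (hX3 : ∀ δ : List (Fin 2), δ.length = n + 1 → grw χ (D δ c.b3) ≤ X) :
    I (χ * χ * (D δ c.b1 * D δ c.b1t + D δ c.b2 * D δ c.b2t + D δ c.b3 * D δ c.b3t)) ≤
      -(1/4) * (grw χ (D δ c.b1) + grw χ (D δ c.b2) + grw χ (D δ c.b3))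
      + 1000000 * 4 ^ (n+1) * (ε * X + ε⁻¹ * c.R n) := by
  obtain ⟨i1, i2, i3, i4, i5, i6⟩ := c.is_all
  have su1 := c.su1; have su2 := c.su2; have su3 := c.su3
  have sb1 := c.sb1; have sb2 := c.sb2; have sb3 := c.sb3
  have hX : 0 ≤ X := (grw_nn χ _).trans (hX1 (List.replicate (n+1) 0) (by simp))
  have hR := c.R_nn n
  have he : 1 ≤ ε⁻¹ := (one_le_inv₀ hε).2 hε1
  have sj1 : Sch c.j1 := sb3.P 1
  have sj2 : Sch c.j2 := (sb3.P 0).neg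
  have sj3 : Sch c.j3 := (sb2.P 0).sub (sb1.P 1)
  set K : ℝ := 4 ^ (n + 1) * (ε * X + 16 * ε⁻¹ * c.R n) with hK
  have hK0 : 0 ≤ K := by positivity
  have Kp : 4 ^ (n + 1) * (8 * c.R n) ≤ K := by
    rw [hK]
    gcongr
    have : 1 * c.R n ≤ ε⁻¹ * c.R n := by gcongr
    nlinarith [mul_nonneg hε.le hX]
  -- commutators
  have cj : ∀ {f : A}, c.Is f → (∀ δ : List (Fin 2), δ.length = n + 1 → grw χ (D δ f) ≤ X) →
      sq (χ * (D δ (f * c.j1) - f * D δ c.j1)) ≤ 4 * K ∧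
      sq (χ * (D δ (f * c.j2) - f * D δ c.j2)) ≤ 4 * K ∧
      sq (χ * (D δ (f * c.j3) - f * D δ c.j3)) ≤ 4 * K := by
    intro f hf hXf
    refine ⟨?_, ?_, ?_⟩
    · have := w_comm hχ hf i6 1 hδ hε hε1 hXf hX3
      unfold j1; linarith
    · have := w_comm hχ hf i6 0 hδ hε hε1 hXf hX3
      have e : χ * (D δ (f * c.j2) - f * D δ c.j2) = -(χ * (D δ (f * P 0 c.b3) - f * D δ (P 0 c.b3))) := by
        unfold j2; rw [mul_neg, D_neg, D_neg]; ring
      rw [e, sq_neg']; linarith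
    · have h1 := w_comm hχ hf i5 0 hδ hε hε1 hXf hX2
      have h2 := w_comm hχ hf i4 1 hδ hε hε1 hXf hX1
      have e : D δ (f * c.j3) - f * D δ c.j3 = (D δ (f * P 0 c.b2) - f * D δ (P 0 c.b2))
          - (D δ (f * P 1 c.b1) - f * D δ (P 1 c.b1)) := by
        unfold j3; rw [mul_sub, D_sub, D_sub]; ring
      rw [e]
      exact sq2 χ (((hf.1.mul _).D _).sub (hf.1.mul _)) (((hf.1.mul _).D _).sub (hf.1.mul _)) h1 h2
  obtain ⟨k11, k12, k13⟩ := cj i4 hX1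
  obtain ⟨k21, k22, k23⟩ := cj i5 hX2
  obtain ⟨k31, k32, k33⟩ := cj i6 hX3
  have gen : ∀ {f g p q a b x y : A}, c.Is f → c.Is g → c.Is p → c.Is q → Sch a → Sch b →
      sq (χ * (D δ (a * x) - a * D δ x)) ≤ 4 * K → sq (χ * (D δ (b * y) - b * D δ y)) ≤ 4 * K →
      sq (χ * (D δ ((f * g - p * q) - (x * a - y * b)) + (D δ x * a - D δ y * b))) ≤ 16 * (4 * K) := by
    intro f g p q a b x y hf hg hp hq ha hb h1 h2
    have e : D δ ((f * g - p * q) - (x * a - y * b)) + (D δ x * a - D δ y * b)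
        = (D δ (f * g) + (D δ (b * y) - b * D δ y)) - (D δ (p * q) + (D δ (a * x) - a * D δ x)) := by
      simp only [D_sub]; rw [mul_comm x a, mul_comm y b]; ring
    rw [e]
    refine sq4 χ ((hf.1.mul _).D _) (((hb.mul _).D _).sub (hb.mul _)) ((hp.1.mul _).D _)
      (((ha.mul _).D _).sub (ha.mul _)) ?_ h2 ?_ h1
    · have := w_prod hχ hf hg hδ; linarith
    · have := w_prod hχ hp hq hδ; linarith
  have f1 := gen i2 i6 i3 i5 sb3 sb2 k32 k23
  have f2 := gen i3 i4 i1 i6 sb1 sb3 k13 k31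
  have f3 := gen i1 i5 i2 i4 sb2 sb1 k21 k12
  have e1 : D δ c.b1t = L (D δ c.b1) + P 1 (D δ c.G3) := by
    unfold b1t; rw [D_add, D_L, D_P]
  have e2 : D δ c.b2t = L (D δ c.b2) - P 0 (D δ c.G3) := by
    unfold b2t; rw [D_sub, D_L, D_P]
  have e3 : D δ c.b3t = L (D δ c.b3) + P 0 (D δ c.G2) - P 1 (D δ c.G1) := by
    unfold b3t; rw [D_sub, D_add, D_L, D_P, D_P]
  have sG1 : Sch c.G1 := by
    unfold G1
    simp (maxDischargeDepth := 30) only [Sch.add, Sch.mul, Sch.mul', Sch.sub, su1, su2, su3, sb1, sb2, sb3]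
  have sG2 : Sch c.G2 := by
    unfold G2
    simp (maxDischargeDepth := 30) only [Sch.add, Sch.mul, Sch.mul', Sch.sub, su1, su2, su3, sb1, sb2, sb3]
  have sG3 : Sch c.G3 := by
    unfold G3
    simp (maxDischargeDepth := 30) only [Sch.add, Sch.mul, Sch.mul', Sch.sub, su1, su2, su3, sb1, sb2, sb3]
  rw [e1, e2, e3]
  have sb : ∀ {f : A}, c.Is f → ∀ x, f x ^ 2 ≤ 4 * c.Q 2 := fun hf x =>
    (sup_le_S hf.1 x).trans (by linarith [hf.2 2])
  have H := hall hχ (sb1.D δ) (sb2.D δ) (sb3.D δ)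
    (F1 := D δ c.G1 + (D δ c.j2 * c.b3 - D δ c.j3 * c.b2))
    (F2 := D δ c.G2 + (D δ c.j3 * c.b1 - D δ c.j1 * c.b3))
    (F3 := D δ c.G3 + (D δ c.j1 * c.b2 - D δ c.j2 * c.b1))
    ((sG1.D δ).add ((sb3.mul' _).sub (sb2.mul' _))) ((sG2.D δ).add ((sb1.mul' _).sub (sb3.mul' _)))
    ((sG3.D δ).add ((sb2.mul' _).sub (sb1.mul' _)))
    (sb i4) (sb i5) (sb i6) (J1 := D δ c.j1) (J2 := D δ c.j2) (J3 := D δ c.j3)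
    (G1 := D δ c.G1) (G2 := D δ c.G2) (G3 := D δ c.G3)
    (by unfold j1; rw [D_P]) (by unfold j2; rw [D_neg, D_P]) (by unfold j3; rw [D_sub, D_P, D_P])
    (by ring) (by ring) (by ring)
  refine H.trans ?_
  have q1 := (sq_le_S (δ := δ) (j := n + 1) (by omega) c.b1).trans (i4.2 _)
  have q2 := (sq_le_S (δ := δ) (j := n + 1) (by omega) c.b2).trans (i5.2 _)
  have q3 := (sq_le_S (δ := δ) (j := n + 1) (by omega) c.b3).trans (i6.2 _)
  have r3 := c.R_ge3 n
  have p2 := c.Q_nn 2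
  have pn := c.Q_nn (n+1)
  have t1 : (1 + 4 * c.Q 2) * (sq (D δ c.b1) + sq (D δ c.b2) + sq (D δ c.b3)) ≤ 12 * c.R n := by
    calc _ ≤ (1 + 4 * c.Q 2) * (c.Q (n+1) + c.Q (n+1) + c.Q (n+1)) := by gcongr
      _ ≤ 12 * ((1 + c.Q 2) * c.Q (n + 1)) := by nlinarith [mul_nonneg p2 pn]
      _ ≤ _ := by linarith
  have t2 : 1 * (1 * c.R n) ≤ 4 ^ (n+1) * (ε⁻¹ * c.R n) := by
    gcongr
    exact one_le_pow₀ (by norm_num)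
  have t3 : K = 4 ^ (n+1) * (ε * X) + 16 * (4 ^ (n+1) * (ε⁻¹ * c.R n)) := by rw [hK]; ring
  have t4 : 0 ≤ (4:ℝ) ^ (n+1) * (ε * X) := by positivity
  have t5 : 0 ≤ (4:ℝ) ^ (n+1) * (ε⁻¹ * c.R n) := by positivity
  unfold G1 G2 G3 at *
  linarith

/-- weighted dissipation -/
def X (c : Cfg) (χ : A) (n : ℕ) : ℝ := ∑ δ ∈ W n, grw χ (D δ c.om) + ∑ δ ∈ W (n + 1),
  (grw χ (D δ c.u3) + (grw χ (D δ c.b1) + grw χ (D δ c.b2) + grw χ (D δ c.b3)))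

/-- weighted energy derivative (half) -/
def Yt (c : Cfg) (χ : A) (n : ℕ) : ℝ := ∑ δ ∈ W n, I (χ * χ * (D δ c.om * D δ c.omt))
  + ∑ δ ∈ W (n + 1), (I (χ * χ * (D δ c.u3 * D δ c.u3t)) +
    I (χ * χ * (D δ c.b1 * D δ c.b1t + D δ c.b2 * D δ c.b2t + D δ c.b3 * D δ c.b3t)))

lemma X_nn (c : Cfg) (χ : A) (n : ℕ) : 0 ≤ c.X χ n := by
  unfold X
  refine add_nonneg (Finset.sum_nonneg fun _ _ => grw_nn _ _) (Finset.sum_nonneg fun δ _ => ?_)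
  have := grw_nn χ (D δ c.u3); have := grw_nn χ (D δ c.b1)
  have := grw_nn χ (D δ c.b2); have := grw_nn χ (D δ c.b3)
  positivity

lemma level (n : ℕ) : ∃ C : ℝ, 0 ≤ C ∧ ∀ (c : Cfg) (χ : A), Wgt χ →
    c.Yt χ n ≤ -(1/8) * c.X χ n + C * c.R n := by
  set M : ℝ := (W (n+1)).card * (1000000 * 4 ^ (n+1)) with hM
  have hM0 : 0 ≤ M := by positivity
  set ε : ℝ := 1 / (8 * M + 1) with hε
  have hε0 : 0 < ε := by positivity
  have hε1 : ε ≤ 1 := by rw [hε, div_le_one (by positivity)]; linarith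
  have hMε : M * ε ≤ 1 / 8 := by
    rw [hε, mul_one_div, div_le_div_iff₀ (by positivity) (by norm_num)]; linarith
  refine ⟨(W n).card * (10000 * 4 ^ (n+1)) + (W (n+1)).card * (10000 * 4 ^ (n+1)) + M * ε⁻¹,
    by positivity, fun c χ hχ => ?_⟩
  have hX := c.X_nn χ n
  have tot : ∀ δ : List (Fin 2), δ.length = n + 1 →
      (grw χ (D δ c.u3) + (grw χ (D δ c.b1) + grw χ (D δ c.b2) + grw χ (D δ c.b3))) ≤ c.X χ n := by
    intro δ hδ
    unfold X
    have h1 : 0 ≤ ∑ δ ∈ W n, grw χ (D δ c.om) := Finset.sum_nonneg fun _ _ => grw_nn _ _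
    have h2 := Finset.single_le_sum (s := W (n+1)) (f := fun δ =>
      (grw χ (D δ c.u3) + (grw χ (D δ c.b1) + grw χ (D δ c.b2) + grw χ (D δ c.b3))))
      (fun δ _ => by
        have := grw_nn χ (D δ c.u3); have := grw_nn χ (D δ c.b1)
        have := grw_nn χ (D δ c.b2); have := grw_nn χ (D δ c.b3)
        positivity) (mem_W.2 hδ)
    linarith
  have pos : ∀ δ : List (Fin 2), 0 ≤ grw χ (D δ c.u3) ∧ 0 ≤ grw χ (D δ c.b1) ∧
    0 ≤ grw χ (D δ c.b2) ∧ 0 ≤ grw χ (D δ c.b3) :=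
    fun δ => ⟨grw_nn _ _, grw_nn _ _, grw_nn _ _, grw_nn _ _⟩
  have A1 : ∑ δ ∈ W n, I (χ * χ * (D δ c.om * D δ c.omt)) ≤
      -(1/4) * ∑ δ ∈ W n, grw χ (D δ c.om) + (W n).card * (10000 * 4 ^ (n+1) * c.R n) := by
    rw [Finset.mul_sum, ← nsmul_eq_mul, ← Finset.sum_const, ← Finset.sum_add_distrib]
    refine Finset.sum_le_sum fun δ hδ => (w_om c hχ (mem_W.1 hδ)).trans ?_
    have := grw_nn χ (D δ c.om); linarith
  have A2 : ∑ δ ∈ W (n + 1), (I (χ * χ * (D δ c.u3 * D δ c.u3t)) +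
    I (χ * χ * (D δ c.b1 * D δ c.b1t + D δ c.b2 * D δ c.b2t + D δ c.b3 * D δ c.b3t))) ≤
      -(1/4) * ∑ δ ∈ W (n + 1),
        (grw χ (D δ c.u3) + (grw χ (D δ c.b1) + grw χ (D δ c.b2) + grw χ (D δ c.b3)))
      + (W (n+1)).card * (10000 * 4 ^ (n+1) * c.R n
        + 1000000 * 4 ^ (n+1) * (ε * c.X χ n + ε⁻¹ * c.R n)) := by
    rw [Finset.mul_sum, ← nsmul_eq_mul, ← Finset.sum_const, ← Finset.sum_add_distrib]
    refine Finset.sum_le_sum fun δ hδ => ?_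
    have hδ := mem_W.1 hδ
    have k1 := w_u3 c hχ hδ
    have k2 := w_b c hχ hδ hε0 hε1 (X := c.X χ n)
      (fun δ h => by obtain ⟨_, _, _, _⟩ := pos δ; linarith [tot δ h])
      (fun δ h => by obtain ⟨_, _, _, _⟩ := pos δ; linarith [tot δ h])
      (fun δ h => by obtain ⟨_, _, _, _⟩ := pos δ; linarith [tot δ h])
    have := pos δ
    linarith
  have e : c.X χ n = ∑ δ ∈ W n, grw χ (D δ c.om) + ∑ δ ∈ W (n + 1),
    (grw χ (D δ c.u3) + (grw χ (D δ c.b1) + grw χ (D δ c.b2) + grw χ (D δ c.b3))) := rfl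
  have p1 : 0 ≤ ∑ δ ∈ W n, grw χ (D δ c.om) := Finset.sum_nonneg fun _ _ => grw_nn _ _
  have A3 : c.Yt χ n ≤ -(1/4) * c.X χ n + ((W n).card * (10000 * 4 ^ (n+1) * c.R n)
    + (W (n+1)).card * (10000 * 4 ^ (n+1) * c.R n) + (M * ε) * c.X χ n + M * (ε⁻¹ * c.R n)) := by
    unfold Yt; rw [hM]; linarith
  have h9 := mul_le_mul_of_nonneg_right hMε hX
  linarith

end Cfg
end HM
end
end

section
open MeasureTheory Set Filter Topology
open scoped ENNReal ContDiff
set_option linter.unusedSimpArgs false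

noncomputable section
namespace HM

lemma grw_one (f : A) : grw 1 f = gr f := by unfold grw gr; rw [one_mul, one_mul]

lemma par1 {g F0 F1 : A} (hg : Sch g) (h0 : Sch F0) (h1 : Sch F1) :
    I (g * (L g + P 0 F0 + P 1 F1)) ≤ -(1/2) * gr g + 20 * (sq g + sq F0 + sq F1) := by
  have := par Wgt.one hg h0 h1
  rwa [grw_one, one_mul, one_mul, one_mul, one_mul] at this

lemma N_zero (f : A) : N 0 f = sq f := by
  have : W 0 = {[]} := by ext δ; rw [mem_W]; simp
  unfold N; rw [this, Finset.sum_singleton]; rfl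

lemma sum_W_succ (k : ℕ) (F : List (Fin 2) → ℝ) :
    ∑ δ ∈ W (k + 1), F δ = ∑ δ ∈ W k, F (0 :: δ) + ∑ δ ∈ W k, F (1 :: δ) := by
  have : W (k + 1) = (W k).image (List.cons 0) ∪ (W k).image (List.cons 1) := by
    ext δ
    simp only [mem_W, Finset.mem_union, Finset.mem_image]
    constructor
    · intro h
      match δ, h with
      | i :: δ, h =>
        fin_cases i
        · exact Or.inl ⟨δ, by simpa using h, rfl⟩
        · exact Or.inr ⟨δ, by simpa using h, rfl⟩
    · rintro (⟨δ, h, rfl⟩ | ⟨δ, h, rfl⟩) <;> simp [h]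
  rw [this, Finset.sum_union, Finset.sum_image, Finset.sum_image]
  · intro a _ b _ h; simpa using h
  · intro a _ b _ h; simpa using h
  · rw [Finset.disjoint_left]
    simp only [Finset.mem_image]
    rintro _ ⟨a, _, rfl⟩ ⟨b, _, h⟩
    simp at h

lemma N_succ (k : ℕ) (f : A) : N (k + 1) f = N k (P 0 f) + N k (P 1 f) := by
  unfold N; rw [sum_W_succ]; rfl

lemma N_succ' (k : ℕ) (f : A) : N (k + 1) f = ∑ δ ∈ W k, gr (D δ f) := by
  rw [N_succ]; unfold N gr
  rw [← Finset.sum_add_distrib]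
  simp only [D_P]

lemma N_one (f : A) : N 1 f = gr f := by rw [N_succ, N_zero, N_zero]; rfl

lemma gr_eq_L {f : A} (hf : Sch f) : gr f = I (-(f * L f)) := by
  unfold gr sq
  rw [← I_add ((hf.P 0).mul _) ((hf.P 1).mul _)]
  refine ibp (f := f * P 0 f) (g := f * P 1 f) (hf.mul _) (hf.mul _) ?_
  simp only [P_mul, L]; ring

lemma gr_le_L {f : A} (hf : Sch f) : gr f ≤ sq f + sq (L f) := by
  rw [gr_eq_L hf, I_neg]
  have := young hf hf.L (δ := 1) one_pos
  have h2 := neg_abs_le (I (f * L f))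
  have := sq_nn (L f)
  norm_num at *
  linarith

lemma N_two {f : A} (hf : Sch f) : N 2 f = sq (L f) := by
  rw [N_succ, N_one, N_one]
  unfold gr sq
  have s := fun i j => ((hf.P i).P j).mul (P j (P i f))
  rw [← I_add (s _ _) (s _ _), ← I_add (s _ _) (s _ _),
    ← I_add ((s _ _).add (s _ _)) ((s _ _).add (s _ _))]
  refine ibp (f := -(P 0 f * P 1 (P 1 f)) + P 1 f * P 0 (P 1 f))
    (g := P 0 f * P 0 (P 1 f) - P 1 f * P 0 (P 0 f)) ?_ ?_ ?_
  · exact ((hf.P 0).mul _).neg.add ((hf.P 1).mul _)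
  · exact ((hf.P 0).mul _).sub ((hf.P 1).mul _)
  · simp only [P_mul, map_add, map_neg, map_sub, L, P10]; ring

/-- div-curl identity -/
lemma divom {f g : A} (hf : Sch f) (hg : Sch g) (h : P 0 f + P 1 g = 0) :
    gr f + gr g = sq (P 0 g - P 1 f) := by
  unfold gr sq
  have s := fun {f : A} (hf : Sch f) i => (hf.P i).mul (P i f)
  rw [← I_add (s hf _) (s hf _), ← I_add (s hg _) (s hg _),
    ← I_add ((s hf _).add (s hf _)) ((s hg _).add (s hg _))]
  refine ibp (f := -(f * P 1 g) - f * P 1 g) (g := f * P 0 g + f * P 0 g) ?_ ?_ ?_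
  · exact (hf.mul _).neg.sub (hf.mul _)
  · exact (hf.mul _).add (hf.mul _)
  · simp only [P_mul, map_add, map_neg, map_sub, P10]
    linear_combination (P 0 f + P 1 g) * h

lemma sq_mul_abs {f g : A} (hg : Sch g) {M : ℝ} (h : ∀ x, |f x| ≤ M) : sq (f * g) ≤ M ^ 2 * sq g :=
  sq_mul_sup hg fun x => sq_le_sq' (by linarith [neg_abs_le (f x), h x]) (by linarith [le_abs_self (f x), h x])

lemma alg2 {f g : A} (hf : Sch f) (hg : Sch g) {δ : List (Fin 2)} (hδ : δ.length = 2) :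
    sq (D δ (f * g)) ≤ 128 * (S 2 f * S 2 g) := by
  have n1 := S_nn 2 f; have n2 := S_nn 2 g
  have := leib 1 (B := 8 * (S 2 f * S 2 g)) δ hf hg (by
    intro β γ h
    rw [one_mul]
    rw [hδ] at h
    by_cases h0 : β.length = 0
    · rw [List.length_eq_zero_iff] at h0
      subst h0
      have := sq_mul_sup (hg.D γ) (f := f) (sup_le_S hf)
      have h3 := sq_le_S (δ := γ) (j := 2) (by simp at h; omega) g
      rw [D_nil]
      nlinarith [mul_nonneg n1 n2]
    by_cases h1 : γ.length = 0
    · rw [List.length_eq_zero_iff] at h1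
      subst h1
      have := sq_mul_sup (hf.D β) (f := g) (sup_le_S hg)
      have h3 := sq_le_S (δ := β) (j := 2) (by simp at h; omega) f
      rw [D_nil, mul_comm]
      nlinarith [mul_nonneg n1 n2]
    have k := lady2 (hf.D β) (hg.D γ)
    have a1 := sq_le_S (δ := β) (j := 2) (by omega) f
    have a2 := sq_le_S (δ := γ) (j := 2) (by omega) g
    have a3 := gr_le_S (δ := β) (j := 2) (by omega) f
    have a4 := gr_le_S (δ := γ) (j := 2) (by omega) g
    apply abs_le_of_sq_le_sq' _ (by positivity) |>.2
    calc _ ≤ _ := k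
      _ ≤ 16 * ((S 2 f * (2 * S 2 f)) * (S 2 g * (2 * S 2 g))) := by
        have := sq_nn (D β f); have := sq_nn (D γ g); have := gr_nn (D β f); have := gr_nn (D γ g)
        gcongr
      _ ≤ _ := by
        have : 0 ≤ (S 2 f * S 2 g) ^ 2 := by positivity
        nlinarith)
  rw [one_mul, hδ] at this
  linarith

namespace Cfg
variable (c : Cfg)

def z1 : A := c.b1 + P 1 c.u3
def z2 : A := c.b2 - P 0 c.u3
def hh : A := c.u1 * c.z2 - c.u2 * c.z1
def zeta : A := P 0 c.z2 - P 1 c.z1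
def z1t : A := c.b1t + P 1 c.u3t
def z2t : A := c.b2t - P 0 c.u3t

lemma sz1 : Sch c.z1 := c.sb1.add (c.su3.P 1)
lemma sz2 : Sch c.z2 := c.sb2.sub (c.su3.P 0)
lemma shh : Sch c.hh := (c.su1.mul _).sub (c.su2.mul _)
lemma szeta : Sch c.zeta := (c.sz2.P 0).sub (c.sz1.P 1)
lemma som : Sch c.om := (c.su2.P 0).sub (c.su1.P 1)

lemma u3t_eq : c.u3t = L c.u3 + ((c.b1 * P 0 c.b3 + c.b2 * P 1 c.b3) - (c.u1 * P 0 c.u3 + c.u2 * P 1 c.u3)) := by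
  unfold u3t
  simp only [P_mul, map_sub]
  linear_combination c.b3 * c.db - c.u3 * c.du

lemma aux_hh : c.hh = c.G3 + ((c.b1 * P 0 c.b3 + c.b2 * P 1 c.b3) - (c.u1 * P 0 c.u3 + c.u2 * P 1 c.u3)) := by
  unfold hh G3 z1 z2 j1 j2; ring

lemma z1t_eq : c.z1t = L c.z1 + P 1 c.hh := by
  rw [aux_hh]; unfold z1t b1t z1; rw [u3t_eq]
  simp only [map_add, L, P_L, P10]; ring

lemma z2t_eq : c.z2t = L c.z2 - P 0 c.hh := by
  rw [aux_hh]; unfold z2t b2t z2; rw [u3t_eq]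
  simp only [map_add, map_sub, L, P_L, P10]; ring

lemma omt_eq : c.omt = L c.om + P 0 (c.b1 * c.j3 - c.u1 * c.om) + P 1 (c.b2 * c.j3 - c.u2 * c.om) := by
  unfold omt F1 F2 om j3
  simp only [map_add, map_sub, L, P_mul, P10]; ring

lemma j3_eq : c.j3 = c.zeta + L c.u3 := by
  unfold j3 zeta z1 z2 L; simp only [map_add, map_sub]; ring

lemma b3t_eq : c.b3t = L c.b3 + (((c.b1 * P 0 c.u3 + c.b2 * P 1 c.u3) - (c.u1 * P 0 c.b3 + c.u2 * P 1 c.b3))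
    - (c.b1 * P 0 c.j3 + c.b2 * P 1 c.j3)) := by
  unfold b3t G1 G2 j1 j2
  simp only [map_add, map_sub, map_neg, P_mul, P10]
  linear_combination (c.u3 - c.j3) * c.db - c.b3 * c.du

/-- E0 -/
lemma e0 {π : A} (hπ : Sch π) :
    I (c.u1 * (L c.u1 + c.F1 - P 0 π)) + I (c.u2 * (L c.u2 + c.F2 - P 1 π)) + I (c.u3 * c.u3t)
      + I (c.b1 * c.b1t) + I (c.b2 * c.b2t) + I (c.b3 * c.b3t) =
    -(gr c.u1 + gr c.u2 + gr c.u3 + gr c.b1 + gr c.b2 + gr c.b3) := by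
  have su1 := c.su1; have su2 := c.su2; have su3 := c.su3
  have sb1 := c.sb1; have sb2 := c.sb2; have sb3 := c.sb3
  unfold gr sq
  rw [← I_add (su1.mul _) (su2.mul _), ← I_add ((su1.mul _).add (su2.mul _)) (su3.mul _)]
  have t3 := ((su1.mul (L c.u1 + c.F1 - P 0 π)).add (su2.mul (L c.u2 + c.F2 - P 1 π))).add (su3.mul c.u3t)
  have t4 := t3.add (sb1.mul c.b1t)
  have t5 := t4.add (sb2.mul c.b2t)
  have t6 := t5.add (sb3.mul c.b3t)
  rw [← I_add t3 (sb1.mul _), ← I_add t4 (sb2.mul _), ← I_add t5 (sb3.mul _)]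
  have s := fun {f : A} (hf : Sch f) i => (hf.P i).mul (P i f)
  have r := fun {f : A} (hf : Sch f) => (s hf 0).add (s hf 1)
  rw [← I_add (s su1 0) (s su1 1), ← I_add (s su2 0) (s su2 1), ← I_add (s su3 0) (s su3 1),
    ← I_add (s sb1 0) (s sb1 1), ← I_add (s sb2 0) (s sb2 1), ← I_add (s sb3 0) (s sb3 1),
    ← I_add (r su1) (r su2), ← I_add ((r su1).add (r su2)) (r su3),
    ← I_add (((r su1).add (r su2)).add (r su3)) (r sb1),
    ← I_add ((((r su1).add (r su2)).add (r su3)).add (r sb1)) (r sb2),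
    ← I_add (((((r su1).add (r su2)).add (r su3)).add (r sb1)).add (r sb2)) (r sb3), ← I_neg]
  have tr := ((((((r su1).add (r su2)).add (r su3)).add (r sb1)).add (r sb2)).add (r sb3)).neg
  have two : ∀ {a b : A}, Sch a → Sch b → I (a + a) = I (b + b) → I a = I b := by
    intro a b ha hb h
    rw [I_add ha ha, I_add hb hb] at h; linarith
  refine two t6 tr ?_
  have sG1 : Sch c.G1 := by
    unfold G1
    simp (maxDischargeDepth := 30) only [Sch.add, Sch.mul, Sch.mul', Sch.sub, su1, su2, su3, sb1, sb2, sb3]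
  have sG2 : Sch c.G2 := by
    unfold G2
    simp (maxDischargeDepth := 30) only [Sch.add, Sch.mul, Sch.mul', Sch.sub, su1, su2, su3, sb1, sb2, sb3]
  have sG3 : Sch c.G3 := by
    unfold G3
    simp (maxDischargeDepth := 30) only [Sch.add, Sch.mul, Sch.mul', Sch.sub, su1, su2, su3, sb1, sb2, sb3]
  set V : A := c.b1 * c.b1 + c.b2 * c.b2 + c.b3 * c.b3 - (c.u1 * c.u1 + c.u2 * c.u2 + c.u3 * c.u3) - π - π with hV
  refine ibp (f := (2:A) * (c.u1 * P 0 c.u1 + c.u2 * P 0 c.u2 + c.u3 * P 0 c.u3 + c.b1 * P 0 c.b1 + c.b2 * P 0 c.b2 + c.b3 * P 0 c.b3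
      + (c.b3 * c.G2 - c.b2 * c.G3)) + c.u1 * V)
    (g := (2:A) * (c.u1 * P 1 c.u1 + c.u2 * P 1 c.u2 + c.u3 * P 1 c.u3 + c.b1 * P 1 c.b1 + c.b2 * P 1 c.b2 + c.b3 * P 1 c.b3
      + (c.b1 * c.G3 - c.b3 * c.G1)) + c.u2 * V) ?_ ?_ ?_
  · refine Sch.add (Sch.mul' ?_ _) (su1.mul _)
    simp (maxDischargeDepth := 30) only [Sch.add, Sch.mul, Sch.sub, su1, su2, su3, sb1, sb2, sb3]
  · refine Sch.add (Sch.mul' ?_ _) (su2.mul _)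
    simp (maxDischargeDepth := 30) only [Sch.add, Sch.mul, Sch.sub, su1, su2, su3, sb1, sb2, sb3]
  · have p2 : ∀ i, P i (2:A) = 0 := fun i => by
      rw [← one_add_one_eq_two, map_add, Derivation.map_one_eq_zero, add_zero]
    rw [u3t_eq]
    unfold b1t b2t b3t F1 F2
    simp only [P_mul, map_add, p2, L, map_sub]
    have d := c.du
    rw [hV]
    simp only [map_add, map_sub, P_mul]
    unfold G1 G2 G3 j1 j2 j3
    simp only [map_add, map_sub, map_neg, P_mul, P10]
    linear_combination (-V) * d

end Cfg
end HM
end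
end

section
open MeasureTheory Set Filter Topology
open scoped ENNReal ContDiff
set_option linter.unusedSimpArgs false

noncomputable section
namespace HM
namespace Cfg
variable (c : Cfg)

lemma z_level (δ : List (Fin 2)) :
    I (D δ c.z1 * D δ c.z1t) + I (D δ c.z2 * D δ c.z2t) ≤ -(1/2) * (gr (D δ c.z1) + gr (D δ c.z2))
      + 20 * (sq (D δ c.z1) + sq (D δ c.z2)) + 40 * sq (D δ c.hh) := by
  have s0 : sq (0 : A) = 0 := by unfold sq I; simp
  have e1 : D δ c.z1t = L (D δ c.z1) + P 0 0 + P 1 (D δ c.hh) := by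
    rw [z1t_eq, D_add, D_L, D_P, map_zero, add_zero]
  have e2 : D δ c.z2t = L (D δ c.z2) + P 0 (-(D δ c.hh)) + P 1 0 := by
    rw [z2t_eq, D_sub, D_L, D_P, map_zero, add_zero, map_neg, sub_eq_add_neg]
  rw [e1, e2]
  have h1 := par1 (c.sz1.D δ) Sch.zero (c.shh.D δ)
  have h2 := par1 (c.sz2.D δ) (c.shh.D δ).neg Sch.zero
  rw [sq_neg'] at h2
  rw [s0] at h1 h2
  linarith

/-- squared norms -/
def U0 : ℝ := sq c.u1 + sq c.u2
def G0 : ℝ := gr c.u1 + gr c.u2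
def Z0 : ℝ := sq c.z1 + sq c.z2
def Z1 : ℝ := gr c.z1 + gr c.z2
def Z2 : ℝ := gr (P 0 c.z1) + gr (P 1 c.z1) + gr (P 0 c.z2) + gr (P 1 c.z2)

lemma U0_nn : 0 ≤ c.U0 := add_nonneg (sq_nn _) (sq_nn _)
lemma G0_nn : 0 ≤ c.G0 := add_nonneg (gr_nn _) (gr_nn _)
lemma Z0_nn : 0 ≤ c.Z0 := add_nonneg (sq_nn _) (sq_nn _)
lemma Z1_nn : 0 ≤ c.Z1 := add_nonneg (gr_nn _) (gr_nn _)

lemma U0_ge : sq c.u1 ≤ c.U0 ∧ sq c.u2 ≤ c.U0 ∧ gr c.u1 ≤ c.G0 ∧ gr c.u2 ≤ c.G0 := by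
  unfold U0 G0
  have := sq_nn c.u1; have := sq_nn c.u2; have := gr_nn c.u1; have := gr_nn c.u2
  refine ⟨?_, ?_, ?_, ?_⟩ <;> linarith

lemma Z0_ge : sq c.z1 ≤ c.Z0 ∧ sq c.z2 ≤ c.Z0 ∧ gr c.z1 ≤ c.Z1 ∧ gr c.z2 ≤ c.Z1 := by
  unfold Z0 Z1
  have := sq_nn c.z1; have := sq_nn c.z2; have := gr_nn c.z1; have := gr_nn c.z2
  refine ⟨?_, ?_, ?_, ?_⟩ <;> linarith

lemma zz0 : I (c.z1 * c.z1t) + I (c.z2 * c.z2t) ≤ -(1/4) * c.Z1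
    + 1000000 * ((1 + c.U0 * c.G0) * c.Z0) := by
  have h := c.z_level []
  simp only [D_nil] at h
  obtain ⟨u1, u2, g1, g2⟩ := c.U0_ge
  have k1 := lady4 c.sz2 c.su1 (ε := 1/400) (by norm_num) le_rfl le_rfl u1 g1
  have k2 := lady4 c.sz1 c.su2 (ε := 1/400) (by norm_num) le_rfl le_rfl u2 g2
  have k3 := sq_sub_le (c.su1.mul c.z2) (c.su2.mul c.z1)
  rw [mul_comm c.u1 c.z2, mul_comm c.u2 c.z1] at k3
  have k4 : sq c.hh ≤ 2 * sq (c.z2 * c.u1) + 2 * sq (c.z1 * c.u2) := by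
    unfold hh; rw [mul_comm c.u1 c.z2, mul_comm c.u2 c.z1]; exact k3
  have n1 := sq_nn c.z1; have n2 := sq_nn c.z2; have n3 := gr_nn c.z1; have n4 := gr_nn c.z2
  have n5 := mul_nonneg n1 (mul_nonneg c.U0_nn c.G0_nn)
  have n6 := mul_nonneg n2 (mul_nonneg c.U0_nn c.G0_nn)
  rw [show (1 + c.U0 * c.G0) * c.Z0 = sq c.z1 + sq c.z2 + sq c.z1 * (c.U0 * c.G0) + sq c.z2 * (c.U0 * c.G0) by
    unfold Z0; ring]
  unfold Z1
  norm_num at k1 k2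
  linarith

lemma G0_eq : c.G0 = sq c.om := divom c.su1 c.su2 c.du

lemma dP (i : Fin 2) : P 0 (P i c.u1) + P 1 (P i c.u2) = 0 := by
  rw [P_comm 0 i, P_comm 1 i, ← map_add, c.du, map_zero]

lemma G1_eq : (gr (P 0 c.u1) + gr (P 0 c.u2)) + (gr (P 1 c.u1) + gr (P 1 c.u2)) = gr c.om := by
  rw [divom (c.su1.P 0) (c.su2.P 0) (c.dP 0), divom (c.su1.P 1) (c.su2.P 1) (c.dP 1)]
  unfold gr om
  simp only [map_sub, P10]

lemma zeta_le : sq c.zeta ≤ 2 * c.Z1 ∧ gr c.zeta ≤ 2 * c.Z2 := by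
  have h : ∀ {f g : A}, Sch f → Sch g → sq (P 0 g - P 1 f) ≤ 2 * (gr f + gr g) := by
    intro f g hf hg
    have := sq_sub_le (hg.P 0) (hf.P 1)
    have := sq_nn (P 0 f); have := sq_nn (P 1 g)
    unfold gr; linarith
  refine ⟨h c.sz1 c.sz2, ?_⟩
  have h0 := h (c.sz1.P 0) (c.sz2.P 0)
  have h1 := h (c.sz1.P 1) (c.sz2.P 1)
  have e : gr c.zeta = sq (P 0 (P 0 c.z2) - P 1 (P 0 c.z1)) + sq (P 0 (P 1 c.z2) - P 1 (P 1 c.z1)) := by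
    unfold zeta; rw [gr]; simp only [map_sub, P10]
  rw [e]; unfold Z2; linarith

lemma hh1 (i : Fin 2) : sq (P i c.hh) ≤ (1/2000) * (gr (P i c.u1) + gr (P i c.u2) + gr (P i c.z1) + gr (P i c.z2))
    + 160000 * (sq (P i c.u1) + sq (P i c.u2)) * (c.Z0 * c.Z1)
    + 160000 * (sq (P i c.z1) + sq (P i c.z2)) * (c.U0 * c.G0) := by
  obtain ⟨u1, u2, g1, g2⟩ := c.U0_ge
  obtain ⟨v1, v2, w1, w2⟩ := c.Z0_ge
  have k1 := lady4 (c.su1.P i) c.sz2 (ε := 1/10000) (by norm_num) le_rfl le_rfl v2 w2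
  have k2 := lady4 (c.su2.P i) c.sz1 (ε := 1/10000) (by norm_num) le_rfl le_rfl v1 w1
  have k3 := lady4 (c.sz2.P i) c.su1 (ε := 1/10000) (by norm_num) le_rfl le_rfl u1 g1
  have k4 := lady4 (c.sz1.P i) c.su2 (ε := 1/10000) (by norm_num) le_rfl le_rfl u2 g2
  have e : P i c.hh = (P i c.u1 * c.z2 + P i c.z2 * c.u1) - (P i c.u2 * c.z1 + P i c.z1 * c.u2) := by
    unfold hh; simp only [map_sub, P_mul]; ring
  have a := (c.su1.P i).mul c.z2
  have b := (c.sz2.P i).mul c.u1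
  have d := (c.su2.P i).mul c.z1
  have f := (c.sz1.P i).mul c.u2
  have s1 := sq_sub_le (a.add b) (d.add f)
  have s2 := sq_add_le a b
  have s3 := sq_add_le d f
  rw [e]
  norm_num at k1 k2 k3 k4
  have n : 0 ≤ c.Z0 * c.Z1 := mul_nonneg c.Z0_nn c.Z1_nn
  have n' : 0 ≤ c.U0 * c.G0 := mul_nonneg c.U0_nn c.G0_nn
  have := gr_nn (P i c.u1); have := gr_nn (P i c.u2); have := gr_nn (P i c.z1); have := gr_nn (P i c.z2)
  have m1 := mul_nonneg (sq_nn (P i c.u1)) n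
  have m2 := mul_nonneg (sq_nn (P i c.u2)) n
  have m3 := mul_nonneg (sq_nn (P i c.z1)) n'
  have m4 := mul_nonneg (sq_nn (P i c.z2)) n'
  linarith

/-- pointwise control of `u₃` -/
structure Ctl (M : ℝ) : Prop where
  l : ∀ x, |(L c.u3) x| ≤ M
  p : ∀ i x, |(P i c.u3) x| ≤ M
  q : ∀ i x, |(P i (L c.u3)) x| ≤ M

variable {c}

lemma zw1_aux {M : ℝ} (hM : c.Ctl M) {b z w u : A} (hb : Sch b) (hz : Sch z) (hu : Sch u) (hbz : b = z - w)
    (hw : ∀ x, |w x| ≤ M) (z0 : sq z ≤ c.Z0) (z1 : gr z ≤ c.Z1) (u0 : sq u ≤ c.U0) (u1 : gr u ≤ c.G0) :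
    sq (b * c.j3 - u * c.om) ≤ (1/200) * (c.Z2 + gr c.om) + 1000000 * (c.Z1 * (c.Z0 * c.Z1))
      + 1000000 * (M ^ 2 * c.Z1) + 1000000 * (M ^ 2 * sq b) + 1000000 * (sq c.om * (c.U0 * c.G0)) := by
  obtain ⟨t1, t2⟩ := c.zeta_le
  have so := c.som; have sz := c.szeta
  have k1 := lady4 so hu (ε := 1/10000) (by norm_num) le_rfl le_rfl u0 u1
  have k2 := lady4 sz hz (ε := 1/10000) (by norm_num) t1 t2 z0 z1
  have k3 := sq_mul_abs (f := w) sz hw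
  have k4 := sq_mul_abs (f := L c.u3) hb hM.l
  have e : b * c.j3 - u * c.om = (((c.zeta * z - w * c.zeta) + L c.u3 * b)) - c.om * u := by
    rw [j3_eq, hbz]; ring
  rw [e]
  have a1 := sz.mul z
  have a2 := sz.mul' w
  have a3 := hb.mul' (L c.u3)
  have a4 := so.mul u
  have s1 := sq_sub_le ((a1.sub a2).add a3) a4
  have s2 := sq_add_le (a1.sub a2) a3
  have s3 := sq_sub_le a1 a2
  norm_num at k1 k2
  have n := mul_nonneg c.Z1_nn (mul_nonneg c.Z0_nn c.Z1_nn)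
  have n' := mul_nonneg (sq_nn c.om) (mul_nonneg c.U0_nn c.G0_nn)
  have n3 := mul_nonneg (sq_nonneg M) c.Z1_nn
  have n4 := mul_nonneg (sq_nonneg M) (sq_nn b)
  have n5 := mul_le_mul_of_nonneg_left t1 (sq_nonneg M)
  have := gr_nn c.om; have := gr_nn c.zeta; have := c.Z1_nn
  linarith

lemma zw1 {M : ℝ} (hM : c.Ctl M) :
    (I (P 0 c.z1 * P 0 c.z1t) + I (P 0 c.z2 * P 0 c.z2t)) + (I (P 1 c.z1 * P 1 c.z1t) + I (P 1 c.z2 * P 1 c.z2t))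
      + I (c.om * c.omt) ≤ -(1/8) * (c.Z2 + gr c.om) +
      1000000000 * ((1 + c.U0 * c.G0 + c.Z0 * c.Z1 + M ^ 2) * (c.Z1 + sq c.om) + M ^ 2 * (sq c.b1 + sq c.b2)) := by
  obtain ⟨u1, u2, g1, g2⟩ := c.U0_ge
  obtain ⟨v1, v2, w1, w2⟩ := c.Z0_ge
  have a0 := c.z_level [0]
  have a1 := c.z_level [1]
  simp only [D_cons, D_nil] at a0 a1
  have b0 := c.hh1 0
  have b1 := c.hh1 1
  have x1 : sq (c.b1 * c.j3 - c.u1 * c.om) ≤ _ := zw1_aux hM c.sb1 c.sz1 c.su1 (w := P 1 c.u3) (by unfold z1; ring) (hM.p 1) v1 w1 u1 g1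
  have x2 : sq (c.b2 * c.j3 - c.u2 * c.om) ≤ _ := zw1_aux hM c.sb2 c.sz2 c.su2 (w := -P 0 c.u3) (by unfold z2; ring)
    (fun x => by rw [A.neg_apply, abs_neg]; exact hM.p 0 x) v2 w2 u2 g2
  have pp := par1 c.som ((c.sb1.mul c.j3).sub (c.su1.mul c.om)) ((c.sb2.mul c.j3).sub (c.su2.mul c.om))
  rw [← omt_eq] at pp
  have go := c.G0_eq
  have g1 := c.G1_eq
  have y1 : c.Z1 = sq (P 0 c.z1) + sq (P 1 c.z1) + (sq (P 0 c.z2) + sq (P 1 c.z2)) := rfl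
  have y2 : c.Z2 = gr (P 0 c.z1) + gr (P 1 c.z1) + gr (P 0 c.z2) + gr (P 1 c.z2) := rfl
  have y3 : c.G0 = sq (P 0 c.u1) + sq (P 1 c.u1) + (sq (P 0 c.u2) + sq (P 1 c.u2)) := rfl
  have n : 0 ≤ c.Z0 * c.Z1 := mul_nonneg c.Z0_nn c.Z1_nn
  have n' : 0 ≤ c.U0 * c.G0 := mul_nonneg c.U0_nn c.G0_nn
  have p1 := c.Z1_nn
  have p2 := sq_nn c.om
  have p3 := sq_nonneg M
  have p4 := gr_nn c.om
  have p5 : 0 ≤ c.Z2 := by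
    rw [y2]; have := gr_nn (P 0 c.z1); have := gr_nn (P 1 c.z1); have := gr_nn (P 0 c.z2); have := gr_nn (P 1 c.z2)
    positivity
  generalize hUU : c.U0 * c.G0 = UU at *
  generalize hZZ : c.Z0 * c.Z1 = ZZ at *
  have q1 : 160000 * (sq (P 0 c.u1) + sq (P 0 c.u2)) * ZZ + 160000 * (sq (P 1 c.u1) + sq (P 1 c.u2)) * ZZ
    = 160000 * (ZZ * sq c.om) := by rw [← go, y3]; ring
  have q2 : 160000 * (sq (P 0 c.z1) + sq (P 0 c.z2)) * UU + 160000 * (sq (P 1 c.z1) + sq (P 1 c.z2)) * UU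
    = 160000 * (UU * c.Z1) := by rw [y1]; ring
  have q3 : (1 + UU + ZZ + M ^ 2) * (c.Z1 + sq c.om) + M ^ 2 * (sq c.b1 + sq c.b2) =
    c.Z1 + sq c.om + UU * c.Z1 + UU * sq c.om + ZZ * c.Z1 + ZZ * sq c.om + M ^ 2 * c.Z1 + M ^ 2 * sq c.om
     + M ^ 2 * sq c.b1 + M ^ 2 * sq c.b2 := by ring
  rw [q3]
  have m1 := mul_nonneg n' p1; have m2 := mul_nonneg n' p2; have m3 := mul_nonneg n p1; have m4 := mul_nonneg n p2
  have m5 := mul_nonneg p3 p1; have m6 := mul_nonneg p3 p2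
  have m7 := mul_nonneg p3 (sq_nn c.b1); have m8 := mul_nonneg p3 (sq_nn c.b2)
  rw [mul_comm c.Z1 ZZ, mul_comm (sq c.om) UU] at x1 x2
  linarith

variable (c)

lemma zz2 : ∑ δ ∈ W 2, (I (D δ c.z1 * D δ c.z1t) + I (D δ c.z2 * D δ c.z2t)) ≤
    -(1/2) * (N 3 c.z1 + N 3 c.z2)
      + 1000000 * ((1 + (S 2 c.u1 + S 2 c.u2)) * (S 2 c.z1 + S 2 c.z2)) := by
  have card : (W 2).card ≤ 4 := by
    unfold W
    exact Finset.card_image_le.trans (by simp)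
  have n1 := S_nn 2 c.u1; have n2 := S_nn 2 c.u2; have n3 := S_nn 2 c.z1; have n4 := S_nn 2 c.z2
  have key : ∀ δ ∈ W 2, I (D δ c.z1 * D δ c.z1t) + I (D δ c.z2 * D δ c.z2t) ≤
      -(1/2) * (gr (D δ c.z1) + gr (D δ c.z2))
        + 30000 * ((1 + (S 2 c.u1 + S 2 c.u2)) * (S 2 c.z1 + S 2 c.z2)) := by
    intro δ hδ
    rw [mem_W] at hδ
    refine (c.z_level δ).trans ?_
    have h1 := sq_sub_le ((c.su1.mul c.z2).D δ) ((c.su2.mul c.z1).D δ)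
    rw [← D_sub] at h1
    have h1 : sq (D δ c.hh) ≤ _ := h1
    have h2 := alg2 c.su1 c.sz2 hδ
    have h3 := alg2 c.su2 c.sz1 hδ
    have h4 := sq_le_S (δ := δ) (j := 2) (by omega) c.z1
    have h5 := sq_le_S (δ := δ) (j := 2) (by omega) c.z2
    nlinarith [mul_nonneg n1 n3, mul_nonneg n2 n3, mul_nonneg n1 n4, mul_nonneg n2 n4]
  refine (Finset.sum_le_sum key).trans ?_
  rw [Finset.sum_add_distrib, ← Finset.mul_sum, Finset.sum_add_distrib, ← N_succ' 2, ← N_succ' 2,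
    Finset.sum_const, nsmul_eq_mul]
  have : ((W 2).card : ℝ) ≤ 4 := by exact_mod_cast card
  have k : 0 ≤ 30000 * ((1 + (S 2 c.u1 + S 2 c.u2)) * (S 2 c.z1 + S 2 c.z2)) := by positivity
  have := mul_le_mul_of_nonneg_right this k
  have k2 : 0 ≤ ((1 + (S 2 c.u1 + S 2 c.u2)) * (S 2 c.z1 + S 2 c.z2)) := by positivity
  linarith

lemma sq2S (i j : Fin 2) (f : A) : sq (P i (P j f)) ≤ S 2 f := sq_le_S (δ := [j, i]) (j := 2) (by simp) f

variable {c}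

lemma bb_aux {M : ℝ} (hM : c.Ctl M) {b z w : A} (hb : Sch b) (hz : Sch z) (hbz : b = z - w)
    (hw : ∀ x, |w x| ≤ M) (i : Fin 2) : sq (b * P i c.j3) ≤
      100 * ((S 2 z + M ^ 2) * (S 2 c.z1 + S 2 c.z2)) + 100 * (M ^ 2 * sq b) := by
  have sz := c.szeta
  have h1 : sq (P i c.zeta) ≤ 2 * (S 2 c.z1 + S 2 c.z2) := by
    unfold zeta
    rw [map_sub]
    have := sq_sub_le ((c.sz2.P 0).P i) ((c.sz1.P 1).P i)
    linarith [sq2S i 0 c.z2, sq2S i 1 c.z1]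
  have h2 := sq_mul_sup (sz.P i) (f := b) (B := 8 * S 2 z + 2 * M ^ 2) (fun x => by
    have k1 := sup_le_S hz x
    have k2 : w x ^ 2 ≤ M ^ 2 :=
      sq_le_sq' (by linarith [neg_abs_le (w x), hw x]) (by linarith [le_abs_self (w x), hw x])
    rw [hbz, A.sub_apply]
    nlinarith [sq_nonneg (z x + w x)])
  have h3 := sq_mul_abs (f := P i (L c.u3)) hb (hM.q i)
  have e : b * P i c.j3 = b * P i c.zeta + P i (L c.u3) * b := by
    rw [j3_eq, map_add]; ring
  rw [e]
  have s1 := sq_add_le ((sz.P i).mul' b) (hb.mul' (P i (L c.u3)))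
  have n3 := S_nn 2 c.z1; have n4 := S_nn 2 c.z2; have n5 := S_nn 2 z; have n6 := sq_nonneg M
  have h4 := mul_le_mul_of_nonneg_left h1 (by positivity : 0 ≤ 8 * S 2 z + 2 * M ^ 2)
  have h5 : 0 ≤ M ^ 2 * sq b := mul_nonneg n6 (sq_nn b)
  nlinarith [mul_nonneg n5 n3, mul_nonneg n5 n4, mul_nonneg n6 n3, mul_nonneg n6 n4]

lemma bb1 {M : ℝ} (hM : c.Ctl M) : I (P 0 c.b3 * P 0 c.b3t) + I (P 1 c.b3 * P 1 c.b3t) ≤ -(1/2) * N 2 c.b3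
    + 100000 * ((S 2 c.u1 + S 2 c.u2) * gr c.b3 + M ^ 2 * (sq c.b1 + sq c.b2)
      + (S 2 c.z1 + S 2 c.z2 + M ^ 2) * (S 2 c.z1 + S 2 c.z2)) := by
  have su1 := c.su1; have su2 := c.su2; have su3 := c.su3
  have sb1 := c.sb1; have sb2 := c.sb2; have sb3 := c.sb3
  rw [N_two sb3]
  have e : c.b3t = L c.b3 + (((P 0 c.u3 * c.b1 + P 1 c.u3 * c.b2) - (c.u1 * P 0 c.b3 + c.u2 * P 1 c.b3))
    - (c.b1 * P 0 c.j3 + c.b2 * P 1 c.j3)) := by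
    rw [b3t_eq]; ring
  set G := (((P 0 c.u3 * c.b1 + P 1 c.u3 * c.b2) - (c.u1 * P 0 c.b3 + c.u2 * P 1 c.b3))
    - (c.b1 * P 0 c.j3 + c.b2 * P 1 c.j3)) with hG
  have a1 := sb1.mul' (P 0 c.u3)
  have a2 := sb2.mul' (P 1 c.u3)
  have a3 := su1.mul (P 0 c.b3)
  have a4 := su2.mul (P 1 c.b3)
  have a5 := sb1.mul (P 0 c.j3)
  have a6 := sb2.mul (P 1 c.j3)
  have sG : Sch G := ((a1.add a2).sub (a3.add a4)).sub (a5.add a6)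
  have h1 : I (P 0 c.b3 * P 0 c.b3t) + I (P 1 c.b3 * P 1 c.b3t) = -(sq (L c.b3) + I (L c.b3 * G)) := by
    unfold sq
    rw [← I_add ((sb3.P 0).mul _) ((sb3.P 1).mul _), ← I_add (sb3.L.mul _) (sb3.L.mul _), ← I_neg]
    refine ibp (f := P 0 c.b3 * c.b3t) (g := P 1 c.b3 * c.b3t) ((sb3.P 0).mul _) ((sb3.P 1).mul _) ?_
    rw [e]; simp only [P_mul, map_add]; unfold L; ring
  have h2 := young sb3.L sG (δ := 1/2) (by norm_num)
  have h3 := neg_abs_le (I (L c.b3 * G))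
  have s1 := sq_sub_le ((a1.add a2).sub (a3.add a4)) (a5.add a6)
  rw [← hG] at s1
  have s2 := sq_sub_le (a1.add a2) (a3.add a4)
  have s3 := sq_add_le a1 a2
  have s4 := sq_add_le a3 a4
  have s5 := sq_add_le a5 a6
  have k1 := sq_mul_abs (f := P 0 c.u3) sb1 (hM.p 0)
  have k2 := sq_mul_abs (f := P 1 c.u3) sb2 (hM.p 1)
  have k3 := sq_mul_sup (sb3.P 0) (f := c.u1) (sup_le_S su1)
  have k4 := sq_mul_sup (sb3.P 1) (f := c.u2) (sup_le_S su2)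
  have k5 := bb_aux hM c.sb1 c.sz1 (w := P 1 c.u3) (by unfold z1; ring) (hM.p 1) 0
  have k6 := bb_aux hM c.sb2 c.sz2 (w := -P 0 c.u3) (by unfold z2; ring)
    (fun x => by rw [A.neg_apply, abs_neg]; exact hM.p 0 x) 1
  have n1 := S_nn 2 c.u1; have n2 := S_nn 2 c.u2
  have n3 := S_nn 2 c.z1; have n4 := S_nn 2 c.z2; have n6 := sq_nonneg M
  have n7 := sq_nn (P 0 c.b3); have n8 := sq_nn (P 1 c.b3)
  have m1 := mul_nonneg n1 n7; have m2 := mul_nonneg n1 n8; have m3 := mul_nonneg n2 n7; have m4 := mul_nonneg n2 n8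
  have m5 := mul_nonneg n6 (sq_nn c.b1); have m6 := mul_nonneg n6 (sq_nn c.b2)
  have m7 := mul_nonneg n6 n3; have m8 := mul_nonneg n6 n4
  have m9 := mul_nonneg n3 n3; have m10 := mul_nonneg n3 n4; have m11 := mul_nonneg n4 n4
  rw [h1]
  norm_num at h2
  unfold gr
  linarith

lemma uu2_aux {M : ℝ} {h f g : A} (hh : ∀ x, |h x| ≤ M) (hf : Sch f) (hg : Sch g) :
    |I (h * (f * g))| ≤ M ^ 2 * sq f + sq g := by
  have h1 := young (hf.mul' h) hg (δ := 1) one_pos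
  have h2 := sq_mul_abs hf hh
  have h3 := sq_nn g
  rw [mul_assoc] at h1
  norm_num at h1
  linarith

lemma uu2 {M : ℝ} (hM : c.Ctl M) : I (L c.u3 * L c.u3t) ≤ - gr (L c.u3) +
    10 * (M ^ 2 * (gr c.b3 + sq c.b1 + sq c.b2 + sq c.u1 + sq c.u2 + c.G0) + (gr c.b1 + gr c.b2)
      + N 2 c.b3 + gr c.u3 + N 2 c.u3) := by
  have su1 := c.su1; have su2 := c.su2; have su3 := c.su3
  have sb1 := c.sb1; have sb2 := c.sb2; have sb3 := c.sb3
  set K := ((c.b1 * P 0 c.b3 + c.b2 * P 1 c.b3) - (c.u1 * P 0 c.u3 + c.u2 * P 1 c.u3)) with hK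
  have sK : Sch K := ((sb1.mul _).add (sb2.mul _)).sub ((su1.mul _).add (su2.mul _))
  have e : I (L c.u3 * L c.u3t) = -(gr (L c.u3)) - (I (P 0 (L c.u3) * P 0 K) + I (P 1 (L c.u3) * P 1 K)) := by
    unfold gr sq
    have t := fun i => ((su3.L.P i).mul (P i (L c.u3)))
    have t' := fun i => ((su3.L.P i).mul (P i K))
    rw [← I_add (t 0) (t 1), ← I_add (t' 0) (t' 1), ← I_neg, ← I_sub ((t 0).add (t 1)).neg ((t' 0).add (t' 1))]
    refine ibp (f := L c.u3 * P 0 c.u3t) (g := L c.u3 * P 1 c.u3t) (su3.L.mul _) (su3.L.mul _) ?_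
    have : c.u3t = L c.u3 + K := c.u3t_eq
    rw [this]
    simp only [P_mul, map_add]
    rw [show L (L c.u3 + K) = P 0 (P 0 (L c.u3)) + P 0 (P 0 K) + (P 1 (P 1 (L c.u3)) + P 1 (P 1 K)) by
      unfold L; simp only [map_add]]
    ring
  have key : ∀ i, -I (P i (L c.u3) * P i K) ≤
      M ^ 2 * (sq (P 0 c.b3) + sq (P 1 c.b3)) + M ^ 2 * (sq c.b1 + sq c.b2) + M ^ 2 * (sq (P i c.u1) + sq (P i c.u2))
      + M ^ 2 * (sq c.u1 + sq c.u2) + (sq (P i c.b1) + sq (P i c.b2)) + (sq (P i (P 0 c.b3)) + sq (P i (P 1 c.b3)))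
      + (sq (P 0 c.u3) + sq (P 1 c.u3)) + (sq (P i (P 0 c.u3)) + sq (P i (P 1 c.u3))) := by
    intro i
    have hq := hM.q i
    have k1 := uu2_aux hq (sb3.P 0) (sb1.P i)
    have k2 := uu2_aux hq (sb3.P 1) (sb2.P i)
    have k3 := uu2_aux hq sb1 ((sb3.P 0).P i)
    have k4 := uu2_aux hq sb2 ((sb3.P 1).P i)
    have k5 := uu2_aux hq (su1.P i) (su3.P 0)
    have k6 := uu2_aux hq (su2.P i) (su3.P 1)
    have k7 := uu2_aux hq su1 ((su3.P 0).P i)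
    have k8 := uu2_aux hq su2 ((su3.P 1).P i)
    set h := P i (L c.u3)
    have e : h * P i K = ((h * (P 0 c.b3 * P i c.b1) + h * (P 1 c.b3 * P i c.b2))
      + (h * (c.b1 * P i (P 0 c.b3)) + h * (c.b2 * P i (P 1 c.b3))))
      - ((h * (P i c.u1 * P 0 c.u3) + h * (P i c.u2 * P 1 c.u3))
      + (h * (c.u1 * P i (P 0 c.u3)) + h * (c.u2 * P i (P 1 c.u3)))) := by
      rw [hK]; simp only [P_mul, map_add, map_sub]; ring
    have t1 := ((sb3.P 0).mul (P i c.b1)).mul' h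
    have t2 := ((sb3.P 1).mul (P i c.b2)).mul' h
    have t3 := (sb1.mul (P i (P 0 c.b3))).mul' h
    have t4 := (sb2.mul (P i (P 1 c.b3))).mul' h
    have t5 := ((su1.P i).mul (P 0 c.u3)).mul' h
    have t6 := ((su2.P i).mul (P 1 c.u3)).mul' h
    have t7 := (su1.mul (P i (P 0 c.u3))).mul' h
    have t8 := (su2.mul (P i (P 1 c.u3))).mul' h
    rw [e, I_sub ((t1.add t2).add (t3.add t4)) ((t5.add t6).add (t7.add t8)), I_add (t1.add t2) (t3.add t4),
      I_add (t5.add t6) (t7.add t8), I_add t1 t2, I_add t3 t4, I_add t5 t6, I_add t7 t8]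
    have a1 := abs_le.1 k1; have a2 := abs_le.1 k2; have a3 := abs_le.1 k3; have a4 := abs_le.1 k4
    have a5 := abs_le.1 k5; have a6 := abs_le.1 k6; have a7 := abs_le.1 k7; have a8 := abs_le.1 k8
    linarith [a1.1, a2.1, a3.1, a4.1, a5.2, a6.2, a7.2, a8.2]
  have k0 := key 0
  have k1 := key 1
  rw [e]
  have nn : ∀ f, N 2 f = sq (P 0 (P 0 f)) + sq (P 0 (P 1 f)) + (sq (P 0 (P 1 f)) + sq (P 1 (P 1 f))) := by
    intro f; rw [N_succ, N_one, N_one]; unfold gr; rw [P10]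
  rw [nn, nn]
  rw [P10, P10] at k1
  unfold G0 gr
  have n6 := sq_nonneg M
  have m0 := mul_nonneg n6 (sq_nn c.b1); have m1 := mul_nonneg n6 (sq_nn c.b2)
  have m2 := mul_nonneg n6 (sq_nn c.u1); have m3 := mul_nonneg n6 (sq_nn c.u2)
  have m4 := mul_nonneg n6 (sq_nn (P 0 c.b3)); have m5 := mul_nonneg n6 (sq_nn (P 1 c.b3))
  have m6 := mul_nonneg n6 (sq_nn (P 0 c.u1)); have m7 := mul_nonneg n6 (sq_nn (P 1 c.u1))
  have m8 := mul_nonneg n6 (sq_nn (P 0 c.u2)); have m9 := mul_nonneg n6 (sq_nn (P 1 c.u2))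
  have q := fun i f => sq_nn (P i f)
  have q1 := q 0 c.b1; have q2 := q 1 c.b1; have q3 := q 0 c.b2; have q4 := q 1 c.b2
  have q5 := q 0 c.u3; have q6 := q 1 c.u3
  have r1 := q 0 (P 0 c.b3); have r2 := q 0 (P 1 c.b3); have r3 := q 1 (P 1 c.b3)
  have r4 := q 0 (P 0 c.u3); have r5 := q 0 (P 1 c.u3); have r6 := q 1 (P 1 c.u3)
  simp only [mul_add] at k0 k1 ⊢
  linarith

end Cfg
end HM
end
end

section
open MeasureTheory Set Filter Topology
open scoped ENNReal ContDiff
set_option linter.unusedSimpArgs false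

noncomputable section
namespace HM

/-! ### cutoffs -/

lemma cutoffs : ∃ χ : ℕ → A, (∀ n, Wgt (χ n)) ∧ (∀ n, HasCompactSupport (χ n)) ∧
    ∀ x, Tendsto (fun n => (χ n) x) atTop (𝓝 1) := by
  obtain ⟨C0, hC0, h0⟩ := (P 0 theta).bdd
  obtain ⟨C1, hC1, h1⟩ := (P 1 theta).bdd
  set s : ℕ → ℝ := fun n => (1 / ((n:ℝ) + 1)) * (1 + C0 + C1)⁻¹ with hs
  have hs0 : ∀ n, 0 < s n := fun n => by positivity
  have hs1 : ∀ n, s n * (1 + C0 + C1) ≤ 1 := fun n => by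
    rw [hs]; simp only
    rw [inv_mul_cancel_right₀ (by positivity)]
    rw [div_le_one (by positivity)]; linarith [Nat.cast_nonneg (α := ℝ) n]
  have hst : Tendsto s atTop (𝓝 0) := by
    have := (tendsto_one_div_add_atTop_nhds_zero_nat (𝕜 := ℝ)).mul_const ((1 + C0 + C1)⁻¹)
    rwa [zero_mul] at this
  have th : ∀ y, theta y = Real.smoothTransition (1 - (y 0 ^ 2 + y 1 ^ 2)) := fun y => rfl
  refine ⟨fun n => tau 0 (s n) theta, fun n => ⟨fun x => ?_, fun i x => ?_⟩, fun n => ?_, fun x => ?_⟩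
  · rw [tau_apply, th, sq_le_one_iff_abs_le_one, abs_of_nonneg (Real.smoothTransition.nonneg _)]
    exact Real.smoothTransition.le_one _
  · rw [P_tau, A.smul_apply, tau_apply, sq_le_one_iff_abs_le_one, abs_mul, abs_of_pos (hs0 n)]
    refine le_trans ?_ (hs1 n)
    refine mul_le_mul_of_nonneg_left ?_ (hs0 n).le
    fin_cases i
    · have := h0 (0 + s n • x); simp only [Fin.zero_eta]; linarith
    · have := h1 (0 + s n • x); simp only [Fin.mk_one]; linarith
  · refine HasCompactSupport.intro (isCompact_closedBall (0:E2) (s n)⁻¹) fun x hx => ?_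
    rw [tau_apply, th]
    refine Real.smoothTransition.zero_of_nonpos (theta_aux _ ?_).le
    rw [mem_closedBall_zero_iff] at hx ⊢
    rw [zero_add, norm_smul, Real.norm_of_nonneg (hs0 n).le]
    intro h
    apply hx
    rw [← mul_le_mul_iff_of_pos_left (hs0 n), mul_inv_cancel₀ (hs0 n).ne']
    exact h
  · have h2 : Tendsto (fun n => (0:E2) + s n • x) atTop (𝓝 ((0:E2) + (0:ℝ) • x)) :=
      tendsto_const_nhds.add (hst.smul_const x)
    have h3 := (theta.cont.tendsto _).comp h2
    have : theta ((0:E2) + (0:ℝ) • x) = 1 := by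
      rw [th]; simp
    rw [this] at h3
    exact h3

def chi : ℕ → A := cutoffs.choose
lemma chi_w (n : ℕ) : Wgt (chi n) := cutoffs.choose_spec.1 n
lemma chi_c (n : ℕ) : HasCompactSupport (chi n) := cutoffs.choose_spec.2.1 n
lemma chi_t (x : E2) : Tendsto (fun n => (chi n) x) atTop (𝓝 1) := cutoffs.choose_spec.2.2 x

lemma chi_lim {f : A} (hf : Sch f) : Tendsto (fun n => I (chi n * chi n * f)) atTop (𝓝 (I f)) := by
  unfold I
  refine tendsto_integral_of_dominated_convergence (fun x => |f x|)
    (fun n => (chi n * chi n * f).cont.aestronglyMeasurable) hf.integrable.abs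
    (fun n => Eventually.of_forall fun x => ?_) (Eventually.of_forall fun x => ?_)
  · simp only [A.mul_apply, Real.norm_eq_abs, abs_mul]
    have := (chi_w n).le x
    rw [sq_le_one_iff_abs_le_one] at this
    have h2 : |(chi n) x| * |(chi n) x| ≤ 1 := by nlinarith [abs_nonneg ((chi n) x)]
    exact mul_le_of_le_one_left (abs_nonneg _) h2
  · simpa using ((chi_t x).mul (chi_t x)).mul_const (f x)

lemma sq_chi (χ f : A) : sq (χ * f) = I (χ * χ * (f * f)) := by unfold sq; congr 1; ring

lemma chi_sq {f : A} (hf : Sch f) : Tendsto (fun n => sq (chi n * f)) atTop (𝓝 (sq f)) := by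
  simp only [sq_chi]; exact chi_lim (hf.mul f)

/-! ### time evolution -/

structure Evo (T : ℝ) (f ft : ℝ → A) : Prop where
  sm : ContDiffOn ℝ ∞ (fun p : ℝ × E2 => (f p.1) p.2) (Ioo 0 T ×ˢ univ)
  hd : ∀ t ∈ Ioo 0 T, ∀ x, HasDerivAt (fun s => (f s) x) ((ft t) x) t

variable {T : ℝ} {f ft g gt : ℝ → A}

lemma opn : IsOpen (Ioo 0 T ×ˢ (univ : Set E2)) := isOpen_Ioo.prod isOpen_univ

lemma Evo.cont (h : Evo T f ft) : ContinuousOn (fun p : ℝ × E2 => (f p.1) p.2) (Ioo 0 T ×ˢ univ) :=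
  h.sm.continuousOn

lemma Evo.ft_eq (h : Evo T f ft) {t : ℝ} (ht : t ∈ Ioo 0 T) (x : E2) :
    (ft t) x = fderiv ℝ (fun p : ℝ × E2 => (f p.1) p.2) (t, x) (1, 0) := by
  have hF : HasFDerivAt (fun p : ℝ × E2 => (f p.1) p.2) _ (t, x) :=
    ((h.sm.contDiffAt (opn.mem_nhds ⟨ht, mem_univ _⟩)).differentiableAt (by simp)).hasFDerivAt
  have h2 : HasDerivAt (fun s : ℝ => (s, x)) ((1:ℝ), (0:E2)) t :=
    (hasDerivAt_id t).prodMk (hasDerivAt_const t x)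
  have h3 := hF.comp_hasDerivAt t h2
  exact (h.hd t ht x).unique h3

lemma pd_joint {F : ℝ × E2 → ℝ} (hF : ContDiffOn ℝ ∞ F (Ioo 0 T ×ˢ univ)) (i : Fin 2) {t : ℝ}
    (ht : t ∈ Ioo 0 T) (x : E2) : pd i (fun y => F (t, y)) x = fderiv ℝ F (t, x) (0, Pi.single i 1) := by
  have hF : HasFDerivAt F _ (t, x) :=
    ((hF.contDiffAt (opn.mem_nhds ⟨ht, mem_univ _⟩)).differentiableAt (by simp)).hasFDerivAt
  have h2 : HasFDerivAt (fun y : E2 => (t, y)) (ContinuousLinearMap.inr ℝ ℝ E2) x :=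
    (hasFDerivAt_const t x).prodMk (hasFDerivAt_id x)
  have := (hF.comp x h2).fderiv
  unfold pd
  change fderiv ℝ (F ∘ fun y : E2 => (t, y)) x _ = _
  rw [this]; simp

lemma fd_smooth {F : ℝ × E2 → ℝ} (hF : ContDiffOn ℝ ∞ F (Ioo 0 T ×ˢ univ)) :
    ContDiffOn ℝ ∞ (fderiv ℝ F) (Ioo 0 T ×ˢ univ) :=
  hF.fderiv_of_isOpen opn (by simp)

lemma Evo.smt (h : Evo T f ft) : ContDiffOn ℝ ∞ (fun p : ℝ × E2 => (ft p.1) p.2) (Ioo 0 T ×ˢ univ) := by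
  have := (fd_smooth h.sm).clm_apply (contDiffOn_const (c := ((1:ℝ), (0:E2))))
  refine this.congr fun p hp => ?_
  exact h.ft_eq hp.1 p.2

lemma mixed {F : ℝ × E2 → ℝ} (hF : ContDiffOn ℝ ∞ F (Ioo 0 T ×ˢ univ)) (e : E2) {t : ℝ}
    (ht : t ∈ Ioo 0 T) (x : E2) : HasDerivAt (fun s => fderiv ℝ F (s, x) (0, e))
      (fderiv ℝ (fun p => fderiv ℝ F p (1, 0)) (t, x) (0, e)) t := by
  have hmem : Ioo 0 T ×ˢ (univ : Set E2) ∈ 𝓝 (t, x) := opn.mem_nhds ⟨ht, mem_univ _⟩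
  have hF2 : HasFDerivAt (fderiv ℝ F) (fderiv ℝ (fderiv ℝ F) (t, x)) (t, x) :=
    (((fd_smooth hF).contDiffAt hmem).differentiableAt (by simp)).hasFDerivAt
  have sym : IsSymmSndFDerivAt ℝ F (t, x) := (hF.contDiffAt hmem).isSymmSndFDerivAt
    (by rw [minSmoothness_of_isRCLikeNormedField]; exact WithTop.coe_le_coe.2 le_top)
  have h2 : HasDerivAt (fun s : ℝ => (s, x)) ((1:ℝ), (0:E2)) t :=
    (hasDerivAt_id t).prodMk (hasDerivAt_const t x)
  have h1 : ∀ v : ℝ × E2, HasFDerivAt (fun p => fderiv ℝ F p v)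
      ((ContinuousLinearMap.apply ℝ ℝ v).comp (fderiv ℝ (fderiv ℝ F) (t, x))) (t, x) := fun v =>
    (ContinuousLinearMap.apply ℝ ℝ v).hasFDerivAt.comp (t, x) hF2
  have h3 := (h1 (0, e)).comp_hasDerivAt t h2
  rw [(h1 (1, 0)).fderiv]
  refine h3.congr_deriv ?_
  have := sym (1, 0) (0, e)
  exact this

lemma Evo.P (h : Evo T f ft) (i : Fin 2) : Evo T (fun t => P i (f t)) (fun t => P i (ft t)) := by
  have hG := (fd_smooth h.sm).clm_apply (contDiffOn_const (c := ((0:ℝ), (Pi.single i 1 : E2))))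
  have e : ∀ p ∈ Ioo 0 T ×ˢ (univ : Set E2), (HM.P i (f p.1)) p.2 =
      fderiv ℝ (fun p : ℝ × E2 => (f p.1) p.2) p (0, Pi.single i 1) :=
    fun p hp => pd_joint h.sm i hp.1 p.2
  refine ⟨hG.congr e, fun t ht x => ?_⟩
  have hmem : Ioo 0 T ×ˢ (univ : Set E2) ∈ 𝓝 (t, x) := opn.mem_nhds ⟨ht, mem_univ _⟩
  have h4 : HasDerivAt (fun s => (HM.P i (f s)) x) (fderiv ℝ (fun p => fderiv ℝ
      (fun p : ℝ × E2 => (f p.1) p.2) p (1, 0)) (t, x) (0, Pi.single i 1)) t := by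
    refine HasDerivAt.congr_of_eventuallyEq (mixed h.sm (Pi.single i 1) ht x) ?_
    filter_upwards [isOpen_Ioo.mem_nhds ht] with s hs
    exact e (s, x) ⟨hs, mem_univ _⟩
  have h5 : (fun p : ℝ × E2 => (ft p.1) p.2) =ᶠ[𝓝 (t, x)]
      fun p => fderiv ℝ (fun p : ℝ × E2 => (f p.1) p.2) p (1, 0) := by
    filter_upwards [hmem] with p hp using h.ft_eq hp.1 p.2
  have h7 := pd_joint h.smt i ht x
  rw [h5.fderiv_eq] at h7
  exact h4.congr_deriv h7.symm

lemma Evo.D (δ : List (Fin 2)) : ∀ {f ft : ℝ → A}, Evo T f ft → Evo T (fun t => D δ (f t)) (fun t => D δ (ft t)) := by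
  induction δ with
  | nil => intro f ft h; exact h
  | cons i δ ih => intro f ft h; exact ih (h.P i)

lemma Evo.add (h : Evo T f ft) (h' : Evo T g gt) : Evo T (fun t => f t + g t) (fun t => ft t + gt t) :=
  ⟨h.sm.add h'.sm, fun t ht x => (h.hd t ht x).add (h'.hd t ht x)⟩
lemma Evo.sub (h : Evo T f ft) (h' : Evo T g gt) : Evo T (fun t => f t - g t) (fun t => ft t - gt t) :=
  ⟨h.sm.sub h'.sm, fun t ht x => (h.hd t ht x).sub (h'.hd t ht x)⟩
lemma Evo.L (h : Evo T f ft) : Evo T (fun t => L (f t)) (fun t => L (ft t)) :=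
  ((h.P 0).P 0).add ((h.P 1).P 1)
lemma Evo.sub_const (h : Evo T f ft) (g : A) : Evo T (fun t => f t - g) ft :=
  ⟨h.sm.sub (g.smooth.contDiffOn.comp contDiffOn_snd fun _ _ => mem_univ _),
    fun t ht x => (h.hd t ht x).sub_const _⟩
lemma Evo.congr (h : Evo T f ft) {f' ft' : ℝ → A} (e : ∀ t ∈ Ioo 0 T, f' t = f t)
    (e' : ∀ t ∈ Ioo 0 T, ft' t = ft t) : Evo T f' ft' := by
  refine ⟨h.sm.congr fun p hp => by rw [e p.1 hp.1], fun t ht x => ?_⟩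
  rw [e' t ht]
  refine (h.hd t ht x).congr_of_eventuallyEq ?_
  filter_upwards [isOpen_Ioo.mem_nhds ht] with s hs
  rw [e s hs]

/-- energy derivative with compact cutoff -/
lemma Evo.en_chi (h : Evo T f ft) {χ : A} (hc : HasCompactSupport χ) {t : ℝ} (ht : t ∈ Ioo 0 T) :
    HasDerivAt (fun s => I (χ * χ * (f s * f s))) (2 * I (χ * χ * (f t * ft t))) t := by
  obtain ⟨a, ha, hta⟩ := exists_between ht.1
  obtain ⟨b, htb, hb⟩ := exists_between ht.2
  have hsub : Icc a b ×ˢ tsupport χ ⊆ Ioo 0 T ×ˢ univ := fun p hp =>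
    ⟨⟨ha.trans_le hp.1.1, hp.1.2.trans_lt hb⟩, mem_univ _⟩
  have hK : IsCompact (Icc a b ×ˢ tsupport χ) := isCompact_Icc.prod hc
  obtain ⟨B, hB⟩ := hK.exists_bound_of_continuousOn
    ((h.cont.mono hsub).mul (h.smt.continuousOn.mono hsub))
  have B' : ∀ s ∈ Icc a b, ∀ x, |χ x * χ x * ((f s) x * (ft s) x)| ≤ B * (χ x * χ x) := by
    intro s hs x
    rw [abs_mul, abs_mul_self, mul_comm]
    by_cases hx : x ∈ tsupport χ
    · exact mul_le_mul_of_nonneg_right (hB (s, x) ⟨hs, hx⟩) (mul_self_nonneg _)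
    · simp [image_eq_zero_of_notMem_tsupport hx]
  have cc : HasCompactSupport (fun x => χ x * χ x) := hc.mul_right
  have int : ∀ g : A, Integrable (χ * χ * g : A) := fun g =>
    (χ * χ * g).cont.integrable_of_hasCompactSupport (cc.mul_right (f' := g))
  have key := hasDerivAt_integral_of_dominated_loc_of_deriv_le (μ := (volume : Measure E2))
    (F := fun s x => χ x * χ x * ((f s) x * (f s) x)) (x₀ := t) (s := Icc a b)
    (F' := fun s x => 2 * (χ x * χ x * ((f s) x * (ft s) x)))
    (bound := fun x => 2 * (B * (χ x * χ x))) (Icc_mem_nhds hta htb)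
    (Eventually.of_forall fun t => (χ * χ * (f t * f t)).cont.aestronglyMeasurable)
    (int (f t * f t)) ((int (f t * ft t)).const_mul 2).aestronglyMeasurable
    (Eventually.of_forall fun x s hs => ?_)
    (((by simpa using! int 1 : Integrable (fun x => χ x * χ x)).const_mul B).const_mul 2)
    (Eventually.of_forall fun x s hs => ?_)
  · have := key.2
    rw [integral_const_mul] at this
    exact this
  · rw [norm_mul, Real.norm_of_nonneg zero_le_two]
    exact mul_le_mul_of_nonneg_left (B' s hs x) zero_le_two
  · have := h.hd s ⟨ha.trans_le hs.1, hs.2.trans_lt hb⟩ x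
    refine ((this.mul this).const_mul _).congr_deriv ?_
    ring

end HM
end
end

section
open MeasureTheory Set Filter Topology
open scoped ENNReal ContDiff
set_option linter.unusedSimpArgs false

noncomputable section
namespace HM

/-- locally bounded above on `(0,T)` -/
def LBd (T : ℝ) (g : ℝ → ℝ) : Prop := ∀ a b : ℝ, 0 < a → b < T → ∃ C : ℝ, ∀ t ∈ Icc a b, g t ≤ C

variable {T : ℝ}

lemma LBd.mono {g h : ℝ → ℝ} (hh : LBd T h) (e : ∀ t ∈ Ioo 0 T, g t ≤ h t) : LBd T g := by
  intro a b ha hb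
  obtain ⟨C, hC⟩ := hh a b ha hb
  exact ⟨C, fun t ht => (e t ⟨ha.trans_le ht.1, ht.2.trans_lt hb⟩).trans (hC t ht)⟩

lemma LBd.add {g h : ℝ → ℝ} (hg : LBd T g) (hh : LBd T h) : LBd T (fun t => g t + h t) := by
  intro a b ha hb
  obtain ⟨C, hC⟩ := hg a b ha hb
  obtain ⟨C', hC'⟩ := hh a b ha hb
  exact ⟨C + C', fun t ht => add_le_add (hC t ht) (hC' t ht)⟩

lemma LBd.const (c : ℝ) : LBd T (fun _ => c) := fun _ _ _ _ => ⟨c, fun _ _ => le_rfl⟩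

lemma LBd.mul {g h : ℝ → ℝ} (hg : LBd T g) (hh : LBd T h) (ng : ∀ t, 0 ≤ g t) (nh : ∀ t, 0 ≤ h t) :
    LBd T (fun t => g t * h t) := by
  intro a b ha hb
  obtain ⟨C, hC⟩ := hg a b ha hb
  obtain ⟨C', hC'⟩ := hh a b ha hb
  exact ⟨C * C', fun t ht => mul_le_mul (hC t ht) (hC' t ht) (nh t) ((ng t).trans (hC t ht))⟩

lemma LBd.cmul {g : ℝ → ℝ} (hg : LBd T g) {c : ℝ} (hc : 0 ≤ c) : LBd T (fun t => c * g t) := by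
  intro a b ha hb
  obtain ⟨C, hC⟩ := hg a b ha hb
  exact ⟨c * C, fun t ht => mul_le_mul_of_nonneg_left (hC t ht) hc⟩

lemma LBd.sum {ι : Type*} (s : Finset ι) {g : ι → ℝ → ℝ} (hg : ∀ i ∈ s, LBd T (g i)) :
    LBd T (fun t => ∑ i ∈ s, g i t) := by
  classical
  induction s using Finset.induction_on with
  | empty => simpa using LBd.const 0
  | insert i s hi ih =>
    simp only [Finset.sum_insert hi]
    exact (hg i (by simp)).add (ih fun j hj => hg j (by simp [hj]))

/-- fields all of whose space derivatives are locally bounded in L2 -/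
structure LB (T : ℝ) (f : ℝ → A) : Prop where
  s : ∀ t, Sch (f t)
  b : ∀ δ, LBd T (fun t => sq (D δ (f t)))

variable {f ft g gt : ℝ → A}

lemma LB.N (hf : LB T f) (k : ℕ) : LBd T (fun t => N k (f t)) := LBd.sum _ fun δ _ => hf.b δ
lemma LB.S (hf : LB T f) (k : ℕ) : LBd T (fun t => S k (f t)) := LBd.sum _ fun k _ => hf.N k
lemma LB.of_S (s : ∀ t, Sch (f t)) (h : ∀ k, LBd T (fun t => HM.S k (f t))) : LB T f :=
  ⟨s, fun δ => (h δ.length).mono fun t _ => sq_le_S le_rfl _⟩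
lemma LB.sq (hf : LB T f) : LBd T (fun t => sq (f t)) := hf.b []
lemma LB.D (hf : LB T f) (δ : List (Fin 2)) : LB T (fun t => D δ (f t)) := by
  refine ⟨fun t => (hf.s t).D δ, fun β => ?_⟩
  have e : ∀ (β δ : List (Fin 2)) (f : A), HM.D β (HM.D δ f) = HM.D (δ ++ β) f := by
    intro β δ
    induction δ with
    | nil => intro f; rfl
    | cons i δ ih => intro f; rw [D_cons, ih]; rfl
  simp only [e]
  exact hf.b _
lemma LB.P (hf : LB T f) (i : Fin 2) : LB T (fun t => P i (f t)) := hf.D [i]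
lemma LB.add (hf : LB T f) (hg : LB T g) : LB T (fun t => f t + g t) := by
  refine ⟨fun t => (hf.s t).add (hg.s t), fun δ => ?_⟩
  refine LBd.mono (((hf.b δ).cmul zero_le_two).add ((hg.b δ).cmul zero_le_two)) fun t _ => ?_
  rw [D_add]; exact sq_add_le ((hf.s t).D δ) ((hg.s t).D δ)
lemma LB.neg (hf : LB T f) : LB T (fun t => - f t) := by
  refine ⟨fun t => (hf.s t).neg, fun δ => ?_⟩
  simp only [D_neg, sq_neg']; exact hf.b δ
lemma LB.sub (hf : LB T f) (hg : LB T g) : LB T (fun t => f t - g t) := by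
  simp only [sub_eq_add_neg]; exact hf.add hg.neg
lemma LB.L (hf : LB T f) : LB T (fun t => L (f t)) := ((hf.P 0).P 0).add ((hf.P 1).P 1)
lemma LB.mul (hf : LB T f) (hg : LB T g) : LB T (fun t => f t * g t) := by
  refine ⟨fun t => (hf.s t).mul _, fun δ => ?_⟩
  have q := fun k => (hf.S k).add (hg.S k)
  have qn : ∀ k t, 0 ≤ HM.S k (f t) + HM.S k (g t) := fun k t => add_nonneg (S_nn _ _) (S_nn _ _)
  refine LBd.mono (((((q 2).add (q (δ.length - 1))).mul (q δ.length)
    (fun t => add_nonneg (qn _ t) (qn _ t)) (fun t => qn _ t)).cmul (c := 8) (by norm_num)).cmul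
    (c := 4 ^ δ.length) (by positivity)) fun t _ => ?_
  have := leib 1 δ (hf.s t) (hg.s t) (fun β γ h => by
    rw [one_mul]
    exact prod_bound (hf.s t) (hg.s t) (Q := fun j => HM.S j (f t) + HM.S j (g t))
      (fun j => le_add_of_nonneg_right (S_nn _ _)) (fun j => le_add_of_nonneg_left (S_nn _ _)) h)
  rwa [one_mul] at this

/-- Lipschitz in time -/
lemma Evo.lip (h : Evo T f ft) (sf : ∀ t, Sch (f t)) (sft : ∀ t, Sch (ft t)) {a b C : ℝ} (ha : 0 < a)
    (hb : b < T) (hC0 : 0 ≤ C) (hC : ∀ t ∈ Icc a b, sq (ft t) ≤ C ^ 2) {s t : ℝ} (hs : a ≤ s) (hst : s < t)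
    (ht : t ≤ b) : sq (f t - f s) ≤ ((C + 2) * (t - s)) ^ 2 := by
  refine le_of_tendsto (chi_sq ((sf t).sub (sf s))) (Eventually.of_forall fun n => ?_)
  set χ := chi n
  have E := h.sub_const (f s)
  have hd : ∀ τ ∈ Icc s t, HasDerivAt (fun τ => sq (χ * (f τ - f s)))
      (2 * I (χ * χ * ((f τ - f s) * ft τ))) τ := fun τ hτ => by
    simp only [sq_chi]
    exact E.en_chi (chi_c n) ⟨by linarith [hτ.1], by linarith [hτ.2]⟩
  have key := image_le_of_deriv_right_lt_deriv_boundary (a := s) (b := t)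
    (f := fun τ => sq (χ * (f τ - f s))) (f' := fun τ => 2 * I (χ * χ * ((f τ - f s) * ft τ)))
    (B := fun τ => ((C + 1) * (τ - s) + (t - s)) ^ 2)
    (B' := fun τ => 2 * ((C + 1) * (τ - s) + (t - s)) * (C + 1))
    (fun τ hτ => (hd τ hτ).continuousAt.continuousWithinAt)
    (fun τ hτ => (hd τ ⟨hτ.1, hτ.2.le⟩).hasDerivWithinAt)
    ?_ (fun τ => ?_) (fun τ hτ e => ?_) (right_mem_Icc.2 hst.le)
  · rw [show (C + 2) * (t - s) = (C + 1) * (t - s) + (t - s) by ring]; exact key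
  · simp only [sub_self, mul_zero, sq, I]
    simp
    positivity
  · have h1 : HasDerivAt (fun τ : ℝ => (C + 1) * (τ - s) + (t - s)) (C + 1) τ := by
      simpa using (((hasDerivAt_id τ).sub_const s).const_mul (C + 1)).add_const (t - s)
    refine (h1.pow 2).congr_deriv ?_
    ring
  · set y := (C + 1) * (τ - s) + (t - s) with hy
    have hy0 : 0 < y := by
      have : 0 ≤ (C + 1) * (τ - s) := mul_nonneg (by linarith) (by linarith [hτ.1])
      linarith
    have sg := (sf τ).sub (sf s)
    have c1 := cs (sg.mul' χ) ((sft τ).mul' χ)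
    have e1 : χ * χ * ((f τ - f s) * ft τ) = (χ * (f τ - f s)) * (χ * ft τ) := by ring
    rw [e1]
    have c2 : sq (χ * ft τ) ≤ C ^ 2 := ((chi_w n).sq_le (sft τ)).trans
      (hC τ ⟨by linarith [hτ.1], by linarith [hτ.2]⟩)
    have c3 : I ((χ * (f τ - f s)) * (χ * ft τ)) ^ 2 ≤ (y * C) ^ 2 := by
      refine c1.trans ?_
      rw [e, mul_pow]
      exact mul_le_mul_of_nonneg_left c2 (by positivity)
    have c4 := abs_le_of_sq_le_sq' c3 (by positivity)
    nlinarith [c4.2]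

/-- energy derivative -/
lemma Evo.en (h : Evo T f ft) (sf : ∀ t, Sch (f t)) (hft : LB T ft) {t : ℝ} (ht : t ∈ Ioo 0 T) :
    HasDerivAt (fun s => sq (f s)) (2 * I (f t * ft t)) t := by
  obtain ⟨a, ha, hta⟩ := exists_between ht.1
  obtain ⟨b, htb, hb⟩ := exists_between ht.2
  obtain ⟨K, hK⟩ := hft.S 2 a b ha hb
  have hK0 : 0 ≤ K := (S_nn 2 (ft t)).trans (hK t ⟨hta.le, htb.le⟩)
  set B := √(4 * K) with hB
  have hB2 : B ^ 2 = 4 * K := Real.sq_sqrt (by positivity)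
  have hB0 : 0 ≤ B := Real.sqrt_nonneg _
  have hsup : ∀ s ∈ Icc a b, ∀ x, |(ft s) x| ≤ B := fun s hs x => by
    refine abs_le_of_sq_le_sq ?_ hB0
    have := sup_le_S (hft.s s) x
    rw [hB2]; linarith [hK s hs]
  -- linear part
  have lin : HasDerivAt (fun s => I (f t * f s)) (I (f t * ft t)) t := by
    have key := hasDerivAt_integral_of_dominated_loc_of_deriv_le (μ := (volume : Measure E2))
      (F := fun s x => (f t) x * (f s) x) (x₀ := t) (s := Icc a b)
      (F' := fun s x => (f t) x * (ft s) x)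
      (bound := fun x => |(f t) x| * B) (Icc_mem_nhds hta htb)
      (Eventually.of_forall fun s => (f t * f s).cont.aestronglyMeasurable)
      (((sf t).mul (f t)).integrable) (((sf t).mul (ft t)).integrable).aestronglyMeasurable
      (Eventually.of_forall fun x s hs => by
        rw [norm_mul]; exact mul_le_mul_of_nonneg_left (hsup s hs x) (norm_nonneg _))
      ((sf t).integrable.abs.mul_const B)
      (Eventually.of_forall fun x s hs =>
        (h.hd s ⟨ha.trans_le hs.1, hs.2.trans_lt hb⟩ x).const_mul _)
    exact key.2
  -- quadratic part
  have quad : HasDerivAt (fun s => sq (f s - f t)) 0 t := by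
    have hC : ∀ s ∈ Icc a b, sq (ft s) ≤ (√K) ^ 2 := fun s hs => by
      rw [Real.sq_sqrt hK0]
      exact (sq_le_S (δ := []) (j := 2) (by simp) (ft s)).trans (hK s hs)
    have O : (fun s => sq (f s - f t)) =O[𝓝 t] fun s => ‖s - t‖ ^ 2 := by
      refine Asymptotics.IsBigO.of_bound ((√K + 2) ^ 2) ?_
      filter_upwards [Icc_mem_nhds hta htb] with s hs
      rw [Real.norm_of_nonneg (sq_nn _), norm_pow, norm_norm, Real.norm_eq_abs, sq_abs, ← mul_pow]
      rcases lt_trichotomy s t with hh | hh | hh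
      · have := h.lip sf hft.s ha hb (Real.sqrt_nonneg K) hC hs.1 hh htb.le
        rw [show f s - f t = -(f t - f s) by ring, sq_neg']
        refine this.trans (le_of_eq ?_); ring
      · subst hh; simp [sq, I]
      · exact h.lip sf hft.s ha hb (Real.sqrt_nonneg K) hC hta.le hh hs.2
    have := (O.hasFDerivAt (𝕜 := ℝ) one_lt_two).hasDerivAt
    simpa using this
  have tot := (((lin.const_mul 2).add quad).sub_const (sq (f t)))
  rw [add_zero] at tot
  refine tot.congr_of_eventuallyEq (Eventually.of_forall fun s => ?_)
  simp only [Pi.add_apply]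
  have e : I (f s * f s) = I ((2:ℝ) • (f t * f s) + (f s - f t) * (f s - f t) - f t * f t) := by
    congr 1; rw [two_smul]; ring
  rw [I_sub ((((sf t).mul _).smul _).add (((sf s).sub (sf t)).mul _)) ((sf t).mul _),
    I_add (((sf t).mul _).smul _) (((sf s).sub (sf t)).mul _), I_smul] at e
  exact e

lemma Evo.sq_cont (h : Evo T f ft) (sf : ∀ t, Sch (f t)) (hft : LB T ft) :
    ContinuousOn (fun s => sq (f s)) (Ioo 0 T) :=
  fun _ ht => (h.en sf hft ht).continuousAt.continuousWithinAt

end HM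
end
end

section
open MeasureTheory Set Filter Topology
open scoped ENNReal ContDiff
set_option linter.unusedSimpArgs false

noncomputable section
namespace HM

namespace Cfg
variable (c : Cfg)

def NN (k : ℕ) : ℝ := N k c.u1 + N k c.u2 + N k c.u3 + N k c.b1 + N k c.b2 + N k c.b3

lemma NN_nn (k : ℕ) : 0 ≤ c.NN k := by
  unfold NN
  have := N_nn k c.u1; have := N_nn k c.u2; have := N_nn k c.u3
  have := N_nn k c.b1; have := N_nn k c.b2; have := N_nn k c.b3
  positivity

lemma Q_succ (k : ℕ) : c.Q (k + 1) = c.Q k + c.NN (k + 1) := by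
  unfold Q NN S
  simp only [Finset.sum_range_succ _ (k + 1)]; ring

lemma Q_zero : c.Q 0 = c.NN 0 := by
  unfold Q NN S; simp

lemma N_om (n : ℕ) : N n c.om = N (n + 1) c.u1 + N (n + 1) c.u2 := by
  rw [N_succ', N_succ', ← Finset.sum_add_distrib]
  unfold N
  refine Finset.sum_congr rfl fun δ _ => ?_
  have z : D δ (0 : A) = 0 := by
    have := D_smul δ 0 (0:A)
    simpa using this
  have z2 : P 0 (D δ c.u1) + P 1 (D δ c.u2) = 0 := by
    rw [← D_P, ← D_P, ← D_add, c.du, z]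
  rw [divom (c.su1.D δ) (c.su2.D δ) z2]
  unfold om
  rw [D_sub, D_P, D_P]

/-- weighted energy -/
def En (χ : A) (n : ℕ) : ℝ := ∑ δ ∈ W n, sq (χ * D δ c.om) + ∑ δ ∈ W (n + 1),
  (sq (χ * D δ c.u3) + (sq (χ * D δ c.b1) + sq (χ * D δ c.b2) + sq (χ * D δ c.b3)))

lemma NN_eq (n : ℕ) : c.NN (n + 1) = ∑ δ ∈ W n, sq (D δ c.om) + ∑ δ ∈ W (n + 1),
    (sq (D δ c.u3) + (sq (D δ c.b1) + sq (D δ c.b2) + sq (D δ c.b3))) := by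
  have := c.N_om n
  simp only [Finset.sum_add_distrib]
  unfold NN
  rw [← this]; unfold N; ring

lemma NN_eq2 (n : ℕ) : c.NN (n + 2) = ∑ δ ∈ W n, gr (D δ c.om) + ∑ δ ∈ W (n + 1),
    (gr (D δ c.u3) + (gr (D δ c.b1) + gr (D δ c.b2) + gr (D δ c.b3))) := by
  have := c.N_om (n + 1)
  simp only [Finset.sum_add_distrib, ← N_succ']
  unfold NN
  rw [this]; ring

lemma En_nn (χ : A) (n : ℕ) : 0 ≤ c.En χ n := by
  unfold En
  refine add_nonneg (Finset.sum_nonneg fun _ _ => sq_nn _) (Finset.sum_nonneg fun δ _ => ?_)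
  have := sq_nn (χ * D δ c.u3); have := sq_nn (χ * D δ c.b1)
  have := sq_nn (χ * D δ c.b2); have := sq_nn (χ * D δ c.b3)
  positivity

lemma En_one (n : ℕ) : c.En 1 n = c.NN (n + 1) := by
  rw [NN_eq]; unfold En; simp only [one_mul]

lemma X_one (n : ℕ) : c.X 1 n = c.NN (n + 2) := by
  rw [NN_eq2]; unfold X; simp only [grw_one]

lemma En_le {χ : A} (hχ : Wgt χ) (n : ℕ) : c.En χ n ≤ c.NN (n + 1) := by
  rw [NN_eq]; unfold En
  have h := fun {f : A} (hf : Sch f) (δ : List (Fin 2)) => hχ.sq_le (hf.D δ)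
  refine add_le_add (Finset.sum_le_sum fun δ _ => h c.som δ) (Finset.sum_le_sum fun δ _ => ?_)
  exact add_le_add (h c.su3 δ) (add_le_add (add_le_add (h c.sb1 δ) (h c.sb2 δ)) (h c.sb3 δ))

lemma En_lim (n : ℕ) : Tendsto (fun k => c.En (chi k) n) atTop (𝓝 (c.NN (n + 1))) := by
  rw [NN_eq]; unfold En
  have h := fun {f : A} (hf : Sch f) (δ : List (Fin 2)) => chi_sq (hf.D δ)
  refine (tendsto_finsetSum _ fun δ _ => h c.som δ).add (tendsto_finsetSum _ fun δ _ => ?_)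
  exact (h c.su3 δ).add (((h c.sb1 δ).add (h c.sb2 δ)).add (h c.sb3 δ))

lemma X_lim (n : ℕ) : Tendsto (fun k => c.X (chi k) n) atTop (𝓝 (c.NN (n + 2))) := by
  rw [NN_eq2]; unfold X
  have h : ∀ {f : A} (_ : Sch f) (δ : List (Fin 2)),
    Tendsto (fun k => grw (chi k) (D δ f)) atTop (𝓝 (gr (D δ f))) := fun hf δ =>
      (chi_sq ((hf.D δ).P 0)).add (chi_sq ((hf.D δ).P 1))
  refine (tendsto_finsetSum _ fun δ _ => h c.som δ).add (tendsto_finsetSum _ fun δ _ => ?_)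
  exact (h c.su3 δ).add (((h c.sb1 δ).add (h c.sb2 δ)).add (h c.sb3 δ))

lemma sF1 : Sch c.F1 := ((c.sb1.mul _).add (c.sb2.mul _)).sub ((c.su1.mul _).add (c.su2.mul _))
lemma sF2 : Sch c.F2 := ((c.sb1.mul _).add (c.sb2.mul _)).sub ((c.su1.mul _).add (c.su2.mul _))
lemma sG1 : Sch c.G1 := ((c.su2.mul _).sub (c.su3.mul _)).sub ((c.sb3.mul' _).sub (c.sb2.mul' _))
lemma sG2 : Sch c.G2 := ((c.su3.mul _).sub (c.su1.mul _)).sub ((c.sb1.mul' _).sub (c.sb3.mul' _))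
lemma sG3 : Sch c.G3 := ((c.su1.mul _).sub (c.su2.mul _)).sub ((c.sb2.mul' _).sub (c.sb1.mul' _))
lemma somt : Sch c.omt := (c.som.L.add (c.sF2.P 0)).sub (c.sF1.P 1)
lemma su3t : Sch c.u3t := (c.su3.L.add (((c.sb1.mul _).sub (c.su1.mul _)).P 0)).add
  (((c.sb2.mul _).sub (c.su2.mul _)).P 1)
lemma sb1t : Sch c.b1t := c.sb1.L.add (c.sG3.P 1)
lemma sb2t : Sch c.b2t := c.sb2.L.sub (c.sG3.P 0)
lemma sb3t : Sch c.b3t := (c.sb3.L.add (c.sG2.P 0)).sub (c.sG1.P 1)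

end Cfg

structure Sol (T : ℝ) where
  c : ℝ → Cfg
  q : ℝ → A
  hq : ∀ t, Sch (q t)
  eu1 : Evo T (fun t => (c t).u1) (fun t => L (c t).u1 + (c t).F1 - P 0 (q t))
  eu2 : Evo T (fun t => (c t).u2) (fun t => L (c t).u2 + (c t).F2 - P 1 (q t))
  eu3 : Evo T (fun t => (c t).u3) (fun t => (c t).u3t)
  eb1 : Evo T (fun t => (c t).b1) (fun t => (c t).b1t)
  eb2 : Evo T (fun t => (c t).b2) (fun t => (c t).b2t)
  eb3 : Evo T (fun t => (c t).b3) (fun t => (c t).b3t)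
  base : LBd T (fun t => (c t).Q 3)

namespace Sol
variable {T : ℝ} (s : Sol T)

lemma eom : Evo T (fun t => (s.c t).om) (fun t => (s.c t).omt) := by
  refine ((s.eu2.P 0).sub (s.eu1.P 1)).congr (fun t _ => rfl) (fun t _ => ?_)
  unfold Cfg.omt Cfg.om
  simp only [map_add, map_sub, L, P_L, P10]; ring

lemma en_deriv {χ : A} (hc : HasCompactSupport χ) (n : ℕ) {t : ℝ} (ht : t ∈ Ioo 0 T) :
    HasDerivAt (fun t => (s.c t).En χ n) (2 * (s.c t).Yt χ n) t := by
  have h := fun {f ft : ℝ → A} (h : Evo T f ft) (δ : List (Fin 2)) => (h.D δ).en_chi hc ht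
  unfold Cfg.En Cfg.Yt
  simp only [sq_chi]
  have e := (HasDerivAt.fun_sum fun δ (_ : δ ∈ W n) => h s.eom δ).add
    (HasDerivAt.fun_sum fun δ (_ : δ ∈ W (n + 1)) => (h s.eu3 δ).add (((h s.eb1 δ).add (h s.eb2 δ)).add (h s.eb3 δ)))
  refine e.congr_deriv ?_
  rw [mul_add, Finset.mul_sum, Finset.mul_sum]
  congr 1
  refine Finset.sum_congr rfl fun δ _ => ?_
  have c := s.c t
  rw [mul_add (χ * χ), mul_add (χ * χ), I_add, I_add]
  · ring
  · exact (((s.c t).sb1.D δ).mul _).mul' _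
  · exact (((s.c t).sb2.D δ).mul _).mul' _
  · exact ((((s.c t).sb1.D δ).mul _).mul' _).add ((((s.c t).sb2.D δ).mul _).mul' _)
  · exact (((s.c t).sb3.D δ).mul _).mul' _

lemma X_cont {χ : A} (hc : HasCompactSupport χ) (n : ℕ) :
    ContinuousOn (fun t => (s.c t).X χ n) (Ioo 0 T) := by
  have h : ∀ {f ft : ℝ → A} (_ : Evo T f ft) (δ : List (Fin 2)),
      ContinuousOn (fun t => grw χ (D δ (f t))) (Ioo 0 T) := by
    intro f ft h δ
    have h1 : ∀ i, ContinuousOn (fun t => sq (χ * P i (D δ (f t)))) (Ioo 0 T) := by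
      intro i t ht
      simp only [sq_chi]
      exact (((h.D δ).P i).en_chi hc ht).continuousAt.continuousWithinAt
    exact (h1 0).add (h1 1)
  unfold Cfg.X
  refine (continuousOn_finsetSum _ fun δ _ => h s.eom δ).add (continuousOn_finsetSum _ fun δ _ => ?_)
  exact (h s.eu3 δ).add (((h s.eb1 δ).add (h s.eb2 δ)).add (h s.eb3 δ))

lemma NN_int (n : ℕ) {a b : ℝ} (ha : 0 < a) (hab : a ≤ b) (hb : b < T) {K : ℝ}
    (hK : ∀ t ∈ Icc a b, (s.c t).R n ≤ K) : IntegrableOn (fun t => (s.c t).NN (n + 2)) (Icc a b) := by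
  obtain ⟨C, hC0, hC⟩ := Cfg.level n
  have sub : Icc a b ⊆ Ioo 0 T := fun t ht => ⟨ha.trans_le ht.1, ht.2.trans_lt hb⟩
  have Xint : ∀ k, IntegrableOn (fun t => (s.c t).X (chi k) n) (Icc a b) := fun k =>
    ((s.X_cont (chi_c k) n).mono sub).integrableOn_Icc
  set M := 4 * ((s.c a).NN (n + 1) + 2 * C * K * (b - a)) with hM
  have bd : ∀ k, ∫ t in Icc a b, (s.c t).X (chi k) n ≤ M := by
    intro k
    have cint : IntegrableOn (fun _ : ℝ => 2 * C * K) (Icc a b) := integrableOn_const (by simp)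
    have key := intervalIntegral.sub_le_integral_of_hasDeriv_right_of_le hab
      (g := fun t => (s.c t).En (chi k) n) (g' := fun t => 2 * (s.c t).Yt (chi k) n)
      (φ := fun t => 2 * C * K - (1/4) * (s.c t).X (chi k) n)
      (fun t ht => (s.en_deriv (chi_c k) n (sub ht)).continuousAt.continuousWithinAt)
      (fun t ht => (s.en_deriv (chi_c k) n (sub (Ioo_subset_Icc_self ht))).hasDerivWithinAt)
      (cint.sub ((Xint k).const_mul _))
      (fun t ht => by
        have h1 := hC (s.c t) (chi k) (chi_w k)
        have h2 := mul_le_mul_of_nonneg_left (hK t (Ioo_subset_Icc_self ht)) hC0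
        nlinarith)
    rw [intervalIntegral.integral_of_le hab, ← integral_Icc_eq_integral_Ioc, integral_sub cint ((Xint k).const_mul _),
      integral_const_mul, setIntegral_const] at key
    simp only [Real.volume_real_Icc_of_le hab, smul_eq_mul] at key
    rw [integral_const_mul] at key
    have h1 := (s.c b).En_nn (chi k) n
    have h2 := (s.c a).En_le (chi_w k) n
    rw [hM]; linarith
  refine integrable_of_tendsto (G := fun k t => (s.c t).X (chi k) n)
    (Eventually.of_forall fun t => (s.c t).X_lim n) (fun k => (Xint k).aestronglyMeasurable) ?_
  refine ne_top_of_le_ne_top (b := ENNReal.ofReal M) ENNReal.ofReal_ne_top ?_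
  refine liminf_le_of_le (by isBoundedDefault) fun d hd => ?_
  obtain ⟨k, hk⟩ := hd.exists
  refine hk.trans ?_
  rw [← ofReal_integral_norm_eq_lintegral_enorm (Xint k)]
  refine ENNReal.ofReal_le_ofReal (le_trans (le_of_eq ?_) (bd k))
  refine integral_congr_ae (Eventually.of_forall fun t => ?_)
  exact Real.norm_of_nonneg ((s.c t).X_nn _ _)

lemma boot (n : ℕ) (hn : 2 ≤ n) (h : LBd T (fun t => (s.c t).Q (n + 1))) :
    LBd T (fun t => (s.c t).Q (n + 2)) := by
  intro a b ha hb
  rcases lt_or_ge b a with hab | hab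
  · exact ⟨0, fun t ht => absurd (ht.1.trans ht.2) (not_le.2 hab)⟩
  obtain ⟨K, hK⟩ := h (a/2) b (by positivity) hb
  have ha2 : 0 < a / 2 := by positivity
  have hab2 : a / 2 ≤ b := by linarith
  have sub : Icc (a/2) b ⊆ Ioo 0 T := fun t ht => ⟨ha2.trans_le ht.1, ht.2.trans_lt hb⟩
  have hK0 : 0 ≤ K := ((s.c b).Q_nn _).trans (hK b ⟨hab2, le_rfl⟩)
  have q : ∀ t ∈ Icc (a/2) b, ∀ j ≤ n + 1, (s.c t).Q j ≤ K := fun t ht j hj =>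
    ((s.c t).Q_mono hj).trans (hK t ht)
  have R : ∀ t ∈ Icc (a/2) b, ∀ j ≤ n + 1, (s.c t).R j ≤ (1 + K * K + K + K) * (s.c t).Q (j + 1) := by
    intro t ht j hj
    unfold Cfg.R
    refine mul_le_mul_of_nonneg_right ?_ ((s.c t).Q_nn _)
    have h1 := q t ht 1 (by omega)
    have h2 := q t ht 2 (by omega)
    have h3 := q t ht j hj
    have h4 := mul_le_mul h1 h2 ((s.c t).Q_nn _) hK0
    linarith
  set K1 := 1 + K * K + K + K with hK1
  have hK10 : 0 ≤ K1 := by positivity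
  have int := s.NN_int n ha2 hab2 hb (K := K1 * K) (fun t ht => (R t ht n (by omega)).trans
    (mul_le_mul_of_nonneg_left (q t ht _ le_rfl) hK10))
  obtain ⟨C, hC0, hC⟩ := Cfg.level (n + 1)
  set J := ∫ t in Icc (a/2) b, 2 * (C * (K1 * (K + (s.c t).NN (n + 2)))) with hJ
  have cint : IntegrableOn (fun _ : ℝ => K) (Icc (a/2) b) := integrableOn_const (by simp)
  have Jint : IntegrableOn (fun t => 2 * (C * (K1 * (K + (s.c t).NN (n + 2))))) (Icc (a/2) b) :=
    (((cint.add int).const_mul K1).const_mul C).const_mul 2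
  have Jnn : ∀ t, 0 ≤ 2 * (C * (K1 * (K + (s.c t).NN (n + 2)))) := fun t => by
    have := (s.c t).NN_nn (n + 2); positivity
  refine ⟨K + ((s.c (a/2)).NN (n + 2) + J), fun t ht => ?_⟩
  have ht' : t ∈ Icc (a/2) b := ⟨by linarith [ht.1], ht.2⟩
  simp only
  rw [Cfg.Q_succ]
  refine add_le_add (hK t ht') ?_
  refine le_of_tendsto ((s.c t).En_lim (n + 1)) (Eventually.of_forall fun k => ?_)
  have sub2 : Icc (a/2) t ⊆ Icc (a/2) b := Icc_subset_Icc_right ht.2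
  have key := intervalIntegral.sub_le_integral_of_hasDeriv_right_of_le ht'.1
      (g := fun t => (s.c t).En (chi k) (n + 1)) (g' := fun t => 2 * (s.c t).Yt (chi k) (n + 1))
      (φ := fun t => 2 * (C * (K1 * (K + (s.c t).NN (n + 2)))))
      (fun t ht => (s.en_deriv (chi_c k) _ (sub (sub2 ht))).continuousAt.continuousWithinAt)
      (fun t ht => (s.en_deriv (chi_c k) _ (sub (sub2 (Ioo_subset_Icc_self ht)))).hasDerivWithinAt)
      (Jint.mono_set sub2)
      (fun t ht => by
        have ht := sub2 (Ioo_subset_Icc_self ht)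
        have h1 := hC (s.c t) (chi k) (chi_w k)
        have h2 := mul_le_mul_of_nonneg_left (R t ht (n + 1) le_rfl) hC0
        rw [Cfg.Q_succ] at h2
        have h3 : C * (K1 * ((s.c t).Q (n + 1) + (s.c t).NN (n + 1 + 1))) ≤
          C * (K1 * (K + (s.c t).NN (n + 2))) :=
          mul_le_mul_of_nonneg_left (mul_le_mul_of_nonneg_left (add_le_add (hK t ht) le_rfl) hK10) hC0
        have := (s.c t).X_nn (chi k) (n + 1)
        linarith)
  have h2 := (s.c (a/2)).En_le (chi_w k) (n + 1)
  have h3 : ∫ y in (a/2)..t, 2 * (C * (K1 * (K + (s.c y).NN (n + 2)))) ≤ J := by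
    rw [intervalIntegral.integral_of_le ht'.1, ← integral_Icc_eq_integral_Ioc]
    exact setIntegral_mono_set Jint (Eventually.of_forall Jnn) (Eventually.of_forall sub2)
  linarith

lemma Q_lbd (k : ℕ) : LBd T (fun t => (s.c t).Q k) := by
  have : ∀ k, LBd T (fun t => (s.c t).Q (k + 3)) := by
    intro k
    induction k with
    | zero => exact s.base
    | succ k ih => exact s.boot (k + 2) (by omega) ih
  exact (this k).mono fun t _ => (s.c t).Q_mono (by omega)

end Sol
end HM
end
end

section
open MeasureTheory Set Filter Topology
open scoped ENNReal ContDiff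
set_option linter.unusedSimpArgs false

noncomputable section
namespace HM

lemma leray {a1 a2 q : A} (h1 : Sch a1) (h2 : Sch a2) (hq : Sch q)
    (h : P 0 (a1 - P 0 q) + P 1 (a2 - P 1 q) = 0) :
    sq (a1 - P 0 q) + sq (a2 - P 1 q) ≤ sq a1 + sq a2 := by
  set v1 := a1 - P 0 q with e1
  set v2 := a2 - P 1 q with e2
  have s1 : Sch v1 := h1.sub (hq.P 0)
  have s2 : Sch v2 := h2.sub (hq.P 1)
  have f1 : a1 = v1 + P 0 q := by rw [e1]; ring
  have f2 : a2 = v2 + P 1 q := by rw [e2]; ring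
  have ex : ∀ {v w : A}, Sch v → Sch w → sq (v + w) = sq v + sq w + 2 * I (v * w) := by
    intro v w hv hw
    have : (v + w) * (v + w) = v * v + w * w + (v * w + v * w) := by ring
    unfold sq
    rw [this, I_add ((hv.mul _).add (hw.mul _)) ((hv.mul _).add (hv.mul _)), I_add (hv.mul _) (hw.mul _),
      I_add (hv.mul _) (hv.mul _)]; ring
  have z : I (v1 * P 0 q) + I (v2 * P 1 q) = 0 := by
    rw [← I_add (s1.mul _) (s2.mul _), ibp (e₂ := 0) (s1.mul q) (s2.mul q)]
    · simp [I]
    · simp only [P_mul]; linear_combination (-q) * h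
  rw [f1, f2, ex s1 (hq.P 0), ex s2 (hq.P 1)]
  have := sq_nn (P 0 q); have := sq_nn (P 1 q)
  linarith

namespace Sol
variable {T : ℝ} (s : Sol T)

lemma lb_of {f : ℝ → A} (sf : ∀ t, Sch (f t)) (h : ∀ t k, S k (f t) ≤ (s.c t).Q k) : LB T f :=
  LB.of_S sf fun k => (s.Q_lbd k).mono fun t _ => h t k

lemma bu1 : LB T (fun t => (s.c t).u1) := s.lb_of (fun t => (s.c t).su1) fun t k => (s.c t).is_all.1.2 k
lemma bu2 : LB T (fun t => (s.c t).u2) := s.lb_of (fun t => (s.c t).su2) fun t k => (s.c t).is_all.2.1.2 k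
lemma bu3 : LB T (fun t => (s.c t).u3) := s.lb_of (fun t => (s.c t).su3) fun t k => (s.c t).is_all.2.2.1.2 k
lemma bb1 : LB T (fun t => (s.c t).b1) := s.lb_of (fun t => (s.c t).sb1) fun t k => (s.c t).is_all.2.2.2.1.2 k
lemma bb2 : LB T (fun t => (s.c t).b2) := s.lb_of (fun t => (s.c t).sb2) fun t k => (s.c t).is_all.2.2.2.2.1.2 k
lemma bb3 : LB T (fun t => (s.c t).b3) := s.lb_of (fun t => (s.c t).sb3) fun t k => (s.c t).is_all.2.2.2.2.2.2 k

lemma bF1 : LB T (fun t => (s.c t).F1) :=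
  ((s.bb1.mul (s.bb1.P 0)).add (s.bb2.mul (s.bb1.P 1))).sub ((s.bu1.mul (s.bu1.P 0)).add (s.bu2.mul (s.bu1.P 1)))
lemma bF2 : LB T (fun t => (s.c t).F2) :=
  ((s.bb1.mul (s.bb2.P 0)).add (s.bb2.mul (s.bb2.P 1))).sub ((s.bu1.mul (s.bu2.P 0)).add (s.bu2.mul (s.bu2.P 1)))
lemma bom : LB T (fun t => (s.c t).om) := (s.bu2.P 0).sub (s.bu1.P 1)
lemma bomt : LB T (fun t => (s.c t).omt) := (s.bom.L.add (s.bF2.P 0)).sub (s.bF1.P 1)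
lemma bu3t : LB T (fun t => (s.c t).u3t) :=
  (s.bu3.L.add (((s.bb1.mul s.bb3).sub (s.bu1.mul s.bu3)).P 0)).add (((s.bb2.mul s.bb3).sub (s.bu2.mul s.bu3)).P 1)
lemma bj1 : LB T (fun t => (s.c t).j1) := s.bb3.P 1
lemma bj2 : LB T (fun t => (s.c t).j2) := (s.bb3.P 0).neg
lemma bj3 : LB T (fun t => (s.c t).j3) := (s.bb2.P 0).sub (s.bb1.P 1)
lemma bG1 : LB T (fun t => (s.c t).G1) :=
  ((s.bu2.mul s.bb3).sub (s.bu3.mul s.bb2)).sub ((s.bj2.mul s.bb3).sub (s.bj3.mul s.bb2))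
lemma bG2 : LB T (fun t => (s.c t).G2) :=
  ((s.bu3.mul s.bb1).sub (s.bu1.mul s.bb3)).sub ((s.bj3.mul s.bb1).sub (s.bj1.mul s.bb3))
lemma bG3 : LB T (fun t => (s.c t).G3) :=
  ((s.bu1.mul s.bb2).sub (s.bu2.mul s.bb1)).sub ((s.bj1.mul s.bb2).sub (s.bj2.mul s.bb1))
lemma bb1t : LB T (fun t => (s.c t).b1t) := s.bb1.L.add (s.bG3.P 1)
lemma bb2t : LB T (fun t => (s.c t).b2t) := s.bb2.L.sub (s.bG3.P 0)
lemma bb3t : LB T (fun t => (s.c t).b3t) := (s.bb3.L.add (s.bG2.P 0)).sub (s.bG1.P 1)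
lemma bz1 : LB T (fun t => (s.c t).z1) := s.bb1.add (s.bu3.P 1)
lemma bz2 : LB T (fun t => (s.c t).z2) := s.bb2.sub (s.bu3.P 0)
lemma bz1t : LB T (fun t => (s.c t).z1t) := s.bb1t.add (s.bu3t.P 1)
lemma bz2t : LB T (fun t => (s.c t).z2t) := s.bb2t.sub (s.bu3t.P 0)
lemma ez1 : Evo T (fun t => (s.c t).z1) (fun t => (s.c t).z1t) := s.eb1.add (s.eu3.P 1)
lemma ez2 : Evo T (fun t => (s.c t).z2) (fun t => (s.c t).z2t) := s.eb2.sub (s.eu3.P 0)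

lemma but : LB T (fun t => L (s.c t).u1 + (s.c t).F1 - P 0 (s.q t)) ∧
    LB T (fun t => L (s.c t).u2 + (s.c t).F2 - P 1 (s.q t)) := by
  have a1 := s.bu1.L.add s.bF1
  have a2 := s.bu2.L.add s.bF2
  have d : ∀ t ∈ Ioo 0 T, P 0 (L (s.c t).u1 + (s.c t).F1 - P 0 (s.q t)) +
      P 1 (L (s.c t).u2 + (s.c t).F2 - P 1 (s.q t)) = 0 := by
    intro t ht
    refine A.ext fun x => ?_
    have h := ((s.eu1.P 0).add (s.eu2.P 1)).hd t ht x
    simp only [(s.c _).du] at h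
    exact h.unique (hasDerivAt_const _ _)
  have key : ∀ δ, LBd T (fun t => sq (D δ (L (s.c t).u1 + (s.c t).F1 - P 0 (s.q t))) +
      sq (D δ (L (s.c t).u2 + (s.c t).F2 - P 1 (s.q t)))) := by
    intro δ
    refine ((a1.b δ).add (a2.b δ)).mono fun t ht => ?_
    have := d t ht
    rw [D_sub, D_sub, D_P, D_P]
    refine leray ((a1.s t).D δ) ((a2.s t).D δ) ((s.hq t).D δ) ?_
    rw [← D_P, ← D_P, ← D_sub, ← D_sub, ← D_P, ← D_P, ← D_add, this]
    have := D_smul δ 0 (0:A)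
    simpa using this
  exact ⟨⟨fun t => (a1.s t).sub ((s.hq t).P 0), fun δ => (key δ).mono fun t _ => le_add_of_nonneg_right (sq_nn _)⟩,
    ⟨fun t => (a2.s t).sub ((s.hq t).P 1), fun δ => (key δ).mono fun t _ => le_add_of_nonneg_left (sq_nn _)⟩⟩

/-- full energy derivative -/
lemma NN_deriv (n : ℕ) {t : ℝ} (ht : t ∈ Ioo 0 T) :
    HasDerivAt (fun t => (s.c t).NN (n + 1)) (2 * (s.c t).Yt 1 n) t := by
  have h := fun {f ft : ℝ → A} (h : Evo T f ft) (sf : ∀ t, Sch (f t)) (hb : LB T ft) (δ : List (Fin 2)) =>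
    (h.D δ).en (fun t => (sf t).D δ) (hb.D δ) ht
  unfold Cfg.Yt
  simp only [Cfg.NN_eq]
  have e := (HasDerivAt.fun_sum fun δ (_ : δ ∈ W n) => h s.eom s.bom.s s.bomt δ).add
    (HasDerivAt.fun_sum fun δ (_ : δ ∈ W (n + 1)) => (h s.eu3 s.bu3.s s.bu3t δ).add
      (((h s.eb1 s.bb1.s s.bb1t δ).add (h s.eb2 s.bb2.s s.bb2t δ)).add (h s.eb3 s.bb3.s s.bb3t δ)))
  refine e.congr_deriv ?_
  rw [mul_add, Finset.mul_sum, Finset.mul_sum]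
  simp only [one_mul]
  congr 1
  refine Finset.sum_congr rfl fun δ _ => ?_
  rw [I_add, I_add]
  · ring
  · exact (((s.c t).sb1.D δ).mul _)
  · exact (((s.c t).sb2.D δ).mul _)
  · exact ((((s.c t).sb1.D δ).mul _)).add ((((s.c t).sb2.D δ).mul _))
  · exact (((s.c t).sb3.D δ).mul _)

end Sol
end HM
end
end

section
open MeasureTheory Set Filter Topology
open scoped ENNReal ContDiff
set_option linter.unusedSimpArgs false

noncomputable section
namespace HM

/-- bounded on `[T/2,T)` -/
def IB (T : ℝ) (g : ℝ → ℝ) : Prop := ∃ C : ℝ, ∀ t ∈ Ico (T/2) T, g t ≤ C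
/-- dominated by an integrable function on `[T/2,T)` -/
def IL (T : ℝ) (g : ℝ → ℝ) : Prop := ∃ h : ℝ → ℝ, IntegrableOn h (Ico (T/2) T) ∧ ∀ t ∈ Ico (T/2) T, g t ≤ h t

variable {T : ℝ} {f g : ℝ → ℝ}

lemma IB.mono (hg : IB T g) (h : ∀ t ∈ Ico (T/2) T, f t ≤ g t) : IB T f :=
  hg.imp fun _ hC t ht => (h t ht).trans (hC t ht)
lemma IL.mono (hg : IL T g) (h : ∀ t ∈ Ico (T/2) T, f t ≤ g t) : IL T f :=
  hg.imp fun _ hC => ⟨hC.1, fun t ht => (h t ht).trans (hC.2 t ht)⟩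
lemma IB.const (c : ℝ) : IB T fun _ => c := ⟨c, fun _ _ => le_rfl⟩
lemma IB.add (hf : IB T f) (hg : IB T g) : IB T fun t => f t + g t := by
  obtain ⟨C, hC⟩ := hf; obtain ⟨D, hD⟩ := hg
  exact ⟨C + D, fun t ht => add_le_add (hC t ht) (hD t ht)⟩
lemma IL.add (hf : IL T f) (hg : IL T g) : IL T fun t => f t + g t := by
  obtain ⟨C, iC, hC⟩ := hf; obtain ⟨D, iD, hD⟩ := hg
  exact ⟨fun t => C t + D t, iC.add iD, fun t ht => add_le_add (hC t ht) (hD t ht)⟩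
lemma IB.il (hf : IB T f) : IL T f := by
  obtain ⟨C, hC⟩ := hf
  exact ⟨fun _ => C, integrableOn_const (by simp), hC⟩
lemma IL.cmul (hf : IL T f) {c : ℝ} (hc : 0 ≤ c) : IL T fun t => c * f t := by
  obtain ⟨C, iC, hC⟩ := hf
  exact ⟨fun t => c * C t, iC.const_mul c, fun t ht => mul_le_mul_of_nonneg_left (hC t ht) hc⟩
lemma IB.cmul (hf : IB T f) {c : ℝ} (hc : 0 ≤ c) : IB T fun t => c * f t := by
  obtain ⟨C, hC⟩ := hf
  exact ⟨c * C, fun t ht => mul_le_mul_of_nonneg_left (hC t ht) hc⟩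
/-- bounded times integrable -/
lemma IB.mul (hf : IB T f) (hg : IL T g) (g0 : ∀ t, 0 ≤ g t) :
    IL T fun t => f t * g t := by
  obtain ⟨C, hC⟩ := hf
  refine (hg.cmul (abs_nonneg C)).mono fun t ht => ?_
  exact mul_le_mul_of_nonneg_right ((hC t ht).trans (le_abs_self C)) (g0 t)
lemma IB.mulB (hf : IB T f) (hg : IB T g) (g0 : ∀ t, 0 ≤ g t) :
    IB T fun t => f t * g t := by
  obtain ⟨C, hC⟩ := hf
  refine (hg.cmul (abs_nonneg C)).mono fun t ht => ?_
  exact mul_le_mul_of_nonneg_right ((hC t ht).trans (le_abs_self C)) (g0 t)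

lemma gronwall (hT : 0 < T) {y yt d a : ℝ → ℝ} (hy : ∀ t ∈ Ioo 0 T, HasDerivAt y (yt t) t)
    (y0 : ∀ t, 0 ≤ y t) (d0 : ∀ t, 0 ≤ d t) (dc : ContinuousOn d (Ioo 0 T)) (ha : IL T a)
    (key : ∀ t ∈ Ico (T/2) T, yt t + d t ≤ a t * (1 + y t)) : IB T y ∧ IL T d := by
  obtain ⟨h, hi, hh⟩ := ha
  have hT2 : 0 < T / 2 := by positivity
  have sub : Ico (T/2) T ⊆ Ioo 0 T := fun t ht => ⟨hT2.trans_le ht.1, ht.2⟩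
  have hi' : IntegrableOn (fun t => |h t|) (Ico (T/2) T) := hi.abs
  have key2 : ∀ t ∈ Ico (T/2) T, yt t + d t ≤ |h t| * (1 + y t) := fun t ht =>
    (key t ht).trans (mul_le_mul_of_nonneg_right ((hh t ht).trans (le_abs_self _)) (by linarith [y0 t]))
  set J := ∫ t in Ico (T/2) T, |h t| with hJ
  have sub2 : ∀ {t}, t ∈ Ico (T/2) T → Icc (T/2) t ⊆ Ico (T/2) T := fun ht s hs => ⟨hs.1, hs.2.trans_lt ht.2⟩
  have hJt : ∀ t ∈ Ico (T/2) T, ∫ s in (T/2)..t, |h s| ≤ J := fun t ht => by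
    rw [intervalIntegral.integral_of_le ht.1, ← integral_Icc_eq_integral_Ioc]
    exact setIntegral_mono_set hi' (Eventually.of_forall fun _ => abs_nonneg _) (Eventually.of_forall (sub2 ht))
  have pos : ∀ t, 0 < 1 + y t := fun t => by linarith [y0 t]
  set K := (1 + y (T/2)) * Real.exp J with hK
  have B : ∀ t ∈ Ico (T/2) T, 1 + y t ≤ K := by
    intro t ht
    have hd : ∀ s ∈ Icc (T/2) t, HasDerivAt (fun s => Real.log (1 + y s)) (yt s / (1 + y s)) s :=
      fun s hs => ((hy s (sub (sub2 ht hs))).const_add 1).log (pos s).ne'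
    have k := intervalIntegral.sub_le_integral_of_hasDeriv_right_of_le ht.1
      (g := fun s => Real.log (1 + y s)) (g' := fun s => yt s / (1 + y s)) (φ := fun s => |h s|)
      (fun s hs => (hd s hs).continuousAt.continuousWithinAt)
      (fun s hs => (hd s (Ioo_subset_Icc_self hs)).hasDerivWithinAt) (hi'.mono_set (sub2 ht))
      (fun s hs => by
        rw [div_le_iff₀ (pos s)]
        linarith [key2 s (sub2 ht (Ioo_subset_Icc_self hs)), d0 s])
    have k2 : Real.log (1 + y t) ≤ Real.log (1 + y (T/2)) + J := by linarith [hJt t ht]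
    rw [Real.log_le_iff_le_exp (pos t), Real.exp_add, Real.exp_log (pos _)] at k2
    exact k2
  have dint : ∀ t ∈ Ico (T/2) T, IntegrableOn d (Icc (T/2) t) := fun t ht =>
    (dc.mono ((sub2 ht).trans sub)).integrableOn_Icc
  have K0 : 0 ≤ K := (pos _).le.trans (B (T/2) ⟨le_rfl, by linarith⟩)
  have DB : ∀ t ∈ Ico (T/2) T, ∫ s in (T/2)..t, d s ≤ J * K + y (T/2) := by
    intro t ht
    have i1 := (hi'.mono_set (sub2 ht)).mul_const K
    have k := intervalIntegral.sub_le_integral_of_hasDeriv_right_of_le ht.1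
      (g := y) (g' := yt) (φ := fun s => |h s| * K - d s)
      (fun s hs => (hy s (sub (sub2 ht hs))).continuousAt.continuousWithinAt)
      (fun s hs => (hy s (sub (sub2 ht (Ioo_subset_Icc_self hs)))).hasDerivWithinAt)
      (i1.sub (dint t ht))
      (fun s hs => by
        have hs := sub2 ht (Ioo_subset_Icc_self hs)
        have := mul_le_mul_of_nonneg_left (B s hs) (abs_nonneg (h s))
        linarith [key2 s hs])
    rw [intervalIntegral.integral_sub
      ((intervalIntegrable_iff_integrableOn_Icc_of_le ht.1).2 i1)
      ((intervalIntegrable_iff_integrableOn_Icc_of_le ht.1).2 (dint t ht)),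
      intervalIntegral.integral_mul_const] at k
    have := mul_le_mul_of_nonneg_right (hJt t ht) K0
    linarith [y0 t]
  refine ⟨⟨K, fun t ht => by linarith [B t ht]⟩, d, ?_, fun _ _ => le_rfl⟩
  set bs : ℕ → ℝ := fun n => T - (T/2) / ((n:ℝ) + 1) with hbs
  have bm : ∀ n, bs n ∈ Ico (T/2) T := fun n => by
    have h1 : 0 < (T/2) / ((n:ℝ) + 1) := by positivity
    have h2 : (T/2) / ((n:ℝ) + 1) ≤ T / 2 := div_le_self hT2.le (by linarith [n.cast_nonneg (α := ℝ)])
    exact ⟨by simp only [hbs]; linarith, by simp only [hbs]; linarith⟩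
  have bt : Tendsto bs atTop (𝓝 T) := by
    have := (tendsto_one_div_add_atTop_nhds_zero_nat (𝕜 := ℝ)).const_mul (T/2)
    have := this.const_sub T
    simp only [mul_zero, sub_zero] at this
    refine this.congr fun n => ?_
    simp only [hbs]; ring
  have := integrableOn_Ioc_of_intervalIntegral_norm_bounded_right (I := J * K + y (T/2)) (f := d)
    (a := T/2) (fun n => (dint (bs n) (bm n)).mono_set Ioc_subset_Icc_self) bt
    (Eventually.of_forall fun n => by
      simp only [Real.norm_of_nonneg (d0 _)]
      rw [← intervalIntegral.integral_of_le (bm n).1]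
      exact DB _ (bm n))
  exact ((integrableOn_Icc_iff_integrableOn_Ioc (by simp)).2 this).mono_set Ico_subset_Icc_self

end HM
end
end

section
open MeasureTheory Set Filter Topology
open scoped ENNReal ContDiff
set_option linter.unusedSimpArgs false

noncomputable section
namespace HM

lemma Evo.gr_cont {T : ℝ} {f ft : ℝ → A} (h : Evo T f ft) (sf : ∀ t, Sch (f t)) (hft : LB T ft) :
    ContinuousOn (fun s => gr (f s)) (Ioo 0 T) :=
  ((h.P 0).sq_cont (fun t => (sf t).P 0) (hft.P 0)).add ((h.P 1).sq_cont (fun t => (sf t).P 1) (hft.P 1))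

lemma Evo.N_cont {T : ℝ} {f ft : ℝ → A} (h : Evo T f ft) (sf : ∀ t, Sch (f t)) (hft : LB T ft) (k : ℕ) :
    ContinuousOn (fun s => N k (f s)) (Ioo 0 T) :=
  continuousOn_finsetSum _ fun δ _ => (h.D δ).sq_cont (fun t => (sf t).D δ) (hft.D δ)

/-- `A y + B ≤ (A+B)(1+y)` -/
lemma lin_le {A B y : ℝ} (hA : 0 ≤ A) (hB : 0 ≤ B) (hy : 0 ≤ y) : A * y + B ≤ (A + B) * (1 + y) := by
  nlinarith [mul_nonneg hB hy]

lemma S_two (f : A) : S 2 f = sq f + gr f + N 2 f := by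
  unfold S; simp only [Finset.sum_range_succ, Finset.sum_range_zero, N_zero, N_one]; ring

namespace Sol
variable {T : ℝ} (s : Sol T)

/-- bounds from the basic energy law -/
lemma step0 (hT : 0 < T) : IB T (fun t => (s.c t).Q 0) ∧ IL T (fun t => (s.c t).NN 1) := by
  refine gronwall hT (a := fun _ => 0) (yt := fun t => 2 * -(s.c t).NN 1) ?_ (fun t => (s.c t).Q_nn 0)
    (fun t => (s.c t).NN_nn 1) ?_ (IB.const 0).il ?_
  · intro t ht
    have e := (((((s.eu1.en s.bu1.s s.but.1 ht).add (s.eu2.en s.bu2.s s.but.2 ht)).add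
      (s.eu3.en s.bu3.s s.bu3t ht)).add (s.eb1.en s.bb1.s s.bb1t ht)).add (s.eb2.en s.bb2.s s.bb2t ht)).add
      (s.eb3.en s.bb3.s s.bb3t ht)
    simp only [Cfg.Q_zero, Cfg.NN, N_zero, N_one]
    rw [← (s.c t).e0 (s.hq t)]
    refine e.congr_deriv ?_
    ring
  · unfold Cfg.NN
    exact (((((s.eu1.N_cont s.bu1.s s.but.1 _).add (s.eu2.N_cont s.bu2.s s.but.2 _)).add
      (s.eu3.N_cont s.bu3.s s.bu3t _)).add (s.eb1.N_cont s.bb1.s s.bb1t _)).add (s.eb2.N_cont s.bb2.s s.bb2t _)).add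
      (s.eb3.N_cont s.bb3.s s.bb3t _)
  · intro t _
    have := (s.c t).NN_nn 1
    linarith

lemma parts0 (c : Cfg) : c.U0 ≤ c.Q 0 ∧ sq c.u3 ≤ c.Q 0 ∧ sq c.b1 + sq c.b2 ≤ c.Q 0 ∧ sq c.b3 ≤ c.Q 0 := by
  rw [Cfg.Q_zero]; unfold Cfg.NN Cfg.U0
  simp only [N_zero]
  have := sq_nn c.u1; have := sq_nn c.u2; have := sq_nn c.u3
  have := sq_nn c.b1; have := sq_nn c.b2; have := sq_nn c.b3
  refine ⟨?_, ?_, ?_, ?_⟩ <;> linarith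

lemma parts1 (c : Cfg) : c.G0 ≤ c.NN 1 ∧ gr c.u3 ≤ c.NN 1 ∧ gr c.b1 + gr c.b2 ≤ c.NN 1 ∧ gr c.b3 ≤ c.NN 1 := by
  unfold Cfg.NN Cfg.G0
  simp only [N_one]
  have := gr_nn c.u1; have := gr_nn c.u2; have := gr_nn c.u3
  have := gr_nn c.b1; have := gr_nn c.b2; have := gr_nn c.b3
  refine ⟨?_, ?_, ?_, ?_⟩ <;> linarith

lemma iU0 (hT : 0 < T) : IB T (fun t => (s.c t).U0) := (s.step0 hT).1.mono fun t _ => (parts0 _).1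
lemma isb (hT : 0 < T) : IB T (fun t => sq (s.c t).b1 + sq (s.c t).b2) :=
  (s.step0 hT).1.mono fun t _ => (parts0 _).2.2.1
lemma iG0 (hT : 0 < T) : IL T (fun t => (s.c t).G0) := (s.step0 hT).2.mono fun t _ => (parts1 _).1
lemma iUG (hT : 0 < T) : IL T (fun t => (s.c t).U0 * (s.c t).G0) := (s.iU0 hT).mul (s.iG0 hT) fun t => (s.c t).G0_nn

lemma step1 (hT : 0 < T) : IB T (fun t => (s.c t).Z0) ∧ IL T (fun t => (s.c t).Z1) := by
  have h := gronwall hT (y := fun t => (s.c t).Z0) (d := fun t => (1/2) * (s.c t).Z1)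
    (a := fun t => 2000000 * (1 + (s.c t).U0 * (s.c t).G0))
    (yt := fun t => 2 * (I ((s.c t).z1 * (s.c t).z1t) + I ((s.c t).z2 * (s.c t).z2t)))
    ?_ (fun t => (s.c t).Z0_nn)
    (fun t => by have := (s.c t).Z1_nn; positivity) ?_ (((IB.const 1).il.add (s.iUG hT)).cmul (by norm_num)) ?_
  · exact ⟨h.1, (h.2.cmul zero_le_two).mono fun t _ => by linarith⟩
  · intro t ht
    refine ((s.ez1.en s.bz1.s s.bz1t ht).add (s.ez2.en s.bz2.s s.bz2t ht)).congr_deriv ?_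
    ring
  · exact ((s.ez1.gr_cont s.bz1.s s.bz1t).add (s.ez2.gr_cont s.bz2.s s.bz2t)).const_smul (1/2 : ℝ)
  · intro t _
    have h := (s.c t).zz0
    have := mul_nonneg (s.c t).U0_nn (s.c t).G0_nn
    linarith

variable {M : ℝ → ℝ}

lemma step2 (hT : 0 < T) (hM : ∀ t ∈ Ico (T/2) T, (s.c t).Ctl (M t)) (iM : IL T (fun t => M t ^ 2)) :
    IB T (fun t => (s.c t).Z1 + (s.c t).G0) ∧ IL T (fun t => (s.c t).Z2 + gr (s.c t).om) := by
  have iZ : IL T (fun t => (s.c t).Z0 * (s.c t).Z1) := (s.step1 hT).1.mul (s.step1 hT).2 fun t => (s.c t).Z1_nn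
  have z2n : ∀ t, 0 ≤ (s.c t).Z2 := fun t => by
    unfold Cfg.Z2
    have h := fun f => gr_nn f
    exact add_nonneg (add_nonneg (add_nonneg (h _) (h _)) (h _)) (h _)
  have h := gronwall hT (y := fun t => (s.c t).Z1 + sq (s.c t).om) (d := fun t => (1/4) * ((s.c t).Z2 + gr (s.c t).om))
    (a := fun t => 2000000000 * ((1 + (s.c t).U0 * (s.c t).G0 + (s.c t).Z0 * (s.c t).Z1 + M t ^ 2) +
      (sq (s.c t).b1 + sq (s.c t).b2) * M t ^ 2))
    (yt := fun t => 2 * ((I (P 0 (s.c t).z1 * P 0 (s.c t).z1t) + I (P 0 (s.c t).z2 * P 0 (s.c t).z2t)) +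
      (I (P 1 (s.c t).z1 * P 1 (s.c t).z1t) + I (P 1 (s.c t).z2 * P 1 (s.c t).z2t)) + I ((s.c t).om * (s.c t).omt)))
    ?_ (fun t => add_nonneg (s.c t).Z1_nn (sq_nn _))
    (fun t => by have := z2n t; have := gr_nn (s.c t).om; positivity) ?_
    ((((((IB.const 1).il.add (s.iUG hT)).add iZ).add iM).add ((s.isb hT).mul iM fun t => sq_nonneg _)).cmul
      (by norm_num)) ?_
  · refine ⟨h.1.mono fun t _ => by rw [Cfg.G0_eq], (h.2.cmul (c := 4) (by norm_num)).mono fun t _ => by linarith⟩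
  · intro t ht
    have e := fun i => (s.ez1.P i).en (fun t => (s.bz1.s t).P i) (s.bz1t.P i) ht
    have e' := fun i => (s.ez2.P i).en (fun t => (s.bz2.s t).P i) (s.bz2t.P i) ht
    refine ((((e 0).add (e 1)).add ((e' 0).add (e' 1))).add (s.eom.en s.bom.s s.bomt ht)).congr_deriv ?_
    ring
  · have e := fun i => (s.ez1.P i).gr_cont (fun t => (s.bz1.s t).P i) (s.bz1t.P i)
    have e' := fun i => (s.ez2.P i).gr_cont (fun t => (s.bz2.s t).P i) (s.bz2t.P i)
    exact (((((e 0).add (e 1)).add (e' 0)).add (e' 1)).add (s.eom.gr_cont s.bom.s s.bomt)).const_smul (1/4 : ℝ)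
  · intro t ht
    have h := Cfg.zw1 (hM t ht)
    have n1 := mul_nonneg (s.c t).U0_nn (s.c t).G0_nn
    have n2 := mul_nonneg (s.c t).Z0_nn (s.c t).Z1_nn
    have n3 := sq_nonneg (M t)
    have n4 := mul_nonneg n3 (add_nonneg (sq_nn (s.c t).b1) (sq_nn (s.c t).b2))
    have := lin_le (A := 1 + (s.c t).U0 * (s.c t).G0 + (s.c t).Z0 * (s.c t).Z1 + M t ^ 2) (by positivity) n4
      (add_nonneg (s.c t).Z1_nn (sq_nn (s.c t).om))
    linarith

lemma iS2u (hT : 0 < T) (hM : ∀ t ∈ Ico (T/2) T, (s.c t).Ctl (M t)) (iM : IL T (fun t => M t ^ 2)) :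
    IL T (fun t => S 2 (s.c t).u1 + S 2 (s.c t).u2) := by
  obtain ⟨h1, h2⟩ := s.step2 hT hM iM
  refine (((s.iU0 hT).il.add h1.il).add h2).mono fun t _ => ?_
  rw [S_two, S_two]
  have := (s.c t).N_om 1
  rw [N_one] at this
  have h3 := (s.c t).Z1_nn
  have h4 : 0 ≤ (s.c t).Z2 := by
    unfold Cfg.Z2
    have h := fun f => gr_nn f
    exact add_nonneg (add_nonneg (add_nonneg (h _) (h _)) (h _)) (h _)
  rw [this]
  unfold Cfg.U0 Cfg.G0
  linarith

lemma step3 (hT : 0 < T) (hM : ∀ t ∈ Ico (T/2) T, (s.c t).Ctl (M t)) (iM : IL T (fun t => M t ^ 2)) :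
    IB T (fun t => S 2 (s.c t).z1 + S 2 (s.c t).z2) := by
  have iZ1 : IB T (fun t => (s.c t).Z1) := (s.step2 hT hM iM).1.mono fun t _ => le_add_of_nonneg_right (s.c t).G0_nn
  have iu := s.iS2u hT hM iM
  have un : ∀ t, 0 ≤ 1 + (S 2 (s.c t).u1 + S 2 (s.c t).u2) := fun t => by
    have := S_nn 2 (s.c t).u1; have := S_nn 2 (s.c t).u2; positivity
  have h := gronwall hT (y := fun t => N 2 (s.c t).z1 + N 2 (s.c t).z2) (d := fun t => 0)
    (a := fun t => 2000000 * ((1 + ((s.c t).Z0 + (s.c t).Z1)) * (1 + (S 2 (s.c t).u1 + S 2 (s.c t).u2))))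
    (yt := fun t => 2 * ∑ δ ∈ W 2, (I (D δ (s.c t).z1 * D δ (s.c t).z1t) + I (D δ (s.c t).z2 * D δ (s.c t).z2t)))
    ?_ (fun t => add_nonneg (N_nn _ _) (N_nn _ _)) (fun _ => le_rfl) continuousOn_const
    ((((IB.const 1).add ((s.step1 hT).1.add iZ1)).mul ((IB.const 1).il.add iu) un).cmul (by norm_num)) ?_
  · refine (((s.step1 hT).1.add iZ1).add h.1).mono fun t _ => ?_
    rw [S_two, S_two]; unfold Cfg.Z0 Cfg.Z1; linarith
  · intro t ht
    have e := fun {f ft : ℝ → A} (h : Evo T f ft) (sf : ∀ t, Sch (f t)) (hb : LB T ft) (δ : List (Fin 2)) =>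
      (h.D δ).en (fun t => (sf t).D δ) (hb.D δ) ht
    refine ((HasDerivAt.fun_sum fun δ (_ : δ ∈ W 2) => e s.ez1 s.bz1.s s.bz1t δ).add
      (HasDerivAt.fun_sum fun δ (_ : δ ∈ W 2) => e s.ez2 s.bz2.s s.bz2t δ)).congr_deriv ?_
    rw [← Finset.sum_add_distrib, Finset.mul_sum]
    refine Finset.sum_congr rfl fun δ _ => ?_
    ring
  · intro t ht
    have h := (s.c t).zz2
    have h1 := N_nn 3 (s.c t).z1
    have h2 := N_nn 3 (s.c t).z2
    have z := add_nonneg (s.c t).Z0_nn (s.c t).Z1_nn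
    have y := add_nonneg (N_nn 2 (s.c t).z1) (N_nn 2 (s.c t).z2)
    have e : S 2 (s.c t).z1 + S 2 (s.c t).z2 = 1 * (N 2 (s.c t).z1 + N 2 (s.c t).z2) + ((s.c t).Z0 + (s.c t).Z1) := by
      rw [S_two, S_two]; unfold Cfg.Z0 Cfg.Z1; ring
    have l := mul_le_mul_of_nonneg_left (lin_le zero_le_one z y) (un t)
    rw [← e] at l
    linarith

lemma step4 (hT : 0 < T) (hM : ∀ t ∈ Ico (T/2) T, (s.c t).Ctl (M t)) (iM : IL T (fun t => M t ^ 2)) :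
    IB T (fun t => gr (s.c t).b3) ∧ IL T (fun t => N 2 (s.c t).b3) := by
  have iu := s.iS2u hT hM iM
  have iz := s.step3 hT hM iM
  have zn : ∀ t, 0 ≤ S 2 (s.c t).z1 + S 2 (s.c t).z2 := fun t => add_nonneg (S_nn _ _) (S_nn _ _)
  refine gronwall hT
    (a := fun t => 200000 * ((S 2 (s.c t).u1 + S 2 (s.c t).u2) + ((sq (s.c t).b1 + sq (s.c t).b2) * M t ^ 2 +
      (S 2 (s.c t).z1 + S 2 (s.c t).z2) * ((S 2 (s.c t).z1 + S 2 (s.c t).z2) + M t ^ 2))))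
    (yt := fun t => 2 * (I (P 0 (s.c t).b3 * P 0 (s.c t).b3t) + I (P 1 (s.c t).b3 * P 1 (s.c t).b3t)))
    ?_ (fun t => gr_nn _) (fun t => N_nn _ _) (s.eb3.N_cont s.bb3.s s.bb3t 2)
    ((iu.add (((s.isb hT).mul iM fun t => sq_nonneg _).add (iz.mul (iz.il.add iM)
      fun t => add_nonneg (zn t) (sq_nonneg _)))).cmul (by norm_num)) ?_
  · intro t ht
    have e := fun i => (s.eb3.P i).en (fun t => (s.bb3.s t).P i) (s.bb3t.P i) ht
    refine ((e 0).add (e 1)).congr_deriv ?_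
    ring
  · intro t ht
    have h := Cfg.bb1 (hM t ht)
    have z := zn t
    have n1 := add_nonneg (sq_nn (s.c t).b1) (sq_nn (s.c t).b2)
    have := lin_le (A := S 2 (s.c t).u1 + S 2 (s.c t).u2) (B := (sq (s.c t).b1 + sq (s.c t).b2) * M t ^ 2 +
      (S 2 (s.c t).z1 + S 2 (s.c t).z2) * ((S 2 (s.c t).z1 + S 2 (s.c t).z2) + M t ^ 2))
      (add_nonneg (S_nn _ _) (S_nn _ _)) (by positivity) (gr_nn (s.c t).b3)
    linarith

lemma step5 (hT : 0 < T) (hM : ∀ t ∈ Ico (T/2) T, (s.c t).Ctl (M t)) (iM : IL T (fun t => M t ^ 2)) :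
    IB T (fun t => sq (L (s.c t).u3)) ∧ IL T (fun t => gr (L (s.c t).u3)) := by
  obtain ⟨h4, h4'⟩ := s.step4 hT hM iM
  have iG : IB T (fun t => (s.c t).G0) := (s.step2 hT hM iM).1.mono fun t _ => le_add_of_nonneg_left (s.c t).Z1_nn
  have ib := (s.step0 hT).2
  refine gronwall hT
    (a := fun t => 20 * (1 + ((gr (s.c t).b3 + (sq (s.c t).b1 + sq (s.c t).b2) + (s.c t).U0 + (s.c t).G0) * M t ^ 2 +
      N 2 (s.c t).b3 + 2 * (s.c t).NN 1)))
    (yt := fun t => 2 * I (L (s.c t).u3 * L (s.c t).u3t))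
    ?_ (fun t => sq_nn _) (fun t => gr_nn _) (s.eu3.L.gr_cont s.bu3.L.s s.bu3t.L)
    (((IB.const 1).il.add ((((((h4.add (s.isb hT)).add (s.iU0 hT)).add iG).mul iM fun t => sq_nonneg _).add h4').add
      (ib.cmul zero_le_two))).cmul (by norm_num)) ?_
  · intro t ht
    exact s.eu3.L.en s.bu3.L.s s.bu3t.L ht
  · intro t ht
    have h := Cfg.uu2 (hM t ht)
    rw [N_two (s.c t).su3] at h
    obtain ⟨-, q1, q2, -⟩ := parts1 (s.c t)
    have n0 := gr_nn (L (s.c t).u3)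
    have n1 := add_nonneg (sq_nn (s.c t).b1) (sq_nn (s.c t).b2)
    have n2 := gr_nn (s.c t).b3
    have n3 := (s.c t).U0_nn
    have n4 := (s.c t).G0_nn
    have n5 := N_nn 2 (s.c t).b3
    have n6 := (s.c t).NN_nn 1
    have := lin_le (A := 1) (B := (gr (s.c t).b3 + (sq (s.c t).b1 + sq (s.c t).b2) + (s.c t).U0 + (s.c t).G0) * M t ^ 2 +
      N 2 (s.c t).b3 + 2 * (s.c t).NN 1) zero_le_one (by positivity) (sq_nn (L (s.c t).u3))
    have e : M t ^ 2 * (gr (s.c t).b3 + sq (s.c t).b1 + sq (s.c t).b2 + sq (s.c t).u1 + sq (s.c t).u2 + (s.c t).G0) =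
      (gr (s.c t).b3 + (sq (s.c t).b1 + sq (s.c t).b2) + (s.c t).U0 + (s.c t).G0) * M t ^ 2 := by
      unfold Cfg.U0; ring
    rw [e] at h
    linarith

lemma gr_sub_le {f g : A} (hf : Sch f) (hg : Sch g) : gr (f - g) ≤ 2 * gr f + 2 * gr g := by
  have h := fun i => sq_sub_le (hf.P i) (hg.P i)
  unfold gr
  simp only [map_sub]
  linarith [h 0, h 1]

lemma bb_parts (c : Cfg) : gr c.b1 + gr c.b2 ≤ 2 * c.Z1 + 4 * sq (L c.u3) ∧
    N 2 c.b1 + N 2 c.b2 ≤ 2 * (S 2 c.z1 + S 2 c.z2) + 4 * gr (L c.u3) := by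
  have e1 : c.b1 = c.z1 - P 1 c.u3 := by unfold Cfg.z1; ring
  have e2 : c.b2 = c.z2 - P 0 (-c.u3) := by unfold Cfg.z2; rw [map_neg]; ring
  have e2' : c.b2 = c.z2 - (- P 0 c.u3) := by unfold Cfg.z2; ring
  have su := c.su3
  have k : N 2 c.u3 = gr (P 0 c.u3) + gr (P 1 c.u3) := by rw [N_succ, N_one, N_one]
  have g0 := gr_nn (P 0 c.u3); have g1 := gr_nn (P 1 c.u3)
  have gneg : ∀ f : A, gr (-f) = gr f := fun f => by unfold gr; simp only [map_neg, sq_neg']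
  rw [N_two su] at k
  have h1 := gr_sub_le c.sz1 (su.P 1)
  have h2 := gr_sub_le c.sz2 ((su.P 0).neg)
  rw [← e1] at h1
  rw [← e2', gneg] at h2
  have Lsub : ∀ f g : A, L (f - g) = L f - L g := fun f g => by unfold L; simp only [map_sub]; ring
  have Lneg : ∀ f : A, L (-f) = -L f := fun f => by unfold L; simp only [map_neg]; ring
  have h3 := sq_sub_le c.sz1.L (su.P 1).L
  have h4 := sq_sub_le c.sz2.L (su.P 0).neg.L
  rw [← Lsub, ← e1] at h3
  rw [← Lsub, ← e2', Lneg, sq_neg'] at h4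
  have k2 : gr (L c.u3) = sq (L (P 0 c.u3)) + sq (L (P 1 c.u3)) := by unfold gr; rw [P_L, P_L]
  have m1 := N_le_S (k := 2) le_rfl c.z1
  have m2 := N_le_S (k := 2) le_rfl c.z2
  rw [N_two c.sz1] at m1
  rw [N_two c.sz2] at m2
  rw [N_two c.sb1, N_two c.sb2]
  have s0 := sq_nn (L (P 0 c.u3)); have s1 := sq_nn (L (P 1 c.u3))
  constructor
  · unfold Cfg.Z1; linarith
  · linarith

lemma step6 (hT : 0 < T) (hM : ∀ t ∈ Ico (T/2) T, (s.c t).Ctl (M t)) (iM : IL T (fun t => M t ^ 2)) :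
    IB T (fun t => (s.c t).Q 1) ∧ IL T (fun t => (s.c t).Q 2) := by
  obtain ⟨h4, h4'⟩ := s.step4 hT hM iM
  obtain ⟨h5, h5'⟩ := s.step5 hT hM iM
  obtain ⟨h2, -⟩ := s.step2 hT hM iM
  have q0 := (s.step0 hT).1
  have q1 : IB T (fun t => (s.c t).Q 1) := by
    refine (((q0.cmul zero_le_two).add ((h2.cmul (c := 2) (by norm_num)).add h4)).add (h5.cmul (c := 5) (by norm_num))).mono
      fun t _ => ?_
    rw [Cfg.Q_succ]
    unfold Cfg.NN
    simp only [N_one, zero_add]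
    have := gr_le_L (s.c t).su3
    have := (bb_parts (s.c t)).1
    have h3 := (parts0 (s.c t)).2.1
    have := (s.c t).Z1_nn; have := (s.c t).G0_nn
    have e : (s.c t).G0 = gr (s.c t).u1 + gr (s.c t).u2 := rfl
    linarith
  refine ⟨q1, ?_⟩
  refine (((q1.il.add (s.iS2u hT hM iM)).add (h5.il.add h4')).add (((s.step3 hT hM iM).il.cmul zero_le_two).add
    (h5'.cmul (c := 4) (by norm_num)))).mono fun t _ => ?_
  rw [Cfg.Q_succ]
  unfold Cfg.NN
  simp only [one_add_one_eq_two]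
  have := (bb_parts (s.c t)).2
  have := N_le_S (k := 2) le_rfl (s.c t).u1
  have := N_le_S (k := 2) le_rfl (s.c t).u2
  have := N_two (s.c t).su3
  linarith

lemma step7 (hT : 0 < T) (hM : ∀ t ∈ Ico (T/2) T, (s.c t).Ctl (M t)) (iM : IL T (fun t => M t ^ 2)) (n : ℕ) :
    IB T (fun t => (s.c t).Q (n + 1)) ∧ IL T (fun t => (s.c t).Q (n + 2)) := by
  obtain ⟨q1, q2⟩ := s.step6 hT hM iM
  induction n with
  | zero => exact ⟨q1, q2⟩
  | succ n ih =>
    obtain ⟨i1, i2⟩ := ih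
    obtain ⟨C, hC0, hC⟩ := Cfg.level (n + 1)
    have n' := fun t k => (s.c t).Q_nn k
    have nn : ∀ t, 0 ≤ 1 + (s.c t).Q 1 * (s.c t).Q 2 + (s.c t).Q 2 + (s.c t).Q (n + 1) := fun t => by
      have := n' t 1; have := n' t 2; have := n' t (n + 1); positivity
    have h := gronwall hT (y := fun t => (s.c t).NN (n + 2)) (d := fun t => (1/4) * (s.c t).NN (n + 3))
      (yt := fun t => 2 * (s.c t).Yt 1 (n + 1))
      (a := fun t => 2 * C * ((1 + (s.c t).Q (n + 1)) * (1 + (s.c t).Q 1 * (s.c t).Q 2 + (s.c t).Q 2 + (s.c t).Q (n + 1))))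
      (fun t ht => s.NN_deriv (n + 1) ht) (fun t => (s.c t).NN_nn _)
      (fun t => by have := (s.c t).NN_nn (n + 3); positivity) ?_
      ((((IB.const 1).add i1).mul ((((IB.const 1).il.add (q1.mul q2 fun t => n' t 2)).add q2).add i1.il) nn).cmul
        (by positivity)) ?_
    · have b : IB T (fun t => (s.c t).Q (n + 1 + 1)) := (i1.add h.1).mono fun t _ => by rw [Cfg.Q_succ]
      refine ⟨b, (b.il.add (h.2.cmul (c := 4) (by norm_num))).mono fun t _ => ?_⟩
      rw [show n + 1 + 2 = (n + 2) + 1 by ring, Cfg.Q_succ]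
      simp only [show n + 2 + 1 = n + 3 by ring, show n + 1 + 1 = n + 2 by ring]
      linarith
    · unfold Cfg.NN
      exact ((((((s.eu1.N_cont s.bu1.s s.but.1 _).add (s.eu2.N_cont s.bu2.s s.but.2 _)).add
        (s.eu3.N_cont s.bu3.s s.bu3t _)).add (s.eb1.N_cont s.bb1.s s.bb1t _)).add (s.eb2.N_cont s.bb2.s s.bb2t _)).add
        (s.eb3.N_cont s.bb3.s s.bb3t _)).const_smul (1/4 : ℝ)
    · intro t _
      have h1 := hC (s.c t) 1 Wgt.one
      rw [Cfg.X_one] at h1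
      unfold Cfg.R at h1
      have e : (s.c t).Q (n + 1 + 1) = 1 * (s.c t).NN (n + 2) + (s.c t).Q (n + 1) := by rw [Cfg.Q_succ]; ring
      have l := mul_le_mul_of_nonneg_left (mul_le_mul_of_nonneg_left
        (lin_le zero_le_one (n' t (n + 1)) ((s.c t).NN_nn (n + 2))) (nn t)) hC0
      rw [← e] at l
      simp only [show n + 1 + 2 = n + 3 by ring] at h1 ⊢
      linarith

/-- the a priori bound -/
theorem main (hT : 0 < T) {p : ℝ} (hp : 2 < p) (hN : IL T (fun t => Np p (s.c t).u3 ^ 2)) (n : ℕ) :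
    IB T (fun t => (s.c t).Q n) := by
  obtain ⟨C, hC0, hC⟩ := bilap hp
  have h := s.step7 hT (M := fun t => C * (√(sq (s.c t).u3) + Np p (s.c t).u3))
    (fun t _ => ⟨fun x => (hC _ (s.c t).su3 x).1, fun i x => ((hC _ (s.c t).su3 x).2 i).1,
      fun i x => ((hC _ (s.c t).su3 x).2 i).2⟩) ?_ n
  · exact h.1.mono fun t _ => (s.c t).Q_mono (by omega)
  · refine (((s.step0 hT).1.il.add hN).cmul (c := 2 * C ^ 2) (by positivity)).mono fun t _ => ?_
    have h1 := (parts0 (s.c t)).2.1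
    have h2 := Real.sq_sqrt (sq_nn (s.c t).u3)
    have h3 : (√(sq (s.c t).u3) + Np p (s.c t).u3) ^ 2 ≤ 2 * ((s.c t).Q 0 + Np p (s.c t).u3 ^ 2) := by
      nlinarith [sq_nonneg (√(sq (s.c t).u3) - Np p (s.c t).u3)]
    have := mul_le_mul_of_nonneg_left h3 (sq_nonneg C)
    rw [mul_pow]; linarith

end Sol
end HM
end
end

section
open MeasureTheory Set Filter Topology
open scoped ENNReal ContDiff
set_option linter.unusedSimpArgs false

noncomputable section
namespace HM

lemma Sol.crit {T : ℝ} (s : Sol T) (hT : 0 < T) {p : ℝ≥0∞} {r : ℝ} (hp : 2 < p) (hptop : p ≠ ⊤) (hr : 2 ≤ r)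
    (h : ∫⁻ t in Ico (T/2) T, (eLpNorm (fun x => (L (L (s.c t).u3)) x) p volume) ^ r < ⊤) :
    IL T (fun t => Np p.toReal (s.c t).u3 ^ 2) := by
  have hp0 : p ≠ 0 := (zero_lt_two.trans hp).ne'
  have hsub : Ico (T/2) T ⊆ Ioo 0 T := fun t ht => ⟨by linarith [ht.1], ht.2⟩
  set w : ℝ × E2 → ℝ := (Ioo 0 T ×ˢ univ).indicator (fun q => (L (L (s.c q.1).u3)) q.2) with hw
  have wm : Measurable w := by
    have hS : MeasurableSet (Ioo 0 T ×ˢ (univ : Set E2)) := opn.measurableSet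
    have := ContinuousOn.measurable_piecewise (f := fun q : ℝ × E2 => (L (L (s.c q.1).u3)) q.2)
      (g := (0 : ℝ × E2 → ℝ)) s.eu3.L.L.cont continuousOn_const hS
    rwa [Set.piecewise_eq_indicator] at this
  set G : ℝ → ℝ≥0∞ := fun t => (∫⁻ x, ‖w (t, x)‖ₑ ^ p.toReal) ^ (1 / p.toReal) with hG
  have Gm : Measurable G :=
    (Measurable.lintegral_prod_right' (f := fun q : ℝ × E2 => ‖w q‖ₑ ^ p.toReal)
      (wm.enorm.pow_const _)).pow_const _
  have Ge : ∀ t ∈ Ico (T/2) T, G t = eLpNorm (fun x => (L (L (s.c t).u3)) x) p volume := by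
    intro t ht
    rw [eLpNorm_eq_lintegral_rpow_enorm_toReal hp0 hptop]
    simp only [hG, hw]
    congr 2
    funext x
    rw [indicator_of_mem (show (t, x) ∈ Ioo 0 T ×ˢ (univ : Set E2) from ⟨hsub ht, mem_univ _⟩)]
  have Gi : ∫⁻ t in Ico (T/2) T, G t ^ r ≠ ⊤ := by
    rw [setLIntegral_congr_fun measurableSet_Ico (fun t ht => by rw [Ge t ht])]
    exact h.ne
  refine ⟨fun t => 1 + (G t ^ r).toReal, ?_, fun t ht => ?_⟩
  · refine Integrable.add (integrableOn_const (by simp)) ?_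
    exact integrable_toReal_of_lintegral_ne_top (Gm.pow_const r).aemeasurable Gi
  · have e : Np p.toReal (s.c t).u3 = (G t).toReal := by
      rw [Ge t ht, eLpNorm_eq_lintegral_rpow_enorm_toReal hp0 hptop, ← ENNReal.toReal_rpow]
      unfold Np
      congr 1
      rw [integral_eq_lintegral_of_nonneg_ae (Eventually.of_forall fun x => by positivity)]
      · congr 1
        refine lintegral_congr fun x => ?_
        rw [← ENNReal.ofReal_rpow_of_nonneg (abs_nonneg _) ENNReal.toReal_nonneg, ← Real.norm_eq_abs, ofReal_norm]
      · exact ((L (L (s.c t).u3)).cont.abs.rpow_const fun x => Or.inr ENNReal.toReal_nonneg).aestronglyMeasurable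
    have e2 : (G t ^ r).toReal = (G t).toReal ^ r := (ENNReal.toReal_rpow _ _).symm
    change Np p.toReal (s.c t).u3 ^ 2 ≤ 1 + (G t ^ r).toReal
    rw [e, e2]
    set N := (G t).toReal
    have hN : 0 ≤ N := ENNReal.toReal_nonneg
    rcases le_total N 1 with h1 | h1
    · have : 0 ≤ N ^ r := Real.rpow_nonneg hN r
      nlinarith
    · have : N ^ (2:ℝ) ≤ N ^ r := Real.rpow_le_rpow_of_exponent_le h1 hr
      rw [Real.rpow_two] at this
      linarith

/-! ### norms of iterated derivatives -/

section
variable {F : Type*} [NormedAddCommGroup F] [NormedSpace ℝ F]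

lemma nrm_comp {F' : Type*} [NormedAddCommGroup F'] [NormedSpace ℝ F'] {f : E2 → F} (hf : ContDiff ℝ ∞ f) (G : F →L[ℝ] F') (hG : ‖G‖ ≤ 1) (n : ℕ) (x : E2) :
    ‖iteratedFDeriv ℝ n (fun y => G (f y)) x‖ ≤ ‖iteratedFDeriv ℝ n f x‖ := by
  have h := G.norm_iteratedFDeriv_comp_left (hf.contDiffAt (x := x)) (n := n) (by exact_mod_cast le_top)
  refine h.trans ?_
  exact mul_le_of_le_one_left (norm_nonneg _) hG

lemma nrm_sum {k : ℕ} {F' : Type*} [NormedAddCommGroup F'] [NormedSpace ℝ F'] {f : Fin k → E2 → F'} (hf : ∀ i, ContDiff ℝ ∞ (f i))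
    (G : Fin k → F' →L[ℝ] F) (hG : ∀ i, ‖G i‖ ≤ 1) (n : ℕ) (x : E2) :
    ‖iteratedFDeriv ℝ n (fun y => ∑ i, G i (f i y)) x‖ ≤ ∑ i, ‖iteratedFDeriv ℝ n (f i) x‖ := by
  rw [iteratedFDeriv_sum (f := fun i y => G i (f i y)) (fun i _ => (((G i).contDiff.comp (hf i)).of_le (by exact_mod_cast le_top)))]
  rw [Finset.sum_apply]
  refine (norm_sum_le _ _).trans (Finset.sum_le_sum fun i _ => ?_)
  exact nrm_comp (hf i) (G i) (hG i) n x
end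

lemma nrm_pd {f : E2 → ℝ} (hf : ContDiff ℝ ∞ f) (i : Fin 2) (n : ℕ) (x : E2) :
    ‖iteratedFDeriv ℝ n (pd i f) x‖ ≤ ‖iteratedFDeriv ℝ (n + 1) f x‖ := by
  rw [← norm_iteratedFDeriv_fderiv]
  refine nrm_comp (hf.fderiv_right (m := ∞) (by simp)) (ContinuousLinearMap.apply ℝ ℝ (Pi.single i 1 : E2)) ?_ n x
  refine ContinuousLinearMap.opNorm_le_bound _ zero_le_one fun g => ?_
  have := g.le_opNorm (Pi.single i 1 : E2)
  rw [Pi.norm_single, norm_one] at this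
  simpa [mul_comm] using this

lemma nrm_pd_sum {f : E2 → ℝ} (hf : ContDiff ℝ ∞ f) (n : ℕ) (x : E2) :
    ‖iteratedFDeriv ℝ (n + 1) f x‖ ≤ ∑ i, ‖iteratedFDeriv ℝ n (pd i f) x‖ := by
  rw [← norm_iteratedFDeriv_fderiv]
  have e : fderiv ℝ f = fun y => ∑ i : Fin 2, (ContinuousLinearMap.toSpanSingleton ℝ
      (ContinuousLinearMap.proj i : E2 →L[ℝ] ℝ)) (pd i f y) := by
    funext y
    ext v
    have hv : v = ∑ i : Fin 2, v i • (Pi.single i 1 : E2) := by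
      ext j; fin_cases j <;> simp
    conv_lhs => rw [hv]
    simp only [map_sum, map_smul, pd, ContinuousLinearMap.sum_apply, ContinuousLinearMap.toSpanSingleton_apply,
      ContinuousLinearMap.smul_apply, ContinuousLinearMap.proj_apply, smul_eq_mul]
    refine Finset.sum_congr rfl fun i _ => mul_comm _ _
  rw [e]
  refine nrm_sum (fun i => contDiff_pd hf i) _ (fun i => ?_) n x
  rw [ContinuousLinearMap.norm_toSpanSingleton]
  refine ContinuousLinearMap.opNorm_le_bound _ zero_le_one fun v => ?_
  rw [one_mul]; exact norm_le_pi_norm v i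

lemma D_le (δ : List (Fin 2)) : ∀ (f : A) (x : E2), |(D δ f) x| ≤ ‖iteratedFDeriv ℝ δ.length f x‖ := by
  induction δ with
  | nil => intro f x; simp
  | cons i δ ih => intro f x; exact (ih (P i f) x).trans (nrm_pd f.smooth i _ x)

lemma le_D (k : ℕ) : ∀ (f : A) (x : E2), ‖iteratedFDeriv ℝ k f x‖ ≤ ∑ δ ∈ W k, |(D δ f) x| := by
  induction k with
  | zero =>
    intro f x
    have : W 0 = {[]} := by ext δ; rw [mem_W]; simp
    rw [this]; simp
  | succ k ih =>
    intro f x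
    rw [sum_W_succ]
    refine (nrm_pd_sum f.smooth k x).trans ?_
    rw [Fin.sum_univ_two]
    exact add_le_add (ih (P 0 f) x) (ih (P 1 f) x)

/-- the bound for vector valued functions -/
lemma vec_le {f : E2 → Fin 3 → ℝ} {a : Fin 3 → A} (h : ∀ x i, f x i = (a i) x) (k : ℕ) (x : E2) :
    ‖iteratedFDeriv ℝ k f x‖ ≤ ∑ i, ∑ δ ∈ W k, |(D δ (a i)) x| := by
  have e : f = fun y => ∑ i : Fin 3, (ContinuousLinearMap.single ℝ (fun _ : Fin 3 => ℝ) i) ((a i) y) := by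
    funext y j
    rw [h, Finset.sum_apply]
    simp [Pi.single_apply]
  rw [e]
  refine (nrm_sum (fun i => (a i).smooth) _ (fun i => ?_) k x).trans (Finset.sum_le_sum fun i _ => le_D k _ x)
  refine ContinuousLinearMap.opNorm_le_bound _ zero_le_one fun v => ?_
  rw [one_mul]; exact (Pi.norm_single (G := fun _ : Fin 3 => ℝ) v).le

lemma vec_ge {f : E2 → Fin 3 → ℝ} (hf : ContDiff ℝ ∞ f) {a : Fin 3 → A} (h : ∀ x i, f x i = (a i) x) (i : Fin 3)
    (δ : List (Fin 2)) (x : E2) : |(D δ (a i)) x| ≤ ‖iteratedFDeriv ℝ δ.length f x‖ := by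
  refine (D_le δ (a i) x).trans ?_
  have e : (a i : E2 → ℝ) = fun y => (ContinuousLinearMap.proj i : (Fin 3 → ℝ) →L[ℝ] ℝ) (f y) := by
    funext y; simp [h]
  rw [e]
  refine nrm_comp hf _ ?_ _ x
  refine ContinuousLinearMap.opNorm_le_bound _ zero_le_one fun v => ?_
  rw [one_mul]; exact norm_le_pi_norm v i

lemma vec_sq {f : E2 → Fin 3 → ℝ} {a : Fin 3 → A} (h : ∀ x i, f x i = (a i) x) (k : ℕ) (x : E2) :
    ‖iteratedFDeriv ℝ k f x‖ ^ 2 ≤ 3 * (W k).card * ∑ i, ∑ δ ∈ W k, (D δ (a i)) x ^ 2 := by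
  have h1 := pow_le_pow_left₀ (norm_nonneg _) (vec_le h k x) 2
  refine h1.trans ?_
  have h2 := sq_sum_le_card_mul_sum_sq (s := Finset.univ) (f := fun i : Fin 3 => ∑ δ ∈ W k, |(D δ (a i)) x|)
  refine h2.trans ?_
  simp only [Finset.card_univ, Fintype.card_fin, Nat.cast_ofNat]
  rw [mul_assoc]
  refine mul_le_mul_of_nonneg_left ?_ (by norm_num)
  rw [Finset.mul_sum]
  refine Finset.sum_le_sum fun i _ => ?_
  have h3 := sq_sum_le_card_mul_sum_sq (s := W k) (f := fun δ => |(D δ (a i)) x|)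
  simpa only [sq_abs] using h3

lemma sq_int {f : A} (hf : Sch f) : Integrable (fun x => f x ^ 2) := by
  have := (hf.mul f).integrable
  refine this.congr (Eventually.of_forall fun x => ?_)
  simp [pow_two]

lemma vec_int {f : E2 → Fin 3 → ℝ} (hf : ContDiff ℝ ∞ f) {a : Fin 3 → A} (h : ∀ x i, f x i = (a i) x)
    (ha : ∀ i, Sch (a i)) (k : ℕ) : Integrable (fun x => ‖iteratedFDeriv ℝ k f x‖ ^ 2) ∧
    ∫ x, ‖iteratedFDeriv ℝ k f x‖ ^ 2 ≤ 3 * (W k).card * ∑ i, N k (a i) := by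
  have ii : Integrable (fun x => 3 * ((W k).card : ℝ) * ∑ i, ∑ δ ∈ W k, (D δ (a i)) x ^ 2) :=
    (integrable_finsetSum _ fun i _ => integrable_finsetSum _ fun δ _ => sq_int ((ha i).D δ)).const_mul _
  have m : Integrable (fun x => ‖iteratedFDeriv ℝ k f x‖ ^ 2) := by
    refine ii.mono' ?_ (Eventually.of_forall fun x => ?_)
    · exact ((hf.continuous_iteratedFDeriv (m := k) (by exact_mod_cast le_top)).norm.pow 2).aestronglyMeasurable
    · rw [Real.norm_of_nonneg (by positivity)]; exact vec_sq h k x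
  refine ⟨m, (integral_mono m ii fun x => vec_sq h k x).trans (le_of_eq ?_)⟩
  rw [integral_const_mul, integral_finsetSum _ fun i _ => integrable_finsetSum _ fun δ _ => sq_int ((ha i).D δ)]
  congr 1
  refine Finset.sum_congr rfl fun i _ => ?_
  rw [integral_finsetSum _ fun δ _ => sq_int ((ha i).D δ)]
  unfold N
  simp only [sq_eq]

lemma hs_up (m : ℕ) : ∃ K : ℝ, 0 ≤ K ∧ ∀ (f : E2 → Fin 3 → ℝ) (a : Fin 3 → A), ContDiff ℝ ∞ f → (∀ x i, f x i = (a i) x) →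
    (∀ i, Sch (a i)) → hSobNorm m f ≤ √(K * ∑ i, S m (a i)) := by
  refine ⟨∑ k ∈ Finset.range (m + 1), 3 * ((W k).card : ℝ), by positivity, fun f a hf h ha => ?_⟩
  unfold hSobNorm
  refine Real.sqrt_le_sqrt ?_
  rw [Finset.sum_mul]
  refine Finset.sum_le_sum fun k hk => ((vec_int hf h ha k).2).trans ?_
  refine mul_le_mul_of_nonneg_left (Finset.sum_le_sum fun i _ => N_le_S ?_ _) (by positivity)
  have := Finset.mem_range.1 hk; omega

lemma hs_low (m : ℕ) : ∃ K : ℝ, 0 ≤ K ∧ ∀ (f : E2 → Fin 3 → ℝ) (a : Fin 3 → A), ContDiff ℝ ∞ f → (∀ x i, f x i = (a i) x) →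
    (∀ i, Sch (a i)) → ∀ i, S m (a i) ≤ K * hSobNorm m f ^ 2 := by
  refine ⟨∑ k ∈ Finset.range (m + 1), ((W k).card : ℝ), by positivity, fun f a hf h ha i => ?_⟩
  have nn : ∀ k ∈ Finset.range (m + 1), 0 ≤ ∫ x, ‖iteratedFDeriv ℝ k f x‖ ^ 2 := fun k _ =>
    integral_nonneg fun x => by positivity
  unfold hSobNorm S
  rw [Real.sq_sqrt (Finset.sum_nonneg nn), Finset.sum_mul]
  refine Finset.sum_le_sum fun k hk => ?_
  have h1 : N k (a i) ≤ (W k).card * ∫ x, ‖iteratedFDeriv ℝ k f x‖ ^ 2 := by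
    unfold N
    rw [← nsmul_eq_mul]
    refine Finset.sum_le_card_nsmul _ _ _ fun δ hδ => ?_
    rw [sq_eq]
    refine integral_mono (sq_int ((ha i).D δ)) (vec_int hf h ha k).1 fun x => ?_
    have := vec_ge hf h i δ x
    rw [mem_W.1 hδ] at this
    simp only
    rw [← sq_abs]
    exact pow_le_pow_left₀ (abs_nonneg _) this 2
  refine h1.trans (mul_le_mul_of_nonneg_left ?_ (by positivity))
  exact Finset.single_le_sum (f := fun k => ∫ x, ‖iteratedFDeriv ℝ k f x‖ ^ 2) nn hk

/-! ### Schwartz functions -/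

lemma schw_pd {f : E2 → ℝ} (hf : IsSchwartz f) (i : Fin 2) : IsSchwartz (pd i f) := by
  refine ⟨contDiff_pd hf.1 i, fun k n => ?_⟩
  obtain ⟨C, hC⟩ := hf.2 k (n + 1)
  exact ⟨C, fun x => (mul_le_mul_of_nonneg_left (nrm_pd hf.1 i n x) (by positivity)).trans (hC x)⟩

lemma schw_wt (k n : ℕ) : ∀ {f : E2 → ℝ}, IsSchwartz f → Wt k n f := by
  have z : ∀ {f : E2 → ℝ}, IsSchwartz f → Wt k 0 f := by
    intro f hf
    obtain ⟨C0, h0⟩ := hf.2 0 0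
    obtain ⟨C1, h1⟩ := hf.2 k 0
    refine ⟨2 ^ (k - 1) * (C0 + C1), fun x => ?_⟩
    have a0 := h0 x
    have a1 := h1 x
    simp only [norm_iteratedFDeriv_zero, Real.norm_eq_abs, pow_zero, one_mul] at a0 a1
    have := add_pow_le zero_le_one (norm_nonneg x) k
    rw [one_pow] at this
    have h2 := mul_le_mul_of_nonneg_left this (abs_nonneg (f x))
    have h3 : (2:ℝ) ^ (k - 1) * (|f x| + ‖x‖ ^ k * |f x|) ≤ 2 ^ (k - 1) * (C0 + C1) :=
      mul_le_mul_of_nonneg_left (add_le_add a0 a1) (by positivity)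
    linarith
  induction n with
  | zero => exact z
  | succ n ih => intro f hf; exact ⟨z hf, fun i => ih (schw_pd hf i)⟩

lemma schw_comp {f : E2 → Fin 3 → ℝ} (hf : IsSchwartz f) (i : Fin 3) : IsSchwartz (fun x => f x i) := by
  have hp : ‖(ContinuousLinearMap.proj i : (Fin 3 → ℝ) →L[ℝ] ℝ)‖ ≤ 1 := by
    refine ContinuousLinearMap.opNorm_le_bound _ zero_le_one fun v => ?_
    rw [one_mul]; exact norm_le_pi_norm v i
  refine ⟨contDiff_pi.1 hf.1 i, fun k n => ?_⟩
  obtain ⟨C, hC⟩ := hf.2 k n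
  exact ⟨C, fun x => (mul_le_mul_of_nonneg_left (nrm_comp hf.1 (ContinuousLinearMap.proj i) hp n x)
    (by positivity)).trans (hC x)⟩

end HM
end
end

section
open MeasureTheory Set Filter Topology
open scoped ENNReal ContDiff
set_option linter.unusedSimpArgs false

noncomputable section
namespace HM

lemma Cfg.b1t_eq (c : Cfg) : c.b1t = L c.b1 + (c.b1 * P 0 c.u1 + c.b2 * P 1 c.u1)
    - P 1 (c.j1 * c.b2 - c.j2 * c.b1) - (c.u1 * P 0 c.b1 + c.u2 * P 1 c.b1) := by
  unfold b1t G3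
  rw [map_sub, map_sub (P 1) (c.u1 * c.b2), P_mul, P_mul]
  linear_combination c.u1 * c.db - c.b1 * c.du

lemma Cfg.b2t_eq (c : Cfg) : c.b2t = L c.b2 + (c.b1 * P 0 c.u2 + c.b2 * P 1 c.u2)
    - (-P 0 (c.j1 * c.b2 - c.j2 * c.b1)) - (c.u1 * P 0 c.b2 + c.u2 * P 1 c.b2) := by
  unfold b2t G3
  rw [map_sub, map_sub (P 0) (c.u1 * c.b2), P_mul, P_mul]
  linear_combination c.u2 * c.db - c.b2 * c.du

lemma Cfg.b3t_eq2 (c : Cfg) : c.b3t = L c.b3 + (c.b1 * P 0 c.u3 + c.b2 * P 1 c.u3)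
    - (P 0 (c.j3 * c.b1 - c.j1 * c.b3) - P 1 (c.j2 * c.b3 - c.j3 * c.b2))
    - (c.u1 * P 0 c.b3 + c.u2 * P 1 c.b3) := by
  unfold b3t G2 G1
  rw [map_sub (P 0) (c.u3 * c.b1 - c.u1 * c.b3), map_sub (P 0) (c.u3 * c.b1),
    map_sub (P 1) (c.u2 * c.b3 - c.u3 * c.b2), map_sub (P 1) (c.u2 * c.b3), P_mul, P_mul, P_mul, P_mul]
  linear_combination c.u3 * c.db - c.b3 * c.du

def Cfg.U (c : Cfg) : Fin 3 → A := ![c.u1, c.u2, c.u3]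
def Cfg.B (c : Cfg) : Fin 3 → A := ![c.b1, c.b2, c.b3]

lemma ind_eq (c : Cfg) {u b : E2 → Fin 3 → ℝ} (hu : ∀ x i, u x i = (c.U i) x) (hb : ∀ x i, b x i = (c.B i) x)
    (x : E2) (i : Fin 3) :
    lap (fun y => b y i) x + advect b u x i - curl (fun y => crossProduct (curl b y) (b y)) x i - advect u b x i
      = (![c.b1t, c.b2t, c.b3t] i) x := by
  obtain rfl : u = fun x i => (c.U i) x := by funext x i; exact hu x i
  obtain rfl : b = fun x i => (c.B i) x := by funext x i; exact hb x i
  rw [Cfg.b1t_eq, Cfg.b2t_eq, Cfg.b3t_eq2]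
  simp only [cross_apply]
  fin_cases i <;> rfl

lemma mom_eq (c : Cfg) (q : A) {u b : E2 → Fin 3 → ℝ} (hu : ∀ x i, u x i = (c.U i) x) (hb : ∀ x i, b x i = (c.B i) x)
    (x : E2) (i : Fin 3) :
    lap (fun y => u y i) x + (advect b b x i - advect u u x i) - ![pd 0 q x, pd 1 q x, 0] i
      = (![L c.u1 + c.F1 - P 0 q, L c.u2 + c.F2 - P 1 q, c.u3t] i) x := by
  obtain rfl : u = fun x i => (c.U i) x := by funext x i; exact hu x i
  obtain rfl : b = fun x i => (c.B i) x := by funext x i; exact hb x i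
  rw [Cfg.u3t_eq]
  fin_cases i
  · rfl
  · rfl
  · exact sub_zero _

open Classical in
/-- lifting a time dependent Schwartz function to the algebra -/
def lift (T : ℝ) (w : ℝ → E2 → ℝ) (hw : ∀ t ∈ Ioo 0 T, IsSchwartz (w t)) (t : ℝ) : A :=
  if h : t ∈ Ioo 0 T then A.mk (w t) (hw t h).1 (fun n => schw_wt 0 n (hw t h)) else 0

section
variable {T : ℝ} {w : ℝ → E2 → ℝ} (hw : ∀ t ∈ Ioo 0 T, IsSchwartz (w t))

lemma lift_apply {t : ℝ} (ht : t ∈ Ioo 0 T) (x : E2) : (lift T w hw t) x = w t x := by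
  unfold lift; rw [dif_pos ht]; rfl

lemma lift_fun {t : ℝ} (ht : t ∈ Ioo 0 T) : (fun x => (lift T w hw t) x) = w t :=
  funext fun x => lift_apply hw ht x

lemma lift_out {t : ℝ} (ht : t ∉ Ioo 0 T) : lift T w hw t = 0 := by
  unfold lift; rw [dif_neg ht]

lemma lift_sch (t : ℝ) : Sch (lift T w hw t) := by
  by_cases ht : t ∈ Ioo 0 T
  · intro n
    have := schw_wt 3 n (hw t ht)
    rw [← lift_fun hw ht] at this
    exact this
  · rw [lift_out hw ht]; exact Sch.zero

lemma lift_evo (hs : ContDiffOn ℝ ∞ (fun p : ℝ × E2 => w p.1 p.2) (Ioo 0 T ×ˢ univ)) {ft : ℝ → A}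
    (hd : ∀ t ∈ Ioo 0 T, ∀ x, deriv (fun s => w s x) t = (ft t) x) : Evo T (lift T w hw) ft := by
  refine ⟨hs.congr fun p hp => lift_apply hw hp.1 _, fun t ht x => ?_⟩
  have h1 : DifferentiableAt ℝ (fun p : ℝ × E2 => w p.1 p.2) (t, x) :=
    (hs.contDiffAt (opn.mem_nhds ⟨ht, mem_univ _⟩)).differentiableAt (by simp)
  have h2 : DifferentiableAt ℝ (fun s : ℝ => (s, x)) t := by fun_prop
  have h3 : DifferentiableAt ℝ (fun s => w s x) t :=
    DifferentiableAt.comp (g := fun p : ℝ × E2 => w p.1 p.2) (f := fun s : ℝ => (s, x)) t h1 h2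
  rw [← hd t ht x]
  refine h3.hasDerivAt.congr_of_eventuallyEq ?_
  filter_upwards [isOpen_Ioo.mem_nhds ht] with s hs'
  exact lift_apply hw hs' x
end

section
variable {T : ℝ} {u b : ℝ → E2 → Fin 3 → ℝ} {π : ℝ → E2 → ℝ}

def mkC (hu : ∀ t ∈ Ioo 0 T, ∀ i, IsSchwartz (fun x => u t x i)) (hb : ∀ t ∈ Ioo 0 T, ∀ i, IsSchwartz (fun x => b t x i))
    (du : ∀ t ∈ Ioo 0 T, ∀ x, pd 0 (fun y => u t y 0) x + pd 1 (fun y => u t y 1) x = 0)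
    (db : ∀ t ∈ Ioo 0 T, ∀ x, pd 0 (fun y => b t y 0) x + pd 1 (fun y => b t y 1) x = 0) (t : ℝ) : Cfg where
  u1 := lift T (fun t x => u t x 0) (fun t ht => hu t ht 0) t
  u2 := lift T (fun t x => u t x 1) (fun t ht => hu t ht 1) t
  u3 := lift T (fun t x => u t x 2) (fun t ht => hu t ht 2) t
  b1 := lift T (fun t x => b t x 0) (fun t ht => hb t ht 0) t
  b2 := lift T (fun t x => b t x 1) (fun t ht => hb t ht 1) t
  b3 := lift T (fun t x => b t x 2) (fun t ht => hb t ht 2) t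
  su1 := lift_sch _ t
  su2 := lift_sch _ t
  su3 := lift_sch _ t
  sb1 := lift_sch _ t
  sb2 := lift_sch _ t
  sb3 := lift_sch _ t
  du := by
    by_cases ht : t ∈ Ioo 0 T
    · refine A.ext fun x => ?_
      have h := du t ht x
      rw [← lift_fun (fun t ht => hu t ht 0) ht, ← lift_fun (fun t ht => hu t ht 1) ht] at h
      exact h
    · rw [lift_out _ ht, lift_out _ ht]; simp
  db := by
    by_cases ht : t ∈ Ioo 0 T
    · refine A.ext fun x => ?_
      have h := db t ht x
      rw [← lift_fun (fun t ht => hb t ht 0) ht, ← lift_fun (fun t ht => hb t ht 1) ht] at h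
      exact h
    · rw [lift_out _ ht, lift_out _ ht]; simp

lemma Q_eq (c : Cfg) (n : ℕ) : c.Q n = (∑ i, S n (c.U i)) + ∑ i, S n (c.B i) := by
  simp [Fin.sum_univ_three, Cfg.Q, Cfg.U, Cfg.B]; ring

lemma sch_U (c : Cfg) (i : Fin 3) : Sch (c.U i) := by
  fin_cases i
  exacts [c.su1, c.su2, c.su3]
lemma sch_B (c : Cfg) (i : Fin 3) : Sch (c.B i) := by
  fin_cases i
  exacts [c.sb1, c.sb2, c.sb3]

lemma exists_sol (m : ℕ) (hm : 2 < m) (hsol : IsHallMHDSolution 1 1 1 (Ico 0 T) u b π)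
    (hloc : ∀ T' ∈ Ico (0 : ℝ) T, ∃ C : ℝ, ∀ t ∈ Icc (0 : ℝ) T', hSobNorm m (u t) + hSobNorm m (b t) ≤ C) :
    ∃ s : Sol T, ∀ t ∈ Ioo 0 T, (∀ x i, u t x i = ((s.c t).U i) x) ∧ (∀ x i, b t x i = ((s.c t).B i) x) := by
  have sub : Ioo 0 T ⊆ Ico 0 T := Ioo_subset_Ico_self
  have sub2 : Ioo 0 T ×ˢ (univ : Set E2) ⊆ Ico 0 T ×ˢ univ := prod_mono sub le_rfl
  have hu : ∀ t ∈ Ioo 0 T, ∀ i, IsSchwartz (fun x => u t x i) := fun t ht i => schw_comp (hsol.schwartz_u t (sub ht)) i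
  have hb : ∀ t ∈ Ioo 0 T, ∀ i, IsSchwartz (fun x => b t x i) := fun t ht i => schw_comp (hsol.schwartz_b t (sub ht)) i
  have hq : ∀ t ∈ Ioo 0 T, IsSchwartz (π t) := fun t ht => hsol.schwartz_pi t (sub ht)
  have cu : ∀ i, ContDiffOn ℝ ∞ (fun p : ℝ × E2 => u p.1 p.2 i) (Ioo 0 T ×ˢ univ) := fun i =>
    contDiffOn_pi.1 (hsol.smooth_u.mono sub2) i
  have cb : ∀ i, ContDiffOn ℝ ∞ (fun p : ℝ × E2 => b p.1 p.2 i) (Ioo 0 T ×ˢ univ) := fun i =>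
    contDiffOn_pi.1 (hsol.smooth_b.mono sub2) i
  set c := mkC hu hb (fun t ht => hsol.div_u t (sub ht)) (fun t ht => hsol.div_b t (sub ht)) with hc
  set q := lift T π hq
  have eU : ∀ t ∈ Ioo 0 T, ∀ x i, u t x i = ((c t).U i) x := by
    intro t ht x i
    have h := fun i => (lift_apply (w := fun t x => u t x i) (fun t ht => hu t ht i) ht x).symm
    fin_cases i
    exacts [h 0, h 1, h 2]
  have eB : ∀ t ∈ Ioo 0 T, ∀ x i, b t x i = ((c t).B i) x := by
    intro t ht x i
    have h := fun i => (lift_apply (w := fun t x => b t x i) (fun t ht => hb t ht i) ht x).symm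
    fin_cases i
    exacts [h 0, h 1, h 2]
  have dU : ∀ i, ∀ t ∈ Ioo 0 T, ∀ x, deriv (fun s => u s x i) t
      = (![L (c t).u1 + (c t).F1 - P 0 (q t), L (c t).u2 + (c t).F2 - P 1 (q t), (c t).u3t] i) x := by
    intro i t ht x
    rw [← mom_eq (c t) (q t) (eU t ht) (eB t ht) x i]
    have h := hsol.momentum t (sub ht) x i
    rw [← lift_fun hq ht] at h
    linarith
  have dB : ∀ i, ∀ t ∈ Ioo 0 T, ∀ x, deriv (fun s => b s x i) t = (![(c t).b1t, (c t).b2t, (c t).b3t] i) x := by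
    intro i t ht x
    rw [← ind_eq (c t) (eU t ht) (eB t ht) x i]
    have h := hsol.induction t (sub ht) x i
    linarith
  have base : LBd T (fun t => (c t).Q 3) := by
    intro a b' ha hb'
    rcases lt_or_ge b' 0 with h0 | h0
    · exact ⟨0, fun t ht => absurd (ht.1.trans ht.2) (by linarith)⟩
    obtain ⟨C, hC⟩ := hloc b' ⟨h0, hb'⟩
    obtain ⟨K, K0, hK⟩ := hs_low m
    refine ⟨6 * (K * C ^ 2), fun t ht => ?_⟩
    have ht0 : t ∈ Ioo 0 T := ⟨ha.trans_le ht.1, ht.2.trans_lt hb'⟩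
    have h := hC t ⟨ht0.1.le, ht.2⟩
    have n1 : 0 ≤ hSobNorm m (u t) := Real.sqrt_nonneg _
    have n2 : 0 ≤ hSobNorm m (b t) := Real.sqrt_nonneg _
    have b1 : ∀ i, S m ((c t).U i) ≤ K * C ^ 2 := fun i =>
      (hK _ _ (hsol.schwartz_u t (sub ht0)).1 (eU t ht0) (sch_U _) i).trans
        (mul_le_mul_of_nonneg_left (pow_le_pow_left₀ n1 (by linarith) 2) K0)
    have b2 : ∀ i, S m ((c t).B i) ≤ K * C ^ 2 := fun i =>
      (hK _ _ (hsol.schwartz_b t (sub ht0)).1 (eB t ht0) (sch_B _) i).trans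
        (mul_le_mul_of_nonneg_left (pow_le_pow_left₀ n2 (by linarith) 2) K0)
    refine ((c t).Q_mono (show 3 ≤ m by omega)).trans ?_
    rw [Q_eq, Fin.sum_univ_three, Fin.sum_univ_three]
    linarith [b1 0, b1 1, b1 2, b2 0, b2 1, b2 2]
  let s : Sol T := ⟨c, q, fun t => lift_sch hq t, lift_evo (fun t ht => hu t ht 0) (cu 0) (dU 0), lift_evo (fun t ht => hu t ht 1) (cu 1) (dU 1),
    lift_evo (fun t ht => hu t ht 2) (cu 2) (dU 2), lift_evo (fun t ht => hb t ht 0) (cb 0) (dB 0), lift_evo (fun t ht => hb t ht 1) (cb 1) (dB 1), lift_evo (fun t ht => hb t ht 2) (cb 2) (dB 2), base⟩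
  exact ⟨s, fun t ht => ⟨eU t ht, eB t ht⟩⟩
end

lemma final (m : ℕ) (hm : 2 < m) (T : ℝ) (hT : 0 < T)
    (u b : ℝ → E2 → (Fin 3 → ℝ)) (π : ℝ → E2 → ℝ)
    (hsol : IsHallMHDSolution 1 1 1 (Set.Ico 0 T) u b π)
    (hloc : ∀ T' ∈ Set.Ico (0 : ℝ) T, ∃ C : ℝ, ∀ t ∈ Set.Icc (0 : ℝ) T',
      hSobNorm m (u t) + hSobNorm m (b t) ≤ C)
    (p : ℝ≥0∞) (r : ℝ) (hp : 2 < p) (hptop : p ≠ ⊤) (hr : 2 ≤ r)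
    (hcrit : ∫⁻ t in Set.Ico (0 : ℝ) T,
        (eLpNorm (fun x => lap (lap (fun y => u t y 2)) x) p volume) ^ r < ⊤) :
    ∃ C : ℝ, ∀ t ∈ Set.Ico (0 : ℝ) T,
      hSobNorm m (u t) + hSobNorm m (b t) ≤ C := by
  obtain ⟨s, hs⟩ := exists_sol m hm hsol hloc
  have hsub : Ico (T/2) T ⊆ Ioo 0 T := fun t ht => ⟨by linarith [ht.1], ht.2⟩
  have h1 : ∫⁻ t in Ico (T/2) T, (eLpNorm (fun x => (L (L (s.c t).u3)) x) p volume) ^ r < ⊤ := by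
    refine lt_of_eq_of_lt ?_ (lt_of_le_of_lt
      (lintegral_mono_set (Ico_subset_Ico_left (by linarith : (0:ℝ) ≤ T/2))) hcrit)
    refine setLIntegral_congr_fun measurableSet_Ico fun t ht => ?_
    have e : (fun y => u t y 2) = fun y => (s.c t).u3 y := funext fun y => (hs t (hsub ht)).1 y 2
    change _ = eLpNorm (fun x => lap (lap (fun y => u t y 2)) x) p volume ^ r
    rw [e]
    rfl
  have hp' : 2 < p.toReal := by
    rw [← ENNReal.toReal_ofNat 2]
    exact (ENNReal.toReal_lt_toReal (by simp) hptop).2 hp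
  obtain ⟨C, hC⟩ := s.main hT hp' (s.crit hT hp hptop hr h1) m
  obtain ⟨K, K0, hK⟩ := hs_up m
  obtain ⟨C0, hC0⟩ := hloc (T/2) ⟨by linarith, by linarith⟩
  refine ⟨max C0 (√(K * C) + √(K * C)), fun t ht => ?_⟩
  rcases le_total t (T/2) with h | h
  · exact (hC0 t ⟨ht.1, h⟩).trans (le_max_left _ _)
  · have ht' : t ∈ Ico (T/2) T := ⟨h, ht.2⟩
    refine le_trans ?_ (le_max_right _ _)
    have hq := hC t ht'
    simp only [Q_eq] at hq
    have nu : 0 ≤ ∑ i, S m ((s.c t).U i) := Finset.sum_nonneg fun i _ => S_nn _ _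
    have nb : 0 ≤ ∑ i, S m ((s.c t).B i) := Finset.sum_nonneg fun i _ => S_nn _ _
    refine add_le_add ?_ ?_
    · refine (hK _ _ (hsol.schwartz_u t ht).1 (hs t (hsub ht')).1 (sch_U _)).trans (Real.sqrt_le_sqrt ?_)
      exact mul_le_mul_of_nonneg_left (by linarith) K0
    · refine (hK _ _ (hsol.schwartz_b t ht).1 (hs t (hsub ht')).2 (sch_B _)).trans (Real.sqrt_le_sqrt ?_)
      exact mul_le_mul_of_nonneg_left (by linarith) K0

end HM
end
end

/-- Theorem 2.3, part (1), `Lᵖ` case: regularity criterion for the 2½-dimensional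
Hall-MHD system (with `ν = η = ε = 1`) in terms of only the third component of velocity:
if `∫₀ᵀ ‖Δ(Δu₃)‖_{Lᵖ}^r dt < ∞` with `2/p + 2/r ≤ 1`, `p ∈ (2,∞)`, then the `Hᵐ` norms
of `(u, b)` remain bounded up to time `T`. -/
theorem regularity_criterion_bilap_u3 (m : ℕ) (hm : 2 < m) (T : ℝ) (hT : 0 < T)
    (u b : ℝ → (Fin 2 → ℝ) → (Fin 3 → ℝ)) (π : ℝ → (Fin 2 → ℝ) → ℝ)
    (hsol : IsHallMHDSolution 1 1 1 (Set.Ico 0 T) u b π)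
    (hloc : ∀ T' ∈ Set.Ico (0 : ℝ) T, ∃ C : ℝ, ∀ t ∈ Set.Icc (0 : ℝ) T',
      hSobNorm m (u t) + hSobNorm m (b t) ≤ C)
    (p : ℝ≥0∞) (r : ℝ) (hp : 2 < p) (hptop : p ≠ ⊤) (hr : 2 ≤ r)
    (hpr : 2 / p + 2 / ENNReal.ofReal r ≤ 1)
    (hcrit : ∫⁻ t in Set.Ico (0 : ℝ) T,
        (eLpNorm (fun x => lap (lap (fun y => u t y 2)) x) p volume) ^ r < ⊤) :
    ∃ C : ℝ, ∀ t ∈ Set.Ico (0 : ℝ) T,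
      hSobNorm m (u t) + hSobNorm m (b t) ≤ C := by
  exact HM.final m hm T hT u b π hsol hloc p r hp hptop hr hcrit
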